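/- Let p = 3. For each integer i ≥ 1 let G_i = GL_2(ℤ/3^i ℤ), with the canonical surjections G_{i+1} → G_i given by reducing matrix entries modulo 3^i, and let inf : H^n(G_i; 𝔽_3) → H^n(G_{i+1}; 𝔽_3) denote the induced inflation maps in group cohomology with trivial coefficients 𝔽_3. Then the direct limit colim_i H^n(G_i; 𝔽_3) is an 𝔽_3-vector space of dimension: 1 if n = 0; 1 if n = 1; 0 if n = 2; 2 if n = 3; and for n ≥ 4, of dimension 3 if n ≡ 0 or 3 (mod 4) and dimension 1 if n ≡ 1 or 2 (mod 4). (This is the additive form of the ring isomorphism H^*_c(GL_2(ℤ_3); 𝔽_3) ≅ 𝔽_3[X] ⊗ Λ(Z_1, Z_2, Z_3) with |Z_1| = 1, |Z_2| = |Z_3| = 3, |X| = 4.) -/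

import Mathlib

/-! Inhomogeneous cochains, cohomology with trivial `𝔽_p` coefficients, inflation maps,
and direct limits along a tower of finite quotients. -/

/-- Inhomogeneous `n`-cochains of `G` with (trivial) `ℤ/p` coefficients. -/
abbrev Cochain (p : ℕ) (G : Type) (n : ℕ) : Type := (Fin n → G) → ZMod p

/-- The inhomogeneous coboundary map for trivial coefficients (the differential of the
standard inhomogeneous cochain complex computing group cohomology). -/
def dCoh (p : ℕ) (G : Type) [Group G] (n : ℕ) :
    Cochain p G n →ₗ[ZMod p] Cochain p G (n + 1) where
  toFun f x := f (fun i => x i.succ) +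
    ∑ j : Fin (n + 1), ((-1 : ZMod p) ^ ((j : ℕ) + 1)) • f (Fin.contractNth j (· * ·) x)
  map_add' f g := by
    funext x
    simp only [Pi.add_apply, smul_add, Finset.sum_add_distrib]
    abel
  map_smul' c f := by
    funext x
    simp only [Pi.smul_apply, smul_eq_mul, RingHom.id_apply, mul_add, Finset.mul_sum]
    congr 1
    exact Finset.sum_congr rfl fun j _ => by ring

/-- `n`-cocycles. -/
def cocycles (p : ℕ) (G : Type) [Group G] (n : ℕ) : Submodule (ZMod p) (Cochain p G n) :=
  LinearMap.ker (dCoh p G n)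

/-- `n`-coboundaries. -/
def coboundaries (p : ℕ) (G : Type) [Group G] : (n : ℕ) → Submodule (ZMod p) (Cochain p G n)
  | 0 => ⊥
  | (n + 1) => LinearMap.range (dCoh p G n)

/-- The `n`-th group cohomology `H^n(G; 𝔽_p)` (trivial coefficients), as cocycles modulo
coboundaries. -/
abbrev Hgrp (p : ℕ) (G : Type) [Group G] (n : ℕ) : Type :=
  (cocycles p G n) ⧸
    (Submodule.comap (cocycles p G n).subtype (coboundaries p G n))

/-- Precomposition of cochains with a group homomorphism. -/
def cochainComap {p : ℕ} {G H : Type} (φ : G → H) (n : ℕ) :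
    Cochain p H n →ₗ[ZMod p] Cochain p G n where
  toFun f x := f (fun i => φ (x i))
  map_add' f g := rfl
  map_smul' c f := rfl

lemma dCoh_cochainComap {p : ℕ} {G H : Type} [Group G] [Group H] (φ : G →* H) (n : ℕ)
    (f : Cochain p H n) :
    dCoh p G n (cochainComap φ n f) = cochainComap φ (n + 1) (dCoh p H n f) := by
  funext x
  show (cochainComap (p := p) φ n f) (fun i => x i.succ) +
      ∑ j : Fin (n + 1), ((-1 : ZMod p) ^ ((j : ℕ) + 1)) •
        (cochainComap (p := p) φ n f) (Fin.contractNth j (· * ·) x) =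
    f (fun i => φ (x i.succ)) + ∑ j : Fin (n + 1), ((-1 : ZMod p) ^ ((j : ℕ) + 1)) •
        f (Fin.contractNth j (· * ·) (fun i => φ (x i)))
  congr 1
  refine Finset.sum_congr rfl fun j _ => ?_
  congr 1
  show f (fun i => φ (Fin.contractNth j (· * ·) x i)) = _
  congr 1
  funext k
  unfold Fin.contractNth
  split_ifs <;> simp

lemma cochainComap_mem_cocycles {p : ℕ} {G H : Type} [Group G] [Group H] (φ : G →* H)
    (n : ℕ) {f : Cochain p H n} (hf : f ∈ cocycles p H n) :
    cochainComap φ n f ∈ cocycles p G n := by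
  have h0 : dCoh p H n f = 0 := hf
  show dCoh p G n (cochainComap φ n f) = 0
  rw [dCoh_cochainComap, h0, map_zero]

/-- The inflation map `H^n(H; 𝔽_p) → H^n(G; 𝔽_p)` induced by a group homomorphism
`φ : G →* H`. -/
def Hmap {p : ℕ} {G H : Type} [Group G] [Group H] (φ : G →* H) (n : ℕ) :
    Hgrp p H n →ₗ[ZMod p] Hgrp p G n :=
  Submodule.mapQ _ _
    ((cochainComap φ n).restrict fun _ hf => cochainComap_mem_cocycles φ n hf)
    (by
      rintro ⟨f, hf⟩ hmem
      rw [Submodule.mem_comap] at hmem ⊢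
      cases n with
      | zero =>
          have : f = 0 := hmem
          simp only [LinearMap.restrict_apply]
          show cochainComap (p := p) φ 0 f ∈ coboundaries p G 0
          rw [this, map_zero]
          exact Submodule.zero_mem _
      | succ n =>
          obtain ⟨g, hg⟩ := hmem
          show cochainComap (p := p) φ (n + 1) f ∈ coboundaries p G (n + 1)
          exact ⟨cochainComap φ n g, by rw [dCoh_cochainComap, hg]; rfl⟩)

/-- Transition maps in the tower: composition of inflations. -/
def Htrans {p : ℕ} {Gseq : ℕ → Type} [∀ i, Group (Gseq i)]
    (π : ∀ i, Gseq (i + 1) →* Gseq i) (n : ℕ) :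
    ∀ i j : ℕ, i ≤ j → Hgrp p (Gseq i) n →ₗ[ZMod p] Hgrp p (Gseq j) n :=
  fun _ _ h => Nat.leRecOn h (fun {k} g => (Hmap (π k) n).comp g) LinearMap.id

namespace GL2Coh

/-! ### Homogeneous cochains on a set -/

/-- Functions of `k` variables in `X`, with values in `𝔽₃`. -/
abbrev Fn (X : Type) (k : ℕ) : Type := (Fin k → X) → ZMod 3

/-- Precomposition as a linear map. -/
def pull {A B : Type} (φ : A → B) : (B → ZMod 3) →ₗ[ZMod 3] (A → ZMod 3) :=
  LinearMap.funLeft (ZMod 3) (ZMod 3) φ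

@[simp] lemma pull_apply {A B : Type} (φ : A → B) (f : B → ZMod 3) (a : A) :
    pull φ f a = f (φ a) := rfl

/-- Fixing the first variable. -/
def fix {X : Type} {k : ℕ} (a : X) : Fn X (k + 1) →ₗ[ZMod 3] Fn X k :=
  pull fun z => Fin.cons a z

@[simp] lemma fix_apply {X : Type} {k : ℕ} (a : X) (f : Fn X (k + 1)) (z : Fin k → X) :
    fix a f z = f (Fin.cons a z) := rfl

/-- The differential on homogeneous cochains. -/
def hd {X : Type} (k : ℕ) : Fn X k →ₗ[ZMod 3] Fn X (k + 1) :=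
  ∑ i : Fin (k + 1), ((-1 : ZMod 3) ^ (i : ℕ)) • pull fun x l => x (i.succAbove l)

lemma hd_apply {X : Type} {k : ℕ} (f : Fn X k) (x : Fin (k + 1) → X) :
    hd k f x = ∑ i : Fin (k + 1), (-1 : ZMod 3) ^ (i : ℕ) * f fun l => x (i.succAbove l) := by
  simp [hd, LinearMap.sum_apply, Finset.sum_apply]

lemma hd_zero {X : Type} (f : Fn X 0) (x : Fin 1 → X) : hd 0 f x = f Fin.elim0 := by
  rw [hd_apply]
  simp
  congr 1
  exact Subsingleton.elim _ _

lemma hd_cons {X : Type} {k : ℕ} (f : Fn X (k + 1)) (a : X) (z : Fin (k + 1) → X) :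
    hd (k + 1) f (Fin.cons a z) = f z - hd k (fix a f) z := by
  rw [hd_apply, Fin.sum_univ_succ, hd_apply, sub_eq_add_neg, ← Finset.sum_neg_distrib]
  congr 1
  · simp
  · refine Finset.sum_congr rfl fun i _ => ?_
    rw [fix_apply, Fin.val_succ, pow_succ]
    have : (fun l => (Fin.cons a z : Fin (k + 2) → X) (i.succ.succAbove l)) =
        Fin.cons a fun l => z (i.succAbove l) := by
      funext l
      refine Fin.cases ?_ (fun l => ?_) l <;> simp
    rw [this]
    ring

lemma fix_hd {X : Type} {k : ℕ} (f : Fn X (k + 1)) (a : X) :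
    fix a (hd (k + 1) f) = f - hd k (fix a f) := by
  funext z
  rw [fix_apply, hd_cons]
  rfl

lemma hd_hd {X : Type} {k : ℕ} (f : Fn X k) : hd (k + 1) (hd k f) = 0 := by
  induction k with
  | zero =>
    funext x
    refine Fin.consCases (fun a z => ?_) x
    rw [hd_cons, hd_zero, hd_zero]
    simp [hd_zero]
  | succ k ih =>
    funext x
    refine Fin.consCases (fun a z => ?_) x
    rw [hd_cons, fix_hd, map_sub, ih]
    simp

lemma hd_pull {X Y : Type} {k : ℕ} (φ : X → Y) (f : Fn Y k) :
    hd k (pull (fun x l => φ (x l)) f) = pull (fun x l => φ (x l)) (hd k f) := by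
  funext x
  simp [hd_apply]

/-- A cocycle in positive degree is the coboundary of its first-variable restriction. -/
lemma eq_hd_fix {X : Type} {k : ℕ} {f : Fn X (k + 1)} (hf : hd (k + 1) f = 0) (a : X) :
    f = hd k (fix a f) := by
  have := fix_hd f a
  rw [hf, map_zero] at this
  exact (sub_eq_zero.1 this.symm)

/-- The maps of the prism operator. -/
def prismMap {X : Type} (θ : X → X) : (k : ℕ) → Fin k → (Fin k → X) → (Fin (k + 1) → X)
  | 0, i, _ => i.elim0
  | k + 1, i, x => Fin.cases (Fin.cons (x 0) fun l => θ (x l))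
      (fun i => Fin.cons (x 0) (prismMap θ k i (Fin.tail x))) i

lemma prismMap_cases {X : Type} (θ : X → X) (k : ℕ) (i : Fin k) (l : Fin (k + 1)) :
    ∃ m, (∀ x, prismMap θ k i x l = x m) ∨ (∀ x, prismMap θ k i x l = θ (x m)) := by
  induction k with
  | zero => exact i.elim0
  | succ k ih =>
    refine Fin.cases ?_ (fun i => ?_) i <;> refine Fin.cases ?_ (fun l => ?_) l
    · exact ⟨0, Or.inl fun x => by simp [prismMap]⟩
    · exact ⟨l, Or.inr fun x => by simp [prismMap]⟩
    · exact ⟨0, Or.inl fun x => by simp [prismMap]⟩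
    · obtain ⟨m, h | h⟩ := ih i l
      · exact ⟨m.succ, Or.inl fun x => by simp [prismMap, h, Fin.tail]⟩
      · exact ⟨m.succ, Or.inr fun x => by simp [prismMap, h, Fin.tail]⟩

lemma prismMap_comp {X : Type} (θ θ' γ : X → X) (h : ∀ x, γ (θ x) = θ' (γ x)) (k : ℕ) (i : Fin k)
    (x : Fin k → X) :
    (fun l => γ (prismMap θ k i x l)) = prismMap θ' k i fun l => γ (x l) := by
  induction k with
  | zero => exact i.elim0
  | succ k ih =>
    funext l
    refine Fin.cases ?_ (fun i => ?_) i <;> refine Fin.cases ?_ (fun l => ?_) l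
    · simp [prismMap]
    · simp [prismMap, h]
    · simp [prismMap]
    · have := congrFun (ih i (Fin.tail x)) l
      simpa [prismMap, Fin.tail_def] using this

/-- The prism operator attached to a self-map of `X`. -/
def prism {X : Type} (θ : X → X) (k : ℕ) : Fn X (k + 1) →ₗ[ZMod 3] Fn X k :=
  ∑ i : Fin k, ((-1 : ZMod 3) ^ (i : ℕ)) • pull (prismMap θ k i)

lemma prism_zero {X : Type} (θ : X → X) : prism θ 0 = 0 := by
  simp [prism]

lemma prism_apply {X : Type} (θ : X → X) {k : ℕ} (f : Fn X (k + 1)) (x : Fin k → X) :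
    prism θ k f x = ∑ i : Fin k, (-1 : ZMod 3) ^ (i : ℕ) * f (prismMap θ k i x) := by
  simp [prism, LinearMap.sum_apply, Finset.sum_apply]

lemma prism_cons {X : Type} (θ : X → X) {k : ℕ} (f : Fn X (k + 2)) (a : X) (z : Fin k → X) :
    prism θ (k + 1) f (Fin.cons a z) =
      f (Fin.cons a (Fin.cons (θ a) fun l => θ (z l))) - prism θ k (fix a f) z := by
  rw [prism_apply, Fin.sum_univ_succ, prism_apply, sub_eq_add_neg, ← Finset.sum_neg_distrib]
  congr 1
  · have : prismMap θ (k + 1) 0 (Fin.cons a z) = Fin.cons a (Fin.cons (θ a) fun l => θ (z l)) := by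
      funext l
      refine Fin.cases ?_ (fun l => ?_) l
      · simp [prismMap]
      · refine Fin.cases ?_ (fun l => ?_) l <;> simp [prismMap]
    simp [this]
  · refine Finset.sum_congr rfl fun i _ => ?_
    rw [Fin.val_succ, pow_succ]
    simp [prismMap]

lemma prism_pull {X : Type} (θ θ' γ : X → X) (h : ∀ x, γ (θ x) = θ' (γ x)) {k : ℕ}
    (f : Fn X (k + 1)) :
    prism θ k (pull (fun x l => γ (x l)) f) = pull (fun x l => γ (x l)) (prism θ' k f) := by
  funext x
  simp [prism_apply, prismMap_comp θ θ' γ h]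

lemma fix_prism {X : Type} (θ : X → X) {k : ℕ} (f : Fn X (k + 2)) (a : X) :
    fix a (prism θ (k + 1) f) =
      pull (fun x l => θ (x l)) (fix (θ a) (fix a f)) - prism θ k (fix a f) := by
  funext z
  rw [fix_apply, prism_cons]
  rfl

lemma hd_prism {X : Type} (θ : X → X) {k : ℕ} (f : Fn X (k + 1)) :
    hd k (prism θ k f) + prism θ (k + 1) (hd (k + 1) f) =
      pull (fun x l => θ (x l)) f - f := by
  induction k with
  | zero =>
    funext x
    refine Fin.consCases (fun a z => ?_) x
    have hz : z = Fin.elim0 := Subsingleton.elim _ _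
    simp only [prism_zero, LinearMap.zero_apply, map_zero, zero_add, Pi.sub_apply, pull_apply]
    rw [prism_cons, prism_zero, hd_cons, hd_zero]
    simp only [LinearMap.zero_apply, Pi.zero_apply, sub_zero, fix_apply, hz]
    congr 2 <;> funext l <;> refine Fin.cases ?_ (fun l => l.elim0) l <;> rfl
  | succ k ih =>
    funext x
    refine Fin.consCases (fun a z => ?_) x
    have h1 := congrFun (ih (fix a f)) z
    rw [Pi.add_apply, hd_cons, prism_cons, fix_prism, fix_hd]
    have h2 : f (fun l => θ ((Fin.cons a z : Fin (k + 2) → X) l)) =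
        f (Fin.cons (θ a) fun l => θ (z l)) := by
      congr 1
      funext l
      refine Fin.cases ?_ (fun l => ?_) l <;> simp
    rw [hd_cons, hd_cons, map_sub, map_sub, hd_pull]
    simp only [Pi.add_apply, Pi.sub_apply, pull_apply] at h1 ⊢
    rw [h2]
    linear_combination h1 - fix_apply a f z

/-! ### Inhomogeneous cochains -/

/-- The inhomogeneous differential attached to a binary operation. -/
def dOp {X : Type} (op : X → X → X) (n : ℕ) : Fn X n →ₗ[ZMod 3] Fn X (n + 1) :=
  pull (fun x l => x l.succ) +
    ∑ j : Fin (n + 1), ((-1 : ZMod 3) ^ ((j : ℕ) + 1)) • pull fun x => Fin.contractNth j op x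

lemma dOp_apply {X : Type} (op : X → X → X) {n : ℕ} (f : Fn X n) (x : Fin (n + 1) → X) :
    dOp op n f x = f (fun l => x l.succ) +
      ∑ j : Fin (n + 1), (-1 : ZMod 3) ^ ((j : ℕ) + 1) * f (Fin.contractNth j op x) := by
  simp [dOp, LinearMap.sum_apply, Finset.sum_apply]

lemma dCoh_eq_dOp (Γ : Type) [Group Γ] (n : ℕ) (f : Fn Γ n) :
    dCoh 3 Γ n f = dOp (· * ·) n f := by
  funext x
  rw [dOp_apply]
  rfl

lemma dOp_pull {X Y : Type} {op : X → X → X} {op' : Y → Y → Y} {φ : X → Y}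
    (h : ∀ a b, φ (op a b) = op' (φ a) (φ b)) {n : ℕ} (f : Fn Y n) :
    dOp op n (pull (fun x l => φ (x l)) f) = pull (fun x l => φ (x l)) (dOp op' n f) := by
  funext x
  simp only [pull_apply, dOp_apply]
  congr 1
  refine Finset.sum_congr rfl fun j _ => ?_
  congr 2
  exact Fin.comp_contractNth op op' h j x

/-- Passage from inhomogeneous to homogeneous cochains. -/
def homog {Γ : Type} [Group Γ] (n : ℕ) : Fn Γ n →ₗ[ZMod 3] Fn Γ (n + 1) :=
  pull fun x l => (x l.castSucc)⁻¹ * x l.succ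

@[simp] lemma homog_apply {Γ : Type} [Group Γ] {n : ℕ} (f : Fn Γ n) (x : Fin (n + 1) → Γ) :
    homog n f x = f fun l => (x l.castSucc)⁻¹ * x l.succ := rfl

/-- Passage from homogeneous to inhomogeneous cochains. -/
def inhom {Γ : Type} [Group Γ] (n : ℕ) : Fn Γ (n + 1) →ₗ[ZMod 3] Fn Γ n :=
  pull fun y => Fin.partialProd y

@[simp] lemma inhom_apply {Γ : Type} [Group Γ] {n : ℕ} (f : Fn Γ (n + 1)) (y : Fin n → Γ) :
    inhom n f y = f (Fin.partialProd y) := rfl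

@[simp] lemma inhom_homog {Γ : Type} [Group Γ] {n : ℕ} (f : Fn Γ n) :
    inhom n (homog n f) = f := by
  funext y
  rw [inhom_apply, homog_apply]
  congr 1
  funext l
  exact Fin.partialProd_right_inv y l

lemma homog_inhom {Γ : Type} [Group Γ] {n : ℕ} {f : Fn Γ (n + 1)}
    (hf : ∀ g x, f (fun l => g * x l) = f x) : homog n (inhom n f) = f := by
  funext x
  rw [homog_apply, inhom_apply]
  conv_rhs => rw [← Fin.partialProd_left_inv x]
  exact (hf _ _).symm

lemma homog_mul {Γ : Type} [Group Γ] {n : ℕ} (f : Fn Γ n) (g : Γ) (x : Fin (n + 1) → Γ) :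
    homog n f (fun l => g * x l) = homog n f x := by
  simp [mul_assoc]

lemma diff_contract {Γ : Type} [Group Γ] {n : ℕ} (x : Fin (n + 2) → Γ) (j : Fin (n + 1)) :
    (fun l : Fin n => (x (j.succ.succAbove l.castSucc))⁻¹ * x (j.succ.succAbove l.succ)) =
      Fin.contractNth j (· * ·) fun l => (x l.castSucc)⁻¹ * x l.succ := by
  funext k
  rw [← Fin.inv_partialProd_mul_eq_contractNth, Fin.succ_succAbove_succ]
  conv_lhs => rw [← Fin.partialProd_left_inv x]
  simp [mul_assoc]

lemma hd_homog {Γ : Type} [Group Γ] {n : ℕ} (f : Fn Γ n) :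
    hd (n + 1) (homog n f) = homog (n + 1) (dOp (· * ·) n f) := by
  funext x
  rw [hd_apply, Fin.sum_univ_succ, homog_apply, homog_apply, dOp_apply]
  congr 1
  · simp
  · refine Finset.sum_congr rfl fun j _ => ?_
    rw [homog_apply, diff_contract x j, Fin.val_succ]

lemma inhom_hd {Γ : Type} [Group Γ] {n : ℕ} {f : Fn Γ (n + 1)}
    (hf : ∀ g x, f (fun l => g * x l) = f x) :
    inhom (n + 1) (hd (n + 1) f) = dOp (· * ·) n (inhom n f) := by
  rw [← inhom_homog (dOp (· * ·) n (inhom n f)), ← hd_homog, homog_inhom hf]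

lemma homog_injective {Γ : Type} [Group Γ] {n : ℕ} {f g : Fn Γ n} (h : homog n f = homog n g) :
    f = g := by
  rw [← inhom_homog f, h, inhom_homog]

lemma dOp_dOp {Γ : Type} [Group Γ] {n : ℕ} (f : Fn Γ n) :
    dOp (· * ·) (n + 1) (dOp (· * ·) n f : Fn Γ (n + 1)) = 0 := by
  apply homog_injective
  rw [← hd_homog, ← hd_homog, hd_hd, map_zero]

/-! ### Polynomial functions -/

/-- Translation of functions on an additive group. -/
def tr {Y : Type} [AddCommGroup Y] (v : Y) : (Y → ZMod 3) →ₗ[ZMod 3] (Y → ZMod 3) :=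
  pull fun y => y + v

@[simp] lemma tr_apply {Y : Type} [AddCommGroup Y] (v : Y) (f : Y → ZMod 3) (y : Y) :
    tr v f y = f (y + v) := rfl

/-- The difference operator. -/
def dif {Y : Type} [AddCommGroup Y] (v : Y) : (Y → ZMod 3) →ₗ[ZMod 3] (Y → ZMod 3) :=
  tr v - LinearMap.id

@[simp] lemma dif_apply {Y : Type} [AddCommGroup Y] (v : Y) (f : Y → ZMod 3) (y : Y) :
    dif v f y = f (y + v) - f y := rfl

lemma dif_comm {Y : Type} [AddCommGroup Y] (v w : Y) (f : Y → ZMod 3) :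
    dif v (dif w f) = dif w (dif v f) := by
  funext y
  simp only [dif_apply, add_right_comm y v w]
  ring

lemma dif_add {Y : Type} [AddCommGroup Y] (v w : Y) (f : Y → ZMod 3) :
    dif (v + w) f = tr w (dif v f) + dif w f := by
  funext y
  simp only [dif_apply, tr_apply, Pi.add_apply, add_assoc, add_comm v w]
  ring

/-- Polynomial functions of degree less than `m`. -/
def Pol (Y : Type) [AddCommGroup Y] : ℕ → Submodule (ZMod 3) (Y → ZMod 3)
  | 0 => ⊥
  | m + 1 => ⨅ v : Y, (Pol Y m).comap (dif v)

lemma mem_pol_zero {Y : Type} [AddCommGroup Y] {f : Y → ZMod 3} : f ∈ Pol Y 0 ↔ f = 0 :=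
  Submodule.mem_bot _

lemma mem_pol_succ {Y : Type} [AddCommGroup Y] {m : ℕ} {f : Y → ZMod 3} :
    f ∈ Pol Y (m + 1) ↔ ∀ v, dif v f ∈ Pol Y m := by
  simp [Pol]

lemma pol_le_succ {Y : Type} [AddCommGroup Y] (m : ℕ) : Pol Y m ≤ Pol Y (m + 1) := by
  induction m with
  | zero => exact bot_le
  | succ m ih =>
    intro f hf
    rw [mem_pol_succ] at hf ⊢
    exact fun v => ih (hf v)

lemma pol_mono {Y : Type} [AddCommGroup Y] {m n : ℕ} (h : m ≤ n) : Pol Y m ≤ Pol Y n :=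
  monotone_nat_of_le_succ pol_le_succ h

lemma mem_pol_one {Y : Type} [AddCommGroup Y] {f : Y → ZMod 3} :
    f ∈ Pol Y 1 ↔ ∀ y v, f (y + v) = f y := by
  simp only [mem_pol_succ, mem_pol_zero, funext_iff, dif_apply, Pi.zero_apply, sub_eq_zero]
  exact forall_comm

/-- A map whose differences are constant. -/
def IsAff {X Y : Type} [AddCommGroup X] [AddCommGroup Y] (α : X → Y) : Prop :=
  ∀ v, ∃ c, ∀ x, α (x + v) = α x + c

/-- A map whose differences are affine. -/
def IsQuad {X Y : Type} [AddCommGroup X] [AddCommGroup Y] (β : X → Y) : Prop :=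
  ∀ v, IsAff fun x => β (x + v) - β x

lemma IsAff.pol {X Y : Type} [AddCommGroup X] [AddCommGroup Y] {α : X → Y} (h : IsAff α) {m : ℕ}
    {f : Y → ZMod 3} (hf : f ∈ Pol Y m) : pull α f ∈ Pol X m := by
  induction m generalizing f with
  | zero => rw [mem_pol_zero.1 hf, map_zero]; exact zero_mem _
  | succ m ih =>
    rw [mem_pol_succ] at hf ⊢
    intro v
    obtain ⟨c, hc⟩ := h v
    convert ih (hf c) using 1
    funext x
    simp [hc]

lemma isAff_hom {X Y : Type} [AddCommGroup X] [AddCommGroup Y] (φ : X →+ Y) : IsAff φ :=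
  fun v => ⟨φ v, fun x => map_add φ x v⟩

lemma pol_pull {X Y : Type} [AddCommGroup X] [AddCommGroup Y] (φ : X →+ Y) {m : ℕ}
    {f : Y → ZMod 3} (hf : f ∈ Pol Y m) : pull φ f ∈ Pol X m :=
  (isAff_hom φ).pol hf

lemma isAff_pi {X : Type} [AddCommGroup X] {ι : Type} {Y : Type} [AddCommGroup Y]
    {α : X → ι → Y} (h : ∀ i, IsAff fun x => α x i) : IsAff α := by
  intro v
  choose c hc using fun i => h i v
  exact ⟨c, fun x => funext fun i => hc i x⟩

lemma pol_tr {Y : Type} [AddCommGroup Y] {m : ℕ} {f : Y → ZMod 3} (w : Y) (hf : f ∈ Pol Y m) :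
    tr w f ∈ Pol Y m :=
  IsAff.pol (fun v => ⟨v, fun x => add_right_comm x v w⟩) hf

/-- The vectors along which the difference of `f` has degree less than `m`. -/
def difSet {Y : Type} [AddCommGroup Y] (m : ℕ) (f : Y → ZMod 3) : AddSubmonoid Y where
  carrier := {v | dif v f ∈ Pol Y m}
  zero_mem' := by
    have : dif 0 f = 0 := by funext y; simp
    simp only [Set.mem_ofPred_eq, this]
    exact zero_mem _
  add_mem' := fun {v w} hv hw => by
    simp only [Set.mem_ofPred_eq, dif_add] at *
    exact add_mem (pol_tr w hv) hw

lemma mem_difSet {Y : Type} [AddCommGroup Y] {m : ℕ} {f : Y → ZMod 3} {v : Y} :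
    v ∈ difSet m f ↔ dif v f ∈ Pol Y m := Iff.rfl

/-- Functions which are periodic modulo a power of `3`. -/
def Per (Y : Type) [AddCommGroup Y] (i : ℕ) : Submodule (ZMod 3) (Y → ZMod 3) where
  carrier := {f | ∀ y v, f (y + 3 ^ i • v) = f y}
  zero_mem' := fun _ _ => rfl
  add_mem' := fun hf hg y v => by simp only [Pi.add_apply, hf y v, hg y v]
  smul_mem' := fun c f hf y v => by simp only [Pi.smul_apply, hf y v]

lemma per_mono {Y : Type} [AddCommGroup Y] : Monotone (Per Y) := by
  intro i j h f hf y v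
  obtain ⟨k, rfl⟩ := Nat.exists_eq_add_of_le h
  rw [pow_add, mul_smul]
  exact hf _ _

/-- Locally constant functions. -/
def LC (Y : Type) [AddCommGroup Y] : Submodule (ZMod 3) (Y → ZMod 3) := ⨆ i, Per Y i

lemma mem_LC {Y : Type} [AddCommGroup Y] {f : Y → ZMod 3} : f ∈ LC Y ↔ ∃ i, f ∈ Per Y i :=
  Submodule.mem_iSup_of_directed _ per_mono.directed_le

lemma per_tr {Y : Type} [AddCommGroup Y] {i : ℕ} {f : Y → ZMod 3} (w : Y) (hf : f ∈ Per Y i) :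
    tr w f ∈ Per Y i := by
  intro y v
  rw [tr_apply, tr_apply, add_right_comm, hf]

lemma per_dif {Y : Type} [AddCommGroup Y] {i : ℕ} {f : Y → ZMod 3} (w : Y) (hf : f ∈ Per Y i) :
    dif w f ∈ Per Y i :=
  sub_mem (per_tr w hf) hf

lemma LC_tr {Y : Type} [AddCommGroup Y] {f : Y → ZMod 3} (w : Y) (hf : f ∈ LC Y) :
    tr w f ∈ LC Y := by
  obtain ⟨i, hi⟩ := mem_LC.1 hf
  exact mem_LC.2 ⟨i, per_tr w hi⟩

lemma LC_pull {X Y : Type} [AddCommGroup X] [AddCommGroup Y] (φ : X →+ Y)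
    {f : Y → ZMod 3} (hf : f ∈ LC Y) : pull φ f ∈ LC X := by
  obtain ⟨i, hi⟩ := mem_LC.1 hf
  refine mem_LC.2 ⟨i, fun y v => ?_⟩
  rw [pull_apply, map_add, map_nsmul, hi, pull_apply]

lemma per_mem_difSet {Y : Type} [AddCommGroup Y] {i m : ℕ} {f : Y → ZMod 3} (hf : f ∈ Per Y i)
    (v : Y) : 3 ^ i • v ∈ difSet m f := by
  have : dif (3 ^ i • v) f = 0 := by
    funext y
    simp [hf y v]
  rw [mem_difSet, this]
  exact zero_mem _

lemma tr_iterate {Y : Type} [AddCommGroup Y] (v : Y) (n : ℕ) (f : Y → ZMod 3) :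
    (tr v ^ n) f = tr (n • v) f := by
  induction n generalizing f with
  | zero => funext y; simp
  | succ n ih =>
    funext y
    rw [pow_succ, Module.End.mul_apply, ih]
    simp [succ_nsmul, add_assoc]

lemma dif_pow {Y : Type} [AddCommGroup Y] (v : Y) (i : ℕ) (f : Y → ZMod 3) :
    (dif v ^ 3 ^ i) f = dif (3 ^ i • v) f := by
  have : CharP (Module.End (ZMod 3) (Y → ZMod 3)) 3 :=
    charP_of_injective_algebraMap (algebraMap (ZMod 3) _).injective 3
  have h : dif v ^ 3 ^ i = tr v ^ 3 ^ i - 1 := by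
    have := sub_pow_char_pow_of_commute 3 i
      (Commute.one_right (tr v : Module.End (ZMod 3) (Y → ZMod 3)))
    rw [one_pow] at this
    exact this
  rw [h, LinearMap.sub_apply, tr_iterate]
  rfl

/-- Locally constant functions on a topologically finitely generated group are polynomial. -/
lemma exists_pol {Y : Type} [AddCommGroup Y] {ι : Type} [Fintype ι] (e : ι → Y) (i : ℕ)
    (he : ∀ v, ∃ a : ι → ℕ, ∃ w, v = ∑ s, a s • e s + 3 ^ i • w)
    {f : Y → ZMod 3} (hf : f ∈ Per Y i) : ∃ m, f ∈ Pol Y m := by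
  classical
  have key : ∀ N : ℕ, ∀ n : ι → ℕ, ∑ s, n s = N → ∀ f ∈ Per Y i,
      (∀ s, (dif (e s) ^ n s) f = 0) → f ∈ Pol Y (N + 1) := by
    intro N
    induction N with
    | zero =>
      intro n hn f hf h
      rw [mem_pol_succ]
      intro v
      obtain ⟨a, w, rfl⟩ := he v
      refine (difSet 0 f).add_mem (sum_mem fun s _ => nsmul_mem ?_ _) (per_mem_difSet hf w)
      have h0 : n s = 0 := by
        rw [Finset.sum_eq_zero_iff] at hn
        exact hn s (Finset.mem_univ s)
      have := h s
      rw [h0] at this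
      have hf0 : f = 0 := this
      rw [mem_difSet, hf0, map_zero]
      exact zero_mem _
    | succ N ih =>
      intro n hn f hf h
      rw [mem_pol_succ]
      intro v
      obtain ⟨a, w, rfl⟩ := he v
      refine (difSet (N + 1) f).add_mem (sum_mem fun s _ => nsmul_mem ?_ _)
        (per_mem_difSet hf w)
      rw [mem_difSet]
      rcases Nat.eq_zero_or_pos (n s) with h0 | h0
      · have := h s
        rw [h0] at this
        have hf0 : f = 0 := this
        rw [hf0, map_zero]
        exact zero_mem _
      · refine ih (Function.update n s (n s - 1)) ?_ _ (per_dif _ hf) fun t => ?_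
        · rw [Finset.sum_update_of_mem (Finset.mem_univ s)]
          rw [← Finset.add_sum_erase _ _ (Finset.mem_univ s)] at hn
          rw [Finset.sdiff_singleton_eq_erase]
          omega
        · by_cases hts : t = s
          · subst hts
            rw [Function.update_self, ← Module.End.mul_apply, ← pow_succ, Nat.sub_add_cancel h0]
            exact h t
          · rw [Function.update_of_ne hts]
            have hc : Commute (dif (e t) ^ n t) (dif (e s)) :=
              Commute.pow_left (LinearMap.ext fun g => dif_comm _ _ g) _
            have := LinearMap.congr_fun hc.eq f
            rw [Module.End.mul_apply, Module.End.mul_apply, h t, map_zero] at this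
            exact this
  refine ⟨_, key _ (fun _ => 3 ^ i) rfl f hf fun s => ?_⟩
  rw [dif_pow]
  funext y
  simp [hf y (e s)]

/-- Multiplication by an additive character raises the degree by at most one. -/
lemma pol_mul_char {Y : Type} [AddCommGroup Y] (χ : Y →+ ZMod 3) {m : ℕ} {f : Y → ZMod 3}
    (hf : f ∈ Pol Y m) : (fun y => χ y * f y) ∈ Pol Y (m + 1) := by
  induction m generalizing f with
  | zero =>
    rw [mem_pol_zero.1 hf]
    simp only [Pi.zero_apply, mul_zero]
    exact zero_mem _
  | succ m ih =>
    rw [mem_pol_succ]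
    intro v
    have h1 := ih (mem_pol_succ.1 hf v)
    have h2 : dif v (fun y => χ y * f y) =
        (fun y => χ y * dif v f y) + χ v • tr v f := by
      funext y
      simp only [dif_apply, map_add, Pi.add_apply, Pi.smul_apply, tr_apply, smul_eq_mul]
      ring
    rw [h2]
    exact add_mem h1 (Submodule.smul_mem _ _ (pol_tr v hf))

/-- Shifting by a multiple of three lowers the degree by two, jointly in both variables. -/
lemma pol_shift {Y : Type} [AddCommGroup Y] {m : ℕ} {f : Y → ZMod 3} (hf : f ∈ Pol Y (m + 2)) :
    (fun p : Y × Y => f (p.1 + 3 • p.2) - f p.1) ∈ Pol (Y × Y) m := by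
  induction m generalizing f with
  | zero =>
    rw [mem_pol_zero]
    funext p
    have h := mem_pol_one.1 (mem_pol_succ.1 hf p.2)
    have h1 := h p.1 p.2
    have h2 := h p.1 (p.2 + p.2)
    simp only [dif_apply, ← add_assoc] at h1 h2
    have h3 : p.1 + 3 • p.2 = p.1 + p.2 + p.2 + p.2 := by abel
    rw [h3, Pi.zero_apply]
    have h4 : (3 : ZMod 3) = 0 := rfl
    linear_combination h2 + h1 + (f (p.1 + p.2) - f p.1) * h4
  | succ m ih =>
    rw [mem_pol_succ]
    rintro ⟨v, w⟩
    have h1 := ih (mem_pol_succ.1 hf (v + 3 • w))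
    have h3 : dif (3 • w) f ∈ Pol Y m := by
      have := dif_pow w 1 f
      rw [pow_one] at this
      rw [← this]
      exact mem_pol_succ.1 (mem_pol_succ.1 (mem_pol_succ.1 hf w) w) w
    have h4 := pol_pull (AddMonoidHom.fst Y Y) (pol_tr v h3)
    convert add_mem h1 h4 using 1
    funext p
    simp only [dif_apply, Pi.add_apply, pull_apply, tr_apply, Prod.fst_add, Prod.snd_add,
      AddMonoidHom.coe_fst, smul_add]
    have e1 : p.1 + v + (3 • p.2 + 3 • w) = p.1 + 3 • p.2 + (v + 3 • w) := by abel
    have e2 : p.1 + (v + 3 • w) = p.1 + v + 3 • w := by abel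
    rw [e1, e2]
    ring

lemma dif_comp_quad {X Y : Type} [AddCommGroup X] [AddCommGroup Y] {α β : X → Y}
    {v : X} {c : Y} (hc : ∀ x, α (x + v) = α x + c) (f : Y → ZMod 3) :
    dif v (pull (fun x => α x + 3 • β x) f) = pull (fun x => α x + 3 • β x) (dif c f) +
      pull (fun x => ((α x, β (x + v) - β x) : Y × Y) + 3 • ((β x, 0) : Y × Y))
        (fun p : Y × Y => tr c f (p.1 + 3 • p.2) - tr c f p.1) := by
  funext x
  simp only [dif_apply, Pi.add_apply, pull_apply, tr_apply, Prod.fst_add, Prod.snd_add, hc,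
    Prod.smul_fst, Prod.smul_snd, smul_zero, add_zero]
  have e1 : α x + c + 3 • β (x + v) = α x + 3 • β x + 3 • (β (x + v) - β x) + c := by
    rw [smul_sub]; abel
  rw [e1]
  ring

lemma IsAff.prodMk {X Y Z : Type} [AddCommGroup X] [AddCommGroup Y] [AddCommGroup Z]
    {α : X → Y} {β : X → Z} (hα : IsAff α) (hβ : IsAff β) : IsAff fun x => (α x, β x) := by
  intro v
  obtain ⟨a, ha⟩ := hα v
  obtain ⟨b, hb⟩ := hβ v
  exact ⟨(a, b), fun x => by simp [ha, hb]⟩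

lemma IsQuad.prodZero {X Y Z : Type} [AddCommGroup X] [AddCommGroup Y] [AddCommGroup Z]
    {β : X → Y} (hβ : IsQuad β) : IsQuad fun x => (β x, (0 : Z)) := by
  intro v w
  obtain ⟨b, hb⟩ := hβ v w
  exact ⟨(b, 0), fun x => by simp [hb]⟩

lemma pol_comp_quad {m : ℕ} : ∀ {X Y : Type} [AddCommGroup X] [AddCommGroup Y] {α β : X → Y}
    (_ : IsAff α) (_ : IsQuad β) {f : Y → ZMod 3} (_ : f ∈ Pol Y m),
    pull (fun x => α x + 3 • β x) f ∈ Pol X m := by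
  induction m using Nat.strong_induction_on with
  | _ m ih =>
    intro X Y _ _ α β hα hβ f hf
    match m, ih, hf with
    | 0, _, hf => rw [mem_pol_zero.1 hf, map_zero]; exact zero_mem _
    | 1, _, hf =>
      rw [mem_pol_one] at hf ⊢
      have hconst : ∀ a b, f a = f b := fun a b => by
        rw [← hf b (a - b)]; congr 1; abel
      exact fun y v => hconst _ _
    | m + 2, ih, hf =>
      rw [mem_pol_succ]
      intro v
      obtain ⟨c, hc⟩ := hα v
      rw [dif_comp_quad hc]
      refine add_mem (ih (m + 1) (by omega) hα hβ (mem_pol_succ.1 hf c)) (pol_le_succ _ ?_)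
      exact ih m (by omega) (hα.prodMk (hβ v)) hβ.prodZero (pol_shift (pol_tr c hf))

/-- A quadratic perturbation divisible by three changes a polynomial function by lower terms. -/
lemma pol_quad_sub {X Y : Type} [AddCommGroup X] [AddCommGroup Y] {α β : X → Y}
    (hα : IsAff α) (hβ : IsQuad β) {m : ℕ} {f : Y → ZMod 3} (hf : f ∈ Pol Y (m + 1)) :
    pull (fun x => α x + 3 • β x) f - pull α f ∈ Pol X m := by
  induction m generalizing f with
  | zero =>
    rw [mem_pol_zero]
    rw [mem_pol_one] at hf
    funext x
    simp [hf]
  | succ m ih =>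
    rw [mem_pol_succ]
    intro v
    obtain ⟨c, hc⟩ := hα v
    have h1 : dif v (pull α f) = pull α (dif c f) := by
      funext x
      simp [hc]
    rw [map_sub, dif_comp_quad hc, h1, add_sub_right_comm]
    exact add_mem (ih (mem_pol_succ.1 hf c))
      (pol_comp_quad (hα.prodMk (hβ v)) hβ.prodZero (pol_shift (pol_tr c hf)))

/-! ### Antidifferences -/

/-- The residue of a `3`-adic integer modulo `3 ^ N`, as a natural number. -/
noncomputable def res (N : ℕ) (c : ℤ_[3]) : ℕ := (PadicInt.toZModPow N c).val

lemma res_lt (N : ℕ) (c : ℤ_[3]) : res N c < 3 ^ N := ZMod.val_lt _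

lemma exists_res (N : ℕ) (c : ℤ_[3]) : ∃ w, c = res N c • (1 : ℤ_[3]) + 3 ^ N • w := by
  have h : c - res N c ∈ RingHom.ker (PadicInt.toZModPow N : ℤ_[3] →+* ZMod (3 ^ N)) := by
    rw [RingHom.mem_ker, map_sub, map_natCast, res, ZMod.natCast_zmod_val, sub_self]
  rw [PadicInt.ker_toZModPow, Ideal.mem_span_singleton'] at h
  obtain ⟨w, hw⟩ := h
  refine ⟨w, ?_⟩
  simp only [nsmul_eq_mul, mul_one, Nat.cast_pow, Nat.cast_ofNat] at hw ⊢
  linear_combination -hw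

lemma res_add_pow (N : ℕ) (c w : ℤ_[3]) : res N (c + 3 ^ N • w) = res N c := by
  have h : PadicInt.toZModPow N (3 ^ N • w) = 0 := by
    rw [nsmul_eq_mul, map_mul, map_natCast, ZMod.natCast_self, zero_mul]
  rw [res, map_add, h, add_zero, res]

lemma res_add_one (N : ℕ) (c : ℤ_[3]) :
    res N (c + 1) = if res N c + 1 = 3 ^ N then 0 else res N c + 1 := by
  have h : res N (c + 1) = (res N c + 1) % 3 ^ N := by
    rw [res, res, map_add, map_one, ZMod.val_add, ZMod.val_one_eq_one_mod]
    simp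
  rw [h]
  split_ifs with h1
  · rw [h1, Nat.mod_self]
  · exact Nat.mod_eq_of_lt (lt_of_le_of_ne (res_lt N c) h1)

lemma sum_periodic (i : ℕ) (φ : ℕ → ZMod 3) (h : ∀ l, φ (l + 3 ^ i) = φ l) :
    ∑ l ∈ Finset.range (3 ^ (i + 1)), φ l = 0 := by
  have e : 3 ^ (i + 1) = 3 ^ i + 3 ^ i + 3 ^ i := by ring
  rw [e, Finset.sum_range_add, Finset.sum_range_add]
  have h1 : ∀ l, φ (3 ^ i + l) = φ l := fun l => by rw [add_comm, h]
  have h2 : ∀ l, φ (3 ^ i + 3 ^ i + l) = φ l := fun l => by rw [add_assoc, h1, h1]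
  simp only [h1, h2]
  generalize ∑ l ∈ Finset.range (3 ^ i), φ l = S
  revert S
  decide

/-- Summation along the direction `j`. -/
noncomputable def antidif {Y : Type} [AddCommGroup Y] (τ : Y →+ ℤ_[3]) (j : ℤ_[3] →+ Y) (N : ℕ)
    (G : Y → ZMod 3) (a : Y) : ZMod 3 :=
  ∑ l ∈ Finset.range (res N (τ a)), G (a - j (τ a) + l • j 1)

section

variable {Y : Type} [AddCommGroup Y] {τ : Y →+ ℤ_[3]} {j : ℤ_[3] →+ Y}

lemma dif_antidif (h : ∀ c, τ (j c) = c) {i : ℕ} {G : Y → ZMod 3} (hG : G ∈ Per Y i) :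
    dif (j 1) (antidif τ j (i + 1) G) = G := by
  funext a
  obtain ⟨w, hw⟩ := exists_res (i + 1) (τ a)
  have hb : a + j 1 - j (τ (a + j 1)) = a - j (τ a) := by
    rw [map_add, map_add, h]; abel
  have hGa : G (a - j (τ a) + res (i + 1) (τ a) • j 1) = G a := by
    conv_rhs => rw [← sub_add_cancel a (j (τ a))]
    nth_rw 4 [hw]
    rw [map_add, map_nsmul, map_nsmul, ← add_assoc]
    exact ((per_mono (Nat.le_succ i) hG) _ _).symm
  rw [dif_apply, antidif, antidif, hb, map_add τ, h, res_add_one]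
  split_ifs with hN
  · have hs := sum_periodic i (fun l => G (a - j (τ a) + l • j 1)) fun l => by
      rw [add_nsmul, ← add_assoc]
      exact hG _ _
    rw [← hN, Finset.sum_range_succ, hGa] at hs
    rw [Finset.sum_range_zero]
    linear_combination -hs
  · rw [Finset.sum_range_succ, hGa]
    ring

lemma dif_antidif_ker {N : ℕ} {G : Y → ZMod 3} {v : Y} (hv : τ v = 0) :
    dif v (antidif τ j N G) = antidif τ j N (dif v G) := by
  funext a
  simp only [dif_apply, antidif, map_add, hv, add_zero]
  rw [← Finset.sum_sub_distrib]
  refine Finset.sum_congr rfl fun l _ => ?_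
  congr 2
  abel

lemma antidif_per {i : ℕ} {G : Y → ZMod 3} (hG : G ∈ Per Y i) :
    antidif τ j (i + 1) G ∈ Per Y (i + 1) := by
  intro a v
  simp only [antidif, map_add, map_nsmul, res_add_pow]
  refine Finset.sum_congr rfl fun l _ => ?_
  have e : a + 3 ^ (i + 1) • v - (j (τ a) + 3 ^ (i + 1) • j (τ v)) + l • j 1 =
      a - j (τ a) + l • j 1 + 3 ^ (i + 1) • (v - j (τ v)) := by
    rw [smul_sub]; abel
  rw [e]
  exact per_mono (Nat.le_succ i) hG _ _

lemma antidif_zero {N : ℕ} : antidif τ j N 0 = 0 := by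
  funext a
  simp [antidif]

lemma antidif_pol (h : ∀ c, τ (j c) = c) {i m : ℕ} {G : Y → ZMod 3} (hG : G ∈ Per Y i)
    (hm : G ∈ Pol Y m) : antidif τ j (i + 1) G ∈ Pol Y (m + 1) := by
  induction m generalizing G with
  | zero =>
    rw [mem_pol_zero.1 hm, antidif_zero]
    exact zero_mem _
  | succ m ih =>
    rw [mem_pol_succ]
    intro v
    obtain ⟨w, hw⟩ := exists_res (i + 1) (τ v)
    have hv : v = (v - j (τ v)) + (res (i + 1) (τ v) • j 1 + 3 ^ (i + 1) • j w) := by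
      conv_lhs => rw [← sub_add_cancel v (j (τ v))]
      congr 1
      conv_lhs => rw [hw]
      rw [map_add, map_nsmul, map_nsmul]
    rw [hv]
    refine (difSet (m + 1) _).add_mem ?_ ((difSet (m + 1) _).add_mem
      ((difSet (m + 1) _).nsmul_mem ?_ _) (per_mem_difSet (antidif_per hG) _))
    · rw [mem_difSet, dif_antidif_ker (by rw [map_sub, h, sub_self])]
      exact ih (per_dif _ hG) (mem_pol_succ.1 hm _)
    · rw [mem_difSet, dif_antidif h hG]
      exact hm

lemma exists_antidif (h : ∀ c, τ (j c) = c) {m : ℕ} {G : Y → ZMod 3} (hG : G ∈ LC Y)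
    (hm : G ∈ Pol Y m) : ∃ I, I ∈ LC Y ∧ I ∈ Pol Y (m + 1) ∧ dif (j 1) I = G ∧
      ∀ v, τ v = 0 → dif v G = 0 → dif v I = 0 := by
  obtain ⟨i, hi⟩ := mem_LC.1 hG
  refine ⟨antidif τ j (i + 1) G, mem_LC.2 ⟨_, antidif_per hi⟩, antidif_pol h hi hm,
    dif_antidif h hi, fun v hv h0 => ?_⟩
  rw [dif_antidif_ker hv, h0, antidif_zero]

end

/-! ### Cohomology of a free abelian pro-3 group -/

/-- The cochains which are invariant under simultaneous translation by `v`. -/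
def diag {A : Type} [AddCommGroup A] (k : ℕ) : A →+ (Fin k → A) where
  toFun a _ := a
  map_zero' := rfl
  map_add' _ _ := rfl

@[simp] lemma diag_apply {A : Type} [AddCommGroup A] (k : ℕ) (a : A) (l : Fin k) :
    diag k a l = a := rfl

lemma hd_tr {A : Type} [AddCommGroup A] {k : ℕ} (f : Fn A k) (v : A) :
    hd k (tr (diag k v) f) = tr (diag (k + 1) v) (hd k f) := by
  funext x
  simp only [hd_apply, tr_apply]
  rfl

lemma hd_dif {A : Type} [AddCommGroup A] {k : ℕ} (f : Fn A k) (v : A) :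
    hd k (dif (diag k v) f) = dif (diag (k + 1) v) (hd k f) := by
  simp only [dif, LinearMap.sub_apply, map_sub, hd_tr]
  rfl

/-- Deleting a coordinate, as an additive map. -/
def delHom (A : Type) [AddCommGroup A] {k : ℕ} (i : Fin (k + 1)) : (Fin (k + 1) → A) →+ (Fin k → A) where
  toFun x l := x (i.succAbove l)
  map_zero' := rfl
  map_add' _ _ := rfl

lemma hd_mem {A : Type} [AddCommGroup A] {k m : ℕ} {f : Fn A k} (hf : f ∈ Pol (Fin k → A) m) :
    hd k f ∈ Pol (Fin (k + 1) → A) m := by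
  rw [hd, LinearMap.sum_apply]
  exact sum_mem fun i _ => Submodule.smul_mem _ _ (pol_pull (delHom A i) hf)

lemma hd_LC {A : Type} [AddCommGroup A] {k : ℕ} {f : Fn A k} (hf : f ∈ LC (Fin k → A)) :
    hd k f ∈ LC (Fin (k + 1) → A) := by
  rw [hd, LinearMap.sum_apply]
  exact sum_mem fun i _ => Submodule.smul_mem _ _ (LC_pull (delHom A i) hf)

/-- The map `prismMap` for an additive endomorphism. -/
def prismHom {A : Type} [AddCommGroup A] (θ : A →+ A) (k : ℕ) (i : Fin k) :
    (Fin k → A) →+ (Fin (k + 1) → A) where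
  toFun := prismMap θ k i
  map_zero' := by
    funext l
    obtain ⟨m, h | h⟩ := prismMap_cases θ k i l <;> simp [h]
  map_add' x y := by
    funext l
    obtain ⟨m, h | h⟩ := prismMap_cases θ k i l <;> simp [h]

lemma prism_mem {A : Type} [AddCommGroup A] (θ : A →+ A) {k m : ℕ} {f : Fn A (k + 1)}
    (hf : f ∈ Pol (Fin (k + 1) → A) m) : prism θ k f ∈ Pol (Fin k → A) m := by
  rw [prism, LinearMap.sum_apply]
  exact sum_mem fun i _ => Submodule.smul_mem _ _ (pol_pull (prismHom θ k i) hf)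

lemma prism_LC {A : Type} [AddCommGroup A] (θ : A →+ A) {k : ℕ} {f : Fn A (k + 1)}
    (hf : f ∈ LC (Fin (k + 1) → A)) : prism θ k f ∈ LC (Fin k → A) := by
  rw [prism, LinearMap.sum_apply]
  exact sum_mem fun i _ => Submodule.smul_mem _ _ (LC_pull (prismHom θ k i) hf)

/-- Composing coordinatewise with an additive map. -/
def mapHom {A B : Type} [AddCommGroup A] [AddCommGroup B] (φ : A →+ B) (k : ℕ) :
    (Fin k → A) →+ (Fin k → B) where
  toFun x l := φ (x l)
  map_zero' := by funext l; simp
  map_add' x y := by funext l; simp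

/-- The homogeneous cochain given by a product of coordinates. -/
def monom {A : Type} [AddCommGroup A] {d n : ℕ} (x : Fin d → A →+ ZMod 3) (s : Fin n → Fin d) :
    Fn A (n + 1) :=
  fun a => ∏ l : Fin n, x (s l) (a l.succ - a l.castSucc)

/-- The span of the products of coordinates with strictly increasing indices. -/
def Mon {A : Type} [AddCommGroup A] {d : ℕ} (x : Fin d → A →+ ZMod 3) (n : ℕ) :
    Submodule (ZMod 3) (Fn A (n + 1)) :=
  Submodule.span (ZMod 3) {f | ∃ s : Fin n → Fin d, StrictMono s ∧ f = monom x s}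

lemma prod_char_pol {Y : Type} [AddCommGroup Y] {n : ℕ} (χ : Fin n → Y →+ ZMod 3) :
    (fun y => ∏ l, χ l y) ∈ Pol Y (n + 1) := by
  induction n with
  | zero =>
    rw [mem_pol_one]
    intro y v
    simp
  | succ n ih =>
    simp only [Fin.prod_univ_succ]
    exact pol_mul_char (χ 0) (ih fun l => χ l.succ)

lemma prod_char_per {Y : Type} [AddCommGroup Y] {n : ℕ} (χ : Fin n → Y →+ ZMod 3) :
    (fun y => ∏ l, χ l y) ∈ Per Y 1 := by
  intro y v
  have h : ∀ l, χ l (3 ^ 1 • v) = 0 := fun l => by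
    rw [map_nsmul, nsmul_eq_mul]
    exact zero_mul _
  simp only [map_add, h, add_zero]

/-- The difference of two consecutive coordinates. -/
def stepHom {A : Type} [AddCommGroup A] {n : ℕ} (l : Fin n) : (Fin (n + 1) → A) →+ A where
  toFun a := a l.succ - a l.castSucc
  map_zero' := by simp
  map_add' a b := by simp only [Pi.add_apply]; abel

lemma mon_pol {A : Type} [AddCommGroup A] {d n : ℕ} {x : Fin d → A →+ ZMod 3} {w : Fn A (n + 1)}
    (hw : w ∈ Mon x n) : w ∈ Pol (Fin (n + 1) → A) (n + 1) := by
  refine Submodule.span_le.2 ?_ hw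
  rintro _ ⟨s, _, rfl⟩
  exact prod_char_pol fun l => (x (s l)).comp (stepHom l)

lemma mon_per {A : Type} [AddCommGroup A] {d n : ℕ} {x : Fin d → A →+ ZMod 3} {w : Fn A (n + 1)}
    (hw : w ∈ Mon x n) : w ∈ Per (Fin (n + 1) → A) 1 := by
  refine Submodule.span_le.2 ?_ hw
  rintro _ ⟨s, _, rfl⟩
  exact prod_char_per fun l => (x (s l)).comp (stepHom l)

lemma mon_inv {A : Type} [AddCommGroup A] {d n : ℕ} {x : Fin d → A →+ ZMod 3} {w : Fn A (n + 1)}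
    (hw : w ∈ Mon x n) (v : A) : dif (diag (n + 1) v) w = 0 := by
  have : Mon x n ≤ LinearMap.ker (dif (diag (n + 1) v)) := by
    refine Submodule.span_le.2 ?_
    rintro _ ⟨s, _, rfl⟩
    rw [SetLike.mem_coe, LinearMap.mem_ker]
    funext a
    simp [monom]
  exact this hw

/-- Every locally constant invariant cocycle is cohomologous to a combination of products of
coordinates, compatibly with degrees. -/
def SpanProp (A : Type) [AddCommGroup A] {d : ℕ} (x : Fin d → A →+ ZMod 3) : Prop :=
  ∀ (n m : ℕ) (f : Fn A (n + 1)), f ∈ LC (Fin (n + 1) → A) → f ∈ Pol (Fin (n + 1) → A) m →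
    (∀ v, dif (diag (n + 1) v) f = 0) → hd (n + 1) f = 0 →
    ∃ g : Fn A n, ∃ w ∈ Mon x n, f = hd n g + w ∧ g ∈ LC (Fin n → A) ∧ g ∈ Pol (Fin n → A) m ∧
      (∀ v, dif (diag n v) g = 0) ∧ (n = 0 → g = 0) ∧ (m ≤ n → w = 0)

section

variable {A B : Type} [AddCommGroup A] [AddCommGroup B] {d : ℕ} {xB : Fin d → B →+ ZMod 3}

lemma span_relative (hB : SpanProp B xB) (ι : B →+ A) (π : A →+ B) (hπ : ∀ b, π (ι b) = b)
    (n m : ℕ) (f : Fn A (n + 1)) (hLC : f ∈ LC (Fin (n + 1) → A))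
    (hm : f ∈ Pol (Fin (n + 1) → A) m)
    (hinv : ∀ b, dif (diag (n + 1) (ι b)) f = 0) (hf : hd (n + 1) f = 0) :
    ∃ g : Fn A n, ∃ w ∈ Mon xB n, f = hd n g + pull (mapHom π (n + 1)) w ∧
      g ∈ LC (Fin n → A) ∧ g ∈ Pol (Fin n → A) m ∧
      (∀ b, dif (diag n (ι b)) g = 0) ∧ (n = 0 → g = 0) ∧ (m ≤ n → w = 0) := by
  have hfB : hd (n + 1) (pull (mapHom ι (n + 1)) f) = 0 := by
    rw [show (mapHom ι (n + 1) : (Fin (n + 1) → B) → _) = fun y l => ι (y l) from rfl, hd_pull, hf,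
      map_zero]
  obtain ⟨g, w, hw, h1, h2, h3, h4, h5, h6⟩ := hB n m (pull (mapHom ι (n + 1)) f)
    (LC_pull _ hLC) (pol_pull _ hm) (fun v => by
      funext y
      have := congrFun (hinv v) (mapHom ι (n + 1) y)
      simp only [dif_apply, pull_apply, map_add] at this ⊢
      exact this) hfB
  have hp := hd_prism (ι.comp π) f
  rw [hf, map_zero, add_zero] at hp
  have e : pull (fun (x : Fin (n + 1) → A) l => (ι.comp π) (x l)) f =
      pull (mapHom π (n + 1)) (pull (mapHom ι (n + 1)) f) := rfl
  have hpull : ∀ u : Fn B n, pull (mapHom π (n + 1)) (hd n u) = hd n (pull (mapHom π n) u) :=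
    fun u => (hd_pull π u).symm
  refine ⟨pull (mapHom π n) g - prism (ι.comp π) n f, w, hw, ?_,
    sub_mem (LC_pull _ h2) (prism_LC _ hLC), sub_mem (pol_pull _ h3) (prism_mem _ hm),
    fun b => ?_, fun h0 => ?_, h6⟩
  · rw [e, h1, map_add, hpull] at hp
    rw [map_sub, hp]
    abel
  · rw [map_sub]
    have e1 : dif (diag n (ι b)) (pull (mapHom π n) g) = 0 := by
      funext y
      have := congrFun (h4 b) (mapHom π n y)
      simp only [dif_apply, pull_apply, map_add, Pi.zero_apply] at this ⊢
      rw [← this]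
      congr 3
      funext l
      simp [mapHom, hπ]
    have e2 : tr (diag n (ι b)) (prism (ι.comp π) n f) = prism (ι.comp π) n f := by
      have := prism_pull (ι.comp π) (ι.comp π) (fun a => a + ι b) (fun a => by simp [hπ]) f
      have h7 : pull (fun (x : Fin (n + 1) → A) l => x l + ι b) f = f := sub_eq_zero.1 (hinv b)
      rw [h7] at this
      exact this.symm
    rw [e1, dif, LinearMap.sub_apply, e2]
    simp
  · subst h0
    rw [h5 rfl, prism_zero]
    simp

lemma hd_char_mul {n : ℕ} (χ : A →+ ZMod 3) {w : Fn A (n + 1)} (hw : hd (n + 1) w = 0)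
    (a : Fin (n + 2) → A) :
    hd (n + 1) (fun y => χ (y 0) * w y) a = χ (a 1 - a 0) * w (Fin.tail a) := by
  refine Fin.consCases (fun c z => ?_) a
  rw [hd_cons]
  have e : fix c (fun y : Fin (n + 1) → A => χ (y 0) * w y) = χ c • fix c w := by
    funext y
    simp
  have e2 := eq_hd_fix hw c
  rw [e, map_smul, ← e2]
  have e3 : (Fin.cons c z : Fin (n + 2) → A) 1 = z 0 := rfl
  rw [e3, Fin.cons_zero, Fin.tail_cons, map_sub]
  simp
  ring

lemma mem_LC_of_per {Y : Type} [AddCommGroup Y] {i : ℕ} {f : Y → ZMod 3} (h : f ∈ Per Y i) :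
    f ∈ LC Y := mem_LC.2 ⟨i, h⟩

lemma LC_mul {Y : Type} [AddCommGroup Y] {f g : Y → ZMod 3} (hf : f ∈ LC Y) (hg : g ∈ LC Y) :
    (fun y => f y * g y) ∈ LC Y := by
  obtain ⟨i, hi⟩ := mem_LC.1 hf
  obtain ⟨j, hj⟩ := mem_LC.1 hg
  refine mem_LC.2 ⟨max i j, fun y v => ?_⟩
  simp only [per_mono (le_max_left i j) hi y v, per_mono (le_max_right i j) hj y v]

set_option maxHeartbeats 400000 in
lemma span_step (hB : SpanProp B xB) (ι : B →+ A) (π : A →+ B) (τ : A →+ ℤ_[3]) (j : ℤ_[3] →+ A)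
    (hπ : ∀ b, π (ι b) = b) (hτ : ∀ c, τ (j c) = c)
    (hτι : ∀ b, τ (ι b) = 0) (hA : ∀ a, ι (π a) + j (τ a) = a) :
    SpanProp A (Fin.cons ((PadicInt.toZMod : ℤ_[3] →+* ZMod 3).toAddMonoidHom.comp τ)
      fun l => (xB l).comp π : Fin (d + 1) → A →+ ZMod 3) := by
  set χ : A →+ ZMod 3 := (PadicInt.toZMod : ℤ_[3] →+* ZMod 3).toAddMonoidHom.comp τ with hχ
  have hχj : χ (j 1) = 1 := by simp [hχ, hτ]
  have hχι : ∀ b, χ (ι b) = 0 := fun b => by simp [hχ, hτι]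
  set xA : Fin (d + 1) → A →+ ZMod 3 := Fin.cons χ fun l => (xB l).comp π with hxA
  have hmon : ∀ n, ∀ w ∈ Mon xB n, pull (mapHom π (n + 1)) w ∈ Mon xA n := by
    intro n w hw
    have : (Mon xB n).map (pull (mapHom π (n + 1))) ≤ Mon xA n := by
      rw [Mon, Submodule.map_span_le]
      rintro _ ⟨s, hs, rfl⟩
      refine Submodule.subset_span ⟨fun l => (s l).succ, fun a b h => Fin.succ_lt_succ_iff.2 (hs h), ?_⟩
      funext a
      simp [monom, hxA, mapHom]
    exact this ⟨w, hw, rfl⟩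
  have hmon' : ∀ n, ∀ w ∈ Mon xB n,
      (fun a : Fin (n + 2) → A => χ (a 1 - a 0) * pull (mapHom π (n + 1)) w (Fin.tail a)) ∈
        Mon xA (n + 1) := by
    intro n w hw
    induction hw using Submodule.span_induction with
    | mem w h =>
      obtain ⟨s, hs, rfl⟩ := h
      refine Submodule.subset_span ⟨Fin.cons 0 fun l => (s l).succ, ?_, ?_⟩
      · refine Fin.strictMono_iff_lt_succ.2 fun i => ?_
        cases n with
        | zero => exact i.elim0
        | succ n =>
          refine Fin.cases ?_ (fun i => ?_) i
          · simp
          · simpa using hs (Fin.castSucc_lt_succ (i := i))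
      · funext a
        rw [monom, Fin.prod_univ_succ]
        simp [monom, hxA, mapHom, Fin.tail]
    | zero => simp only [map_zero, Pi.zero_apply, mul_zero]; exact zero_mem _
    | add u v _ _ hu hv =>
      convert add_mem hu hv using 1
      funext a
      simp only [map_add, Pi.add_apply, mul_add]
    | smul c u _ hu =>
      convert Submodule.smul_mem _ c hu using 1
      funext a
      simp only [map_smul, Pi.smul_apply, smul_eq_mul]
      ring
  intro n m f hLC hm hinv hf
  obtain ⟨g, w, hw, h1, h2, h3, h4, h5, h6⟩ :=
    span_relative hB ι π hπ n m f hLC hm (fun b => hinv _) hf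
  have hwinv : ∀ n, ∀ w ∈ Mon xB n, ∀ v,
      dif (diag (n + 1) v) (pull (mapHom π (n + 1)) w) = 0 := fun n w hw v =>
    mon_inv (hmon n w hw) v
  cases n with
  | zero =>
    refine ⟨0, _, hmon 0 w hw, ?_, zero_mem _, zero_mem _, fun v => map_zero _, fun _ => rfl,
      fun h => by rw [h6 h, map_zero]⟩
    rw [h1, h5 rfl]
  | succ k =>
    obtain rfl | ⟨m, rfl⟩ : m = 0 ∨ ∃ m', m = m' + 1 := by
      cases m
      · exact Or.inl rfl
      · exact Or.inr ⟨_, rfl⟩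
    · rw [mem_pol_zero.1 hm]
      exact ⟨0, 0, zero_mem _, by simp, zero_mem _, zero_mem _, fun v => map_zero _, fun _ => rfl,
        fun _ => rfl⟩
    set D := dif (diag (k + 1) (j 1)) with hD
    have he : hd (k + 1) (D g) = 0 := by
      rw [hD, hd_dif]
      have : hd (k + 1) g = f - pull (mapHom π (k + 1 + 1)) w := by rw [h1]; abel
      rw [this, map_sub, hinv, hwinv _ w hw, sub_zero]
    obtain ⟨G, w', hw', p1, p2, p3, p4, p5, p6⟩ :=
      span_relative hB ι π hπ k m (D g) (sub_mem (LC_tr _ h2) h2)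
        (mem_pol_succ.1 h3 _) (fun b => by rw [hD, dif_comm, h4, map_zero]) he
    obtain ⟨I, i1, i2, i3, i4⟩ : ∃ I : Fn A k, I ∈ LC (Fin k → A) ∧ I ∈ Pol (Fin k → A) (m + 1) ∧
        hd k (dif (diag k (j 1)) I) = hd k G ∧ ∀ b, dif (diag k (ι b)) I = 0 := by
      cases k with
      | zero =>
        rw [p5 rfl]
        exact ⟨0, zero_mem _, zero_mem _, by simp, fun b => map_zero _⟩
      | succ k =>
        obtain ⟨I, i1, i2, i3, i4⟩ := exists_antidif (τ := τ.comp (Pi.evalAddMonoidHom _ 0))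
          (j := (diag (k + 1)).comp j) (fun c => by simp [hτ]) p2 p3
        refine ⟨I, i1, i2, congrArg _ i3, fun b => i4 _ ?_ (p4 b)⟩
        simp [hτι]
    set u : Fn A (k + 1) := fun y => χ (y 0) * pull (mapHom π (k + 1)) w' y with hu
    have hδw' : hd (k + 1) (pull (mapHom π (k + 1)) w') = 0 := by
      have : pull (mapHom π (k + 1)) w' = D g - hd k G := by rw [p1]; abel
      rw [this, map_sub, he, hd_hd, sub_zero]
    have hδu : hd (k + 1) u = fun a => χ (a 1 - a 0) * pull (mapHom π (k + 1)) w' (Fin.tail a) :=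
      funext (hd_char_mul χ hδw')
    have hDu : D u = pull (mapHom π (k + 1)) w' := by
      funext y
      have := congrFun (hwinv k w' hw' (j 1)) y
      simp only [dif_apply, Pi.zero_apply, sub_eq_zero] at this
      simp only [hD, hu, dif_apply, this, Pi.add_apply, map_add, diag_apply, hχj]
      ring
    have huι : ∀ b, dif (diag (k + 1) (ι b)) u = 0 := by
      intro b
      funext y
      have := congrFun (hwinv k w' hw' (ι b)) y
      simp only [dif_apply, Pi.zero_apply, sub_eq_zero] at this
      simp only [hu, dif_apply, this, Pi.add_apply, diag_apply, map_add, hχι, add_zero, sub_self,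
        Pi.zero_apply]
    have huLC : u ∈ LC (Fin (k + 1) → A) := by
      refine LC_mul (mem_LC_of_per (i := 1) fun y v => ?_)
        (mem_LC_of_per (mon_per (hmon k w' hw')))
      have : χ (3 ^ 1 • v 0) = 0 := by
        rw [map_nsmul, nsmul_eq_mul]
        exact zero_mul _
      simp only [Pi.add_apply, Pi.smul_apply, map_add, this, add_zero]
    have hum : u ∈ Pol (Fin (k + 1) → A) (m + 1) := by
      by_cases hmk : m ≤ k
      · have : u = 0 := by
          rw [hu, p6 hmk]
          funext y
          simp
        rw [this]
        exact zero_mem _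
      · have hmul := pol_mul_char (χ.comp (Pi.evalAddMonoidHom (fun _ : Fin (k + 1) => A) 0))
          (mon_pol (hmon k w' hw'))
        exact pol_mono (by omega : k + 1 + 1 ≤ m + 1) hmul
    set g2 := g - hd k I - u with hg2
    have hg2j : dif (diag (k + 1) (j 1)) g2 = 0 := by
      rw [hg2, map_sub, map_sub, ← hd_dif, i3, ← hD, p1, hDu]
      abel
    have hg2ι : ∀ b, dif (diag (k + 1) (ι b)) g2 = 0 := by
      intro b
      rw [hg2, map_sub, map_sub, ← hd_dif, i4, h4, huι]
      simp
    have hg2LC : g2 ∈ LC (Fin (k + 1) → A) := sub_mem (sub_mem h2 (hd_LC i1)) huLC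
    refine ⟨g2, hd (k + 1) u + pull (mapHom π (k + 1 + 1)) w, ?_, ?_, hg2LC,
      sub_mem (sub_mem h3 (hd_mem i2)) hum, fun v => ?_, fun h => absurd h (Nat.succ_ne_zero k),
      fun h => ?_⟩
    · have m1 := hmon' k w' hw'
      have m2 := hmon (k + 1) w hw
      rw [← hδu] at m1
      exact Submodule.add_mem _ m1 m2
    · rw [hg2, map_sub, map_sub, hd_hd, h1]
      abel
    · obtain ⟨i, hi⟩ := mem_LC.1 hg2LC
      obtain ⟨c, hc⟩ := exists_res i (τ v)
      have hv : v = ι (π v) + (res i (τ v) • j 1 + 3 ^ i • j c) := by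
        conv_lhs => rw [← hA v]
        congr 1
        conv_lhs => rw [hc]
        rw [map_add, map_nsmul, map_nsmul]
      rw [← mem_pol_zero, ← mem_difSet, hv, map_add, map_add, map_nsmul, map_nsmul]
      refine (difSet 0 g2).add_mem ?_ ((difSet 0 g2).add_mem
        ((difSet 0 g2).nsmul_mem ?_ _) (per_mem_difSet hi _))
      · rw [mem_difSet, mem_pol_zero, hg2ι]
      · rw [mem_difSet, mem_pol_zero, hg2j]
    · have hu0 : u = 0 := by
        rw [hu, p6 (by omega)]
        funext y
        simp
      rw [hu0, h6 h, map_zero, map_zero, add_zero]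

end

lemma fix_pol {A : Type} [AddCommGroup A] {k m : ℕ} (a : A) {f : Fn A (k + 1)}
    (hf : f ∈ Pol (Fin (k + 1) → A) m) : fix a f ∈ Pol (Fin k → A) m := by
  refine IsAff.pol (isAff_pi fun i => ?_) hf
  refine Fin.cases (fun v => ⟨0, fun x => by simp⟩) (fun i v => ⟨v i, fun x => by simp⟩) i

lemma fix_LC {A : Type} [AddCommGroup A] {k : ℕ} (a : A) {f : Fn A (k + 1)}
    (hf : f ∈ LC (Fin (k + 1) → A)) : fix a f ∈ LC (Fin k → A) := by
  obtain ⟨i, hi⟩ := mem_LC.1 hf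
  refine mem_LC.2 ⟨i, fun y v => ?_⟩
  have := hi (Fin.cons a y) (Fin.cons 0 v)
  rw [fix_apply, fix_apply, ← this]
  congr 1
  funext l
  refine Fin.cases ?_ (fun l => ?_) l <;> simp

lemma span_base (A : Type) [AddCommGroup A] [Subsingleton A] (x : Fin 0 → A →+ ZMod 3) :
    SpanProp A x := by
  intro n m f hLC hm hinv hf
  have hs : ∀ (k : ℕ) (y : Fin k → A), y = 0 := fun k y => Subsingleton.elim _ _
  cases n with
  | zero =>
    by_cases h : m = 0
    · subst h
      rw [mem_pol_zero.1 hm]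
      exact ⟨0, 0, zero_mem _, by simp, zero_mem _, zero_mem _, fun v => map_zero _, fun _ => rfl,
        fun _ => rfl⟩
    · refine ⟨0, f, ?_, by simp, zero_mem _, zero_mem _, fun v => map_zero _, fun _ => rfl,
        fun h' => absurd (Nat.le_zero.1 h') h⟩
      have : f = f 0 • monom x Fin.elim0 := by
        funext y
        rw [hs _ y]
        simp [monom]
      rw [this]
      exact Submodule.smul_mem _ _ (Submodule.subset_span ⟨_, fun a => a.elim0, rfl⟩)
  | succ n =>
    refine ⟨fix 0 f, 0, zero_mem _, ?_, fix_LC 0 hLC, fix_pol 0 hm, fun v => ?_,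
      fun h => absurd h (Nat.succ_ne_zero n), fun _ => rfl⟩
    · rw [add_zero]
      exact eq_hd_fix hf 0
    · funext y
      rw [hs _ (diag (n + 1) v)]
      simp

/-- The coordinates modulo three. -/
noncomputable def coordF (d : ℕ) (l : Fin d) : (Fin d → ℤ_[3]) →+ ZMod 3 :=
  (PadicInt.toZMod : ℤ_[3] →+* ZMod 3).toAddMonoidHom.comp (Pi.evalAddMonoidHom (fun _ => ℤ_[3]) l)

lemma span_fin (d : ℕ) : SpanProp (Fin d → ℤ_[3]) (coordF d) := by
  induction d with
  | zero => exact span_base _ _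
  | succ d ih =>
    let ι : (Fin d → ℤ_[3]) →+ (Fin (d + 1) → ℤ_[3]) :=
      { toFun := fun b => Fin.cons 0 b
        map_zero' := by
          funext l; refine Fin.cases ?_ (fun l => ?_) l <;> simp
        map_add' := fun a b => by
          funext l; refine Fin.cases ?_ (fun l => ?_) l <;> simp }
    let π : (Fin (d + 1) → ℤ_[3]) →+ (Fin d → ℤ_[3]) :=
      { toFun := fun b => Fin.tail b
        map_zero' := rfl
        map_add' := fun a b => rfl }
    let j : ℤ_[3] →+ (Fin (d + 1) → ℤ_[3]) :=
      { toFun := fun c => Fin.cons c 0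
        map_zero' := by
          funext l; refine Fin.cases ?_ (fun l => ?_) l <;> simp
        map_add' := fun a b => by
          funext l; refine Fin.cases ?_ (fun l => ?_) l <;> simp }
    have h := span_step ih ι π (Pi.evalAddMonoidHom (fun _ => ℤ_[3]) 0) j
      (fun b => rfl) (fun c => by simp [j]) (fun b => by simp [ι]) (fun a => by
        funext l
        refine Fin.cases ?_ (fun l => ?_) l
        · exact zero_add (a 0)
        · exact add_zero (a l.succ))
    convert h using 1
    funext l
    refine Fin.cases ?_ (fun l => ?_) l <;> rfl

/-- Consecutive differences. -/
def diffHom (A : Type) [AddCommGroup A] (n : ℕ) : (Fin (n + 1) → A) →+ (Fin n → A) where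
  toFun x l := -x l.castSucc + x l.succ
  map_zero' := by funext l; simp
  map_add' x y := by funext l; simp only [Pi.add_apply]; abel

/-- Partial sums. -/
def psumHom (A : Type) [AddCommGroup A] (n : ℕ) : (Fin n → A) →+ (Fin (n + 1) → A) where
  toFun y := Fin.partialProd (M := Multiplicative A) y
  map_zero' := by
    funext l
    induction l using Fin.induction with
    | zero => exact Fin.partialProd_zero _
    | succ l ih =>
      refine (Fin.partialProd_succ (M := Multiplicative A) _ _).trans ?_
      rw [ih]
      exact add_zero (0 : A)
  map_add' x y := by
    funext l
    induction l using Fin.induction with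
    | zero => exact (add_zero (0 : A)).symm
    | succ l ih =>
      refine (Fin.partialProd_succ (M := Multiplicative A) _ _).trans ?_
      have hx := Fin.partialProd_succ (M := Multiplicative A) x l
      have hy := Fin.partialProd_succ (M := Multiplicative A) y l
      refine (congrArg (fun a : A => a + (x l + y l)) ih).trans ?_
      refine Eq.trans ?_ (congrArg₂ (fun a b : A => a + b) hx hy).symm
      exact add_add_add_comm (G := A) (Fin.partialProd (M := Multiplicative A) x l.castSucc : A)
        (Fin.partialProd (M := Multiplicative A) y l.castSucc : A) (x l) (y l)

/-- The inhomogeneous cochain given by a product of coordinates. -/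
def imonom {A : Type} [AddCommGroup A] {d n : ℕ} (x : Fin d → A →+ ZMod 3) (s : Fin n → Fin d) :
    Fn A n :=
  fun a => ∏ l : Fin n, x (s l) (a l)

/-- The span of products of coordinates with increasing indices. -/
def IMon {A : Type} [AddCommGroup A] {d : ℕ} (x : Fin d → A →+ ZMod 3) (n : ℕ) :
    Submodule (ZMod 3) (Fn A n) :=
  Submodule.span (ZMod 3) {f | ∃ s : Fin n → Fin d, StrictMono s ∧ f = imonom x s}

/-- The differential of the additive group `A`. -/
abbrev dA (A : Type) [AddCommGroup A] (n : ℕ) : Fn A n →ₗ[ZMod 3] Fn A (n + 1) :=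
  dOp (fun a b : A => a + b) n

lemma span_inhom {A : Type} [AddCommGroup A] {d : ℕ} {x : Fin d → A →+ ZMod 3}
    (h : SpanProp A x) (n m : ℕ) (f : Fn A (n + 1)) (hLC : f ∈ LC (Fin (n + 1) → A))
    (hm : f ∈ Pol (Fin (n + 1) → A) m) (hf : dA A (n + 1) f = 0) :
    ∃ g : Fn A n, ∃ w ∈ IMon x (n + 1), f = dA A n g + w ∧ g ∈ LC (Fin n → A) ∧
      g ∈ Pol (Fin n → A) m ∧ (m ≤ n + 1 → w = 0) := by
  have hh : hd (n + 2) (pull (diffHom A (n + 1)) f) = 0 := by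
    have := hd_homog (Γ := Multiplicative A) f
    have h2 : dOp (X := Multiplicative A) (fun a b => a * b) (n + 1) f = 0 := hf
    rw [h2, map_zero] at this
    exact this
  have hinv : ∀ k (u : Fn A k) v, dif (diag (k + 1) v) (pull (diffHom A k) u) = 0 := by
    intro k u v
    funext y
    rw [dif_apply, pull_apply, pull_apply, map_add]
    have : diffHom A k (diag (k + 1) v) = 0 := by
      funext l
      exact neg_add_cancel v
    rw [this, add_zero, sub_self, Pi.zero_apply]
  obtain ⟨g, w, hw, h1, h2, h3, h4, -, h6⟩ := h (n + 1) m (pull (diffHom A (n + 1)) f)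
    (LC_pull _ hLC) (pol_pull _ hm) (hinv _ _) hh
  have hps : pull (psumHom A (n + 1)) (pull (diffHom A (n + 1)) f) = f :=
    inhom_homog (Γ := Multiplicative A) f
  have hg : pull (psumHom A (n + 1)) (hd (n + 1) g) = dA A n (pull (psumHom A n) g) := by
    refine inhom_hd (Γ := Multiplicative A) (f := g) fun v y => ?_
    have h5 := sub_eq_zero.1 (congrFun (h4 v) y)
    refine Eq.trans (congrArg g ?_) h5
    funext l
    exact add_comm (G := A) v (y l)
  refine ⟨pull (psumHom A n) g, pull (psumHom A (n + 1)) w, ?_, ?_, LC_pull _ h2, pol_pull _ h3,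
    fun hmn => by rw [h6 hmn, map_zero]⟩
  · have : (Mon x (n + 1)).map (pull (psumHom A (n + 1))) ≤ IMon x (n + 1) := by
      rw [Mon, Submodule.map_span_le]
      rintro _ ⟨s, hs, rfl⟩
      refine Submodule.subset_span ⟨s, hs, ?_⟩
      funext a
      rw [pull_apply, monom, imonom]
      refine Finset.prod_congr rfl fun l _ => ?_
      congr 1
      have := Fin.partialProd_right_inv (G := Multiplicative A) a l
      rw [← this, sub_eq_neg_add]
      rfl
    exact this ⟨w, hw, rfl⟩
  · rw [← hg, ← map_add, ← h1, hps]

/-! ### An alternating functional -/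

lemma sum_powerset_pol {Y L : Type} [AddCommGroup Y] [DecidableEq L] (y : L → Y) (S : Finset L) :
    ∀ f : Y → ZMod 3, f ∈ Pol Y S.card → ∀ x,
      ∑ E ∈ S.powerset, (-1 : ZMod 3) ^ E.card * f (x + ∑ l ∈ E, y l) = 0 := by
  induction S using Finset.induction_on with
  | empty =>
    intro f hf x
    rw [Finset.card_empty] at hf
    simp [mem_pol_zero.1 hf]
  | insert a S ha ih =>
    intro f hf x
    rw [Finset.card_insert_of_notMem ha] at hf
    have h := ih (dif (y a) f) (mem_pol_succ.1 hf _) x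
    rw [Finset.sum_powerset_insert ha, ← neg_eq_zero, ← h, neg_add, ← sub_eq_neg_add,
      sub_eq_add_neg, ← Finset.sum_neg_distrib, ← Finset.sum_neg_distrib, ← Finset.sum_add_distrib]
    refine Finset.sum_congr rfl fun E hE => ?_
    have haE : a ∉ E := fun h' => ha (Finset.mem_powerset.1 hE h')
    rw [Finset.card_insert_of_notMem haE, Finset.sum_insert haE, dif_apply,
      show x + (y a + ∑ l ∈ E, y l) = x + ∑ l ∈ E, y l + y a by abel]
    ring

/-- The alternating sum of all iterated differences of a cochain at the origin. -/
def alt {A : Type} [AddCommGroup A] {n : ℕ} (v : Fin n → A) : Fn A n →ₗ[ZMod 3] ZMod 3 :=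
  ∑ σ : Equiv.Perm (Fin n), ((σ.sign : ℤ) : ZMod 3) • ∑ E : Finset (Fin n),
    (-1 : ZMod 3) ^ E.card • LinearMap.proj fun l => if l ∈ E then v (σ l) else 0

lemma alt_apply {A : Type} [AddCommGroup A] {n : ℕ} (v : Fin n → A) (f : Fn A n) :
    alt v f = ∑ σ : Equiv.Perm (Fin n), ((σ.sign : ℤ) : ZMod 3) * ∑ E : Finset (Fin n),
      (-1 : ZMod 3) ^ E.card * f fun l => if l ∈ E then v (σ l) else 0 := by
  simp only [alt, LinearMap.sum_apply, LinearMap.smul_apply, smul_eq_mul, LinearMap.proj_apply]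

lemma alt_pol {A : Type} [AddCommGroup A] {n : ℕ} (v : Fin n → A) {f : Fn A n}
    (hf : f ∈ Pol (Fin n → A) n) : alt v f = 0 := by
  rw [alt_apply]
  refine Finset.sum_eq_zero fun σ _ => ?_
  have := sum_powerset_pol (fun l : Fin n => Pi.single l (v (σ l)) : Fin n → Fin n → A)
    Finset.univ f (by simpa using hf) 0
  rw [Finset.powerset_univ] at this
  refine mul_eq_zero_of_right _ ((Finset.sum_congr rfl fun E _ => ?_).trans this)
  congr 2
  funext l
  rw [zero_add, Finset.sum_apply]
  simp [Pi.single_apply]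

lemma alt_of_update {A : Type} [AddCommGroup A] {n : ℕ} (v : Fin n → A) {f : Fn A n} (a : Fin n)
    (hf : ∀ x y, (∀ l, l ≠ a → x l = y l) → f x = f y) : alt v f = 0 := by
  rw [alt_apply]
  refine Finset.sum_eq_zero fun σ _ => mul_eq_zero_of_right _ ?_
  have h1 : (Finset.univ : Finset (Fin n)) = insert a (Finset.univ.erase a) := by simp
  rw [← Finset.powerset_univ, h1, Finset.sum_powerset_insert (by simp), ← Finset.sum_add_distrib]
  refine Finset.sum_eq_zero fun E hE => ?_
  have haE : a ∉ E := fun h' => by simpa using Finset.mem_powerset.1 hE h'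
  rw [Finset.card_insert_of_notMem haE, hf _ (fun l => if l ∈ insert a E then v (σ l) else 0)]
  · ring
  · intro l hl
    simp [Finset.mem_insert, hl]

lemma alt_of_swap {A : Type} [AddCommGroup A] {n : ℕ} (v : Fin n → A) {f : Fn A n} {a b : Fin n}
    (hab : a ≠ b) (hf : ∀ x, f (fun l => x (Equiv.swap a b l)) = f x) : alt v f = 0 := by
  have key : alt v f = - alt v f := by
    rw [alt_apply]
    conv_lhs => rw [← Equiv.sum_comp (Equiv.mulRight (Equiv.swap a b))]
    rw [← Finset.sum_neg_distrib]
    refine Finset.sum_congr rfl fun σ _ => ?_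
    rw [← neg_mul]
    congr 1
    · simp [Equiv.Perm.sign_swap hab]
    · rw [← Equiv.sum_comp (Equiv.finsetCongr (Equiv.swap a b))]
      refine Finset.sum_congr rfl fun E _ => ?_
      congr 1
      · simp
      · rw [← hf]
        congr 1
        funext l
        simp [Equiv.finsetCongr]
  have h2 : ∀ c : ZMod 3, c = -c → c = 0 := by decide
  exact h2 _ key

lemma alt_dA {A : Type} [AddCommGroup A] {n : ℕ} (v : Fin (n + 1) → A) (g : Fn A n) :
    alt v (dA A n g) = 0 := by
  rw [dA, dOp, LinearMap.add_apply, map_add, LinearMap.sum_apply, map_sum]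
  rw [alt_of_update v (0 : Fin (n + 1)), zero_add]
  · refine Finset.sum_eq_zero fun j _ => ?_
    rw [LinearMap.smul_apply, map_smul, smul_eq_zero]
    right
    refine Fin.lastCases ?_ (fun j => ?_) j
    · refine alt_of_update v (Fin.last n) fun x y h => ?_
      rw [pull_apply, pull_apply]
      congr 1
      funext k
      rw [Fin.contractNth_apply_of_lt _ _ _ _ (by simp), Fin.contractNth_apply_of_lt _ _ _ _ (by simp)]
      exact h _ (Fin.castSucc_lt_last k).ne
    · have hne : j.castSucc ≠ j.succ := Fin.castSucc_lt_succ.ne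
      refine alt_of_swap v hne fun x => ?_
      rw [pull_apply, pull_apply]
      congr 1
      funext k
      rcases lt_trichotomy (k : ℕ) j with h | h | h
      · rw [Fin.contractNth_apply_of_lt _ _ _ _ (by simpa using h),
          Fin.contractNth_apply_of_lt _ _ _ _ (by simpa using h), Equiv.swap_apply_of_ne_of_ne]
        · simp [Fin.ext_iff]; omega
        · simp [Fin.ext_iff]; omega
      · rw [Fin.contractNth_apply_of_eq _ _ _ _ (by simpa using h),
          Fin.contractNth_apply_of_eq _ _ _ _ (by simpa using h)]
        obtain rfl : k = j := Fin.ext h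
        rw [Equiv.swap_apply_left, Equiv.swap_apply_right, add_comm]
      · rw [Fin.contractNth_apply_of_gt _ _ _ _ (by simpa using h),
          Fin.contractNth_apply_of_gt _ _ _ _ (by simpa using h), Equiv.swap_apply_of_ne_of_ne]
        · simp [Fin.ext_iff]; omega
        · simp [Fin.ext_iff]; omega
  · intro x y h
    rw [pull_apply, pull_apply]
    congr 1
    funext l
    exact h _ (Fin.succ_ne_zero l)

lemma alt_imonom {A : Type} [AddCommGroup A] {n d : ℕ} (x : Fin d → A →+ ZMod 3) (v : Fin n → A)
    (s : Fin n → Fin d) :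
    alt v (imonom x s) = (-1) ^ n * (Matrix.of fun i j => x (s j) (v i)).det := by
  rw [alt_apply, Matrix.det_apply', Finset.mul_sum]
  refine Finset.sum_congr rfl fun σ _ => ?_
  rw [mul_left_comm]
  congr 1
  rw [Finset.sum_eq_single Finset.univ]
  · simp [imonom]
  · intro E _ hE
    obtain ⟨l, hl⟩ : ∃ l, l ∉ E := by
      by_contra h
      push Not at h
      exact hE (Finset.eq_univ_iff_forall.2 h)
    refine mul_eq_zero_of_right _ (Finset.prod_eq_zero (Finset.mem_univ l) ?_)
    simp [hl]
  · simp

lemma alt_pull {A : Type} [AddCommGroup A] {n : ℕ} (ρ : A →+ A) (v : Fin n → A) (f : Fn A n) :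
    alt v (pull (fun x l => ρ (x l)) f) = alt (fun l => ρ (v l)) f := by
  rw [alt_apply, alt_apply]
  refine Finset.sum_congr rfl fun σ _ => ?_
  congr 1
  refine Finset.sum_congr rfl fun E _ => ?_
  rw [pull_apply]
  congr 2
  funext l
  by_cases h : l ∈ E <;> simp [h]

lemma mem_IMon {A : Type} [AddCommGroup A] {n d : ℕ} {x : Fin d → A →+ ZMod 3} {w : Fn A n} :
    w ∈ IMon x n ↔ ∃ c : {s : Fin n → Fin d // StrictMono s} → ZMod 3,
      w = ∑ s, c s • imonom x s.1 := by
  have : {f | ∃ s : Fin n → Fin d, StrictMono s ∧ f = imonom x s} =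
      Set.range fun s : {s : Fin n → Fin d // StrictMono s} => imonom x s.1 := by
    ext f
    simp [eq_comm]
  rw [IMon, this, Submodule.mem_span_range_iff_exists_fun]
  simp only [eq_comm]

lemma det_strictMono {n d : ℕ} {s s' : Fin n → Fin d} (hs : StrictMono s) (hs' : StrictMono s')
    (a : Fin d → ZMod 3) :
    (Matrix.of fun i j => if s j = s' i then a (s j) else 0).det =
      if s = s' then ∏ l, a (s l) else 0 := by
  split_ifs with h
  · subst h
    have : (Matrix.of fun i j => if s j = s i then a (s j) else 0) =
        Matrix.diagonal fun l => a (s l) := by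
      ext i j
      rw [Matrix.of_apply, Matrix.diagonal_apply]
      by_cases hij : i = j
      · simp [hij]
      · rw [if_neg hij, if_neg fun h => hij (hs.injective h).symm]
    rw [this, Matrix.det_diagonal]
  · obtain ⟨j, hj⟩ : ∃ j, s j ∉ Set.range s' := by
      by_contra hcon
      push Not at hcon
      apply h
      have hsub : Finset.univ.image s ⊆ Finset.univ.image s' := by
        intro z hz
        obtain ⟨j, -, rfl⟩ := Finset.mem_image.1 hz
        obtain ⟨i, hi⟩ := hcon j
        exact Finset.mem_image.2 ⟨i, Finset.mem_univ _, hi⟩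
      have heq := Finset.eq_of_subset_of_card_le hsub (by
        rw [Finset.card_image_of_injective _ hs.injective,
          Finset.card_image_of_injective _ hs'.injective])
      refine (hs.range_inj hs').1 ?_
      have := congrArg (fun S : Finset (Fin d) => (S : Set (Fin d))) heq
      simpa using this
    refine Matrix.det_eq_zero_of_column_eq_zero j fun i => ?_
    rw [Matrix.of_apply, if_neg fun h => hj ⟨i, h.symm⟩]

lemma alt_sum_imonom {A : Type} [AddCommGroup A] {n d : ℕ} {x : Fin d → A →+ ZMod 3}
    {u : Fin d → A} {a : Fin d → ZMod 3} (hu : ∀ l l', x l (u l') = if l = l' then a l else 0)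
    (c : {s : Fin n → Fin d // StrictMono s} → ZMod 3) (s : {s : Fin n → Fin d // StrictMono s}) :
    alt (fun l => u (s.1 l)) (∑ s, c s • imonom x s.1) = (-1) ^ n * (c s * ∏ l, a (s.1 l)) := by
  rw [map_sum, Finset.sum_eq_single s]
  · rw [map_smul, alt_imonom]
    simp only [hu]
    rw [det_strictMono s.2 s.2, if_pos rfl, smul_eq_mul]
    ring
  · intro s' _ hs'
    rw [map_smul, alt_imonom]
    simp only [hu]
    rw [det_strictMono s'.2 s.2, if_neg fun h => hs' (Subtype.ext h), mul_zero, smul_zero]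
  · simp

lemma eq_zero_of_alt {A : Type} [AddCommGroup A] {n d : ℕ} {x : Fin d → A →+ ZMod 3}
    {e : Fin d → A} (he : ∀ l l', x l (e l') = if l = l' then 1 else 0) {w : Fn A n}
    (hw : w ∈ IMon x n) (h : ∀ v, alt v w = 0) : w = 0 := by
  obtain ⟨c, rfl⟩ := mem_IMon.1 hw
  refine Finset.sum_eq_zero fun s _ => ?_
  have h1 := alt_sum_imonom (a := fun _ => 1) he c s
  rw [h, Finset.prod_const_one, mul_one, eq_comm, mul_eq_zero] at h1
  rw [h1.resolve_left (pow_ne_zero _ (by decide)), zero_smul]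

/-! ### Cohomology of a filtered deformation of an additive group -/

/-- A group law on `A` which is a deformation of addition, with a compatible action of a finite
group of order prime to three. -/
structure Deform {A : Type} [AddCommGroup A] {d : ℕ} (x : Fin d → A →+ ZMod 3) (e : Fin d → A)
    (op : A → A → A) {T : Type} [Group T] [Fintype T] (ρ : T → A →+ A) : Prop where
  span : SpanProp A x
  dual : ∀ l l', x l (e l') = if l = l' then 1 else 0
  pol : ∀ (n : ℕ) (f : Fn A n), f ∈ LC (Fin n → A) → ∃ m, f ∈ Pol (Fin n → A) m
  sub : ∀ (n m : ℕ) (f : Fn A n), f ∈ Pol (Fin n → A) (m + 1) →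
    dOp op n f - dA A n f ∈ Pol (Fin (n + 1) → A) m
  lc : ∀ (n : ℕ) (f : Fn A n), f ∈ LC (Fin n → A) → dOp op n f ∈ LC (Fin (n + 1) → A)
  sq : ∀ (n : ℕ) (f : Fn A n), dOp op (n + 1) (dOp op n f : Fn A (n + 1)) = 0
  equiv : ∀ t a b, ρ t (op a b) = op (ρ t a) (ρ t b)
  mul : ∀ t t' a, ρ (t * t') a = ρ t (ρ t' a)
  card : (Fintype.card T : ZMod 3) ≠ 0

/-- Locally constant cochains which transform by a character. -/
def Eqv {A : Type} [AddCommGroup A] {T : Type} [Group T] (ρ : T → A →+ A) (χ : T →* ZMod 3)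
    (n : ℕ) : Submodule (ZMod 3) (Fn A n) :=
  LC (Fin n → A) ⊓
    ⨅ t, LinearMap.ker (pull (fun (y : Fin n → A) l => ρ t (y l)) - χ t • LinearMap.id)

lemma mem_Eqv {A : Type} [AddCommGroup A] {T : Type} [Group T] {ρ : T → A →+ A} {χ : T →* ZMod 3}
    {n : ℕ} {f : Fn A n} :
    f ∈ Eqv ρ χ n ↔ f ∈ LC (Fin n → A) ∧ ∀ t y, f (fun l => ρ t (y l)) = χ t * f y := by
  simp only [Eqv, Submodule.mem_inf, Submodule.mem_iInf, LinearMap.mem_ker]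
  refine and_congr_right fun _ => forall_congr' fun t => ?_
  rw [LinearMap.sub_apply, sub_eq_zero, funext_iff]
  rfl

/-- Averaging over a finite group. -/
noncomputable def av {A : Type} [AddCommGroup A] {T : Type} [Group T] [Fintype T] (ρ : T → A →+ A)
    (χ : T →* ZMod 3) (n : ℕ) : Fn A n →ₗ[ZMod 3] Fn A n :=
  (Fintype.card T : ZMod 3)⁻¹ • ∑ t, χ t⁻¹ • pull fun (y : Fin n → A) l => ρ t (y l)

section

variable {A : Type} [AddCommGroup A] {T : Type} [Group T] [Fintype T] {ρ : T → A →+ A}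
  {χ : T →* ZMod 3} {n : ℕ}

lemma av_apply (f : Fn A n) (y : Fin n → A) :
    av ρ χ n f y = (Fintype.card T : ZMod 3)⁻¹ * ∑ t, χ t⁻¹ * f fun l => ρ t (y l) := by
  simp [av, LinearMap.sum_apply, Finset.sum_apply]

lemma av_mem_of {S : Submodule (ZMod 3) (Fn A n)}
    (hS : ∀ t, ∀ f ∈ S, pull (fun (y : Fin n → A) l => ρ t (y l)) f ∈ S) {f : Fn A n}
    (hf : f ∈ S) : av ρ χ n f ∈ S := by
  simp only [av, LinearMap.smul_apply, LinearMap.sum_apply]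
  exact S.smul_mem _ (Submodule.sum_mem _ fun t _ => S.smul_mem _ (hS t f hf))

lemma av_LC {f : Fn A n} (hf : f ∈ LC (Fin n → A)) : av ρ χ n f ∈ LC (Fin n → A) :=
  av_mem_of (fun t _ h => LC_pull (mapHom (ρ t) n) h) hf

lemma av_pol {m : ℕ} {f : Fn A n} (hf : f ∈ Pol (Fin n → A) m) :
    av ρ χ n f ∈ Pol (Fin n → A) m :=
  av_mem_of (fun t _ h => pol_pull (mapHom (ρ t) n) h) hf

lemma av_mem (hmul : ∀ t t' a, ρ (t * t') a = ρ t (ρ t' a)) {f : Fn A n}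
    (hf : f ∈ LC (Fin n → A)) : av ρ χ n f ∈ Eqv ρ χ n := by
  refine mem_Eqv.2 ⟨av_LC hf, fun s y => ?_⟩
  rw [av_apply, av_apply, mul_left_comm]
  congr 1
  rw [Finset.mul_sum]
  rw [← Equiv.sum_comp (Equiv.mulRight s) fun t => χ s * (χ t⁻¹ * f fun l => ρ t (y l))]
  refine Finset.sum_congr rfl fun t _ => ?_
  rw [Equiv.coe_mulRight, mul_inv_rev, ← mul_assoc, ← map_mul, mul_inv_cancel_left]
  simp only [hmul]

lemma av_eq (hcard : (Fintype.card T : ZMod 3) ≠ 0) {f : Fn A n} (hf : f ∈ Eqv ρ χ n) :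
    av ρ χ n f = f := by
  funext y
  rw [av_apply]
  have : ∀ t, (χ t⁻¹ * f fun l => ρ t (y l)) = f y := fun t => by
    rw [(mem_Eqv.1 hf).2, ← mul_assoc, ← map_mul, inv_mul_cancel, map_one, one_mul]
  simp only [this, Finset.sum_const, Finset.card_univ, nsmul_eq_mul]
  rw [inv_mul_cancel_left₀ hcard]

lemma av_dOp {op : A → A → A} (h : ∀ t a b, ρ t (op a b) = op (ρ t a) (ρ t b)) (f : Fn A n) :
    dOp op n (av ρ χ n f) = av ρ χ (n + 1) (dOp op n f) := by
  simp only [av, LinearMap.smul_apply, LinearMap.sum_apply, map_smul, map_sum]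
  congr 1
  refine Finset.sum_congr rfl fun t _ => ?_
  rw [dOp_pull (h t)]

lemma dOp_mem {d : ℕ} {x : Fin d → A →+ ZMod 3} {e : Fin d → A} {op : A → A → A}
    (D : Deform x e op ρ) {f : Fn A n} (hf : f ∈ Eqv ρ χ n) : dOp op n f ∈ Eqv ρ χ (n + 1) := by
  rw [← av_eq D.card hf, av_dOp D.equiv]
  exact av_mem D.mul (D.lc n f (mem_Eqv.1 hf).1)

lemma imon_pol {d : ℕ} {x : Fin d → A →+ ZMod 3} {w : Fn A n} (hw : w ∈ IMon x n) :
    w ∈ Pol (Fin n → A) (n + 1) := by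
  refine Submodule.span_le.2 ?_ hw
  rintro _ ⟨s, _, rfl⟩
  exact prod_char_pol fun l => (x (s l)).comp (Pi.evalAddMonoidHom (fun _ => A) l)

lemma imon_LC {d : ℕ} {x : Fin d → A →+ ZMod 3} {w : Fn A n} (hw : w ∈ IMon x n) :
    w ∈ LC (Fin n → A) := by
  refine Submodule.span_le.2 ?_ hw
  rintro _ ⟨s, _, rfl⟩
  exact mem_LC_of_per
    (prod_char_per fun l => (x (s l)).comp (Pi.evalAddMonoidHom (fun _ => A) l))

variable {d : ℕ} {x : Fin d → A →+ ZMod 3} {e : Fin d → A} {op : A → A → A}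

lemma dA_dA (f : Fn A n) : dA A (n + 1) (dA A n f : Fn A (n + 1)) = 0 :=
  dOp_dOp (Γ := Multiplicative A) f

lemma dA_LC {f : Fn A n} (hf : f ∈ LC (Fin n → A)) : dA A n f ∈ LC (Fin (n + 1) → A) := by
  have h : ∀ (φ : (Fin (n + 1) → A) →+ (Fin n → A)), pull φ f ∈ LC (Fin (n + 1) → A) :=
    fun φ => LC_pull φ hf
  rw [dA, dOp, LinearMap.add_apply, LinearMap.sum_apply]
  refine add_mem (h ⟨⟨fun y l => y l.succ, rfl⟩, fun _ _ => rfl⟩)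
    (Submodule.sum_mem _ fun j _ => ?_)
  rw [LinearMap.smul_apply]
  refine Submodule.smul_mem _ _ (h ⟨⟨Fin.contractNth j (· + ·), ?_⟩, ?_⟩)
  · funext k
    simp [Fin.contractNth]
  · intro y z
    funext k
    simp only [Fin.contractNth, Pi.add_apply]
    split_ifs
    · rfl
    · exact add_add_add_comm _ _ _ _
    · rfl

lemma dA_mem (D : Deform x e op ρ) {m : ℕ} {f : Fn A n} (hf : f ∈ Pol (Fin n → A) (m + 1))
    (h : dOp op n f ∈ Pol (Fin (n + 1) → A) m) : dA A n f ∈ Pol (Fin (n + 1) → A) m := by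
  have := sub_mem h (D.sub n m f hf)
  rwa [sub_sub_cancel] at this

lemma exists_symbol (D : Deform x e op ρ) {m : ℕ} {f : Fn A (n + 1)}
    (hLC : f ∈ LC (Fin (n + 1) → A)) (hf : f ∈ Pol (Fin (n + 1) → A) (m + 1))
    (hd : dA A (n + 1) f ∈ Pol (Fin (n + 2) → A) m) :
    ∃ h : Fn A n, ∃ w ∈ IMon x (n + 1), h ∈ LC (Fin n → A) ∧ h ∈ Pol (Fin n → A) (m + 1) ∧
      f - dA A n h - w ∈ Pol (Fin (n + 1) → A) m ∧ (m ≤ n → w = 0) := by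
  obtain ⟨g, w', hw', h1, h2, h3, -⟩ :=
    span_inhom D.span (n + 1) m (dA A (n + 1) f) (dA_LC hLC) hd (dA_dA f)
  have hw0 : w' = 0 := by
    refine eq_zero_of_alt D.dual hw' fun v => ?_
    have := congrArg (alt v) h1
    rwa [map_add, alt_dA, alt_dA, zero_add, eq_comm] at this
  rw [hw0, add_zero] at h1
  obtain ⟨h, w, hw, k1, k2, k3, k4⟩ := span_inhom D.span n (m + 1) (f - g) (sub_mem hLC h2)
    (sub_mem hf (pol_le_succ _ h3)) (by rw [map_sub, h1, sub_self])
  refine ⟨h, w, hw, k2, k3, ?_, fun hm => k4 (by omega)⟩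
  have : f - dA A n h - w = g := by
    rw [sub_eq_iff_eq_add] at k1
    rw [k1]
    abel
  rwa [this]

lemma sub_av_mem (D : Deform x e op ρ) {m : ℕ} {f : Fn A (n + 1)} {h : Fn A n}
    (hf : f ∈ Eqv ρ χ (n + 1)) (h2 : h ∈ Pol (Fin n → A) (m + 1))
    (h3 : f - dA A n h ∈ Pol (Fin (n + 1) → A) m) :
    f - dOp op n (av ρ χ n h) ∈ Pol (Fin (n + 1) → A) m := by
  have h4 : f - dOp op n h ∈ Pol (Fin (n + 1) → A) m := by
    have := sub_mem h3 (D.sub n m h h2)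
    rwa [sub_sub_sub_cancel_right] at this
  have h5 : f - dOp op n (av ρ χ n h) = av ρ χ (n + 1) (f - dOp op n h) := by
    rw [map_sub, av_eq D.card hf, av_dOp D.equiv]
  rw [h5]
  exact av_pol h4

lemma exists_pol_sub (D : Deform x e op ρ) {m : ℕ} {f : Fn A (n + 1)} (hf : f ∈ Eqv ρ χ (n + 1))
    (hd : dOp op (n + 1) f = 0) (hm : f ∈ Pol (Fin (n + 1) → A) (n + 2 + m)) :
    ∃ h ∈ Eqv ρ χ n, f - dOp op n h ∈ Pol (Fin (n + 1) → A) (n + 2) := by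
  induction m generalizing f with
  | zero => exact ⟨0, zero_mem _, by rwa [map_zero, sub_zero]⟩
  | succ m ih =>
    obtain ⟨h, w, hw, h1, h2, h3, -⟩ := exists_symbol D (mem_Eqv.1 hf).1 hm
      (dA_mem D hm (by rw [hd]; exact zero_mem _))
    have h4 := sub_av_mem (χ := χ) D hf h2 (by
      have := add_mem h3 (pol_mono (show n + 1 + 1 ≤ n + 2 + m by omega) (imon_pol hw))
      rwa [sub_add_cancel] at this)
    have h5 := av_mem (χ := χ) D.mul h1
    obtain ⟨g, hg, hg'⟩ := ih (sub_mem hf (dOp_mem D h5)) (by rw [map_sub, hd, D.sq, sub_zero]) h4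
    refine ⟨av ρ χ n h + g, add_mem h5 hg, ?_⟩
    rwa [map_add, ← sub_sub]

lemma exists_eq_dOp_of_le (D : Deform x e op ρ) {m : ℕ} (hmn : m ≤ n + 1) {f : Fn A (n + 1)}
    (hf : f ∈ Eqv ρ χ (n + 1)) (hd : dOp op (n + 1) f = 0)
    (hm : f ∈ Pol (Fin (n + 1) → A) m) :
    ∃ h ∈ Eqv ρ χ n, h ∈ Pol (Fin n → A) m ∧ f = dOp op n h := by
  induction m generalizing f with
  | zero => exact ⟨0, zero_mem _, zero_mem _, by rw [mem_pol_zero.1 hm, map_zero]⟩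
  | succ m ih =>
    obtain ⟨h, w, hw, h1, h2, h3, hw0⟩ := exists_symbol D (mem_Eqv.1 hf).1 hm
      (dA_mem D hm (by rw [hd]; exact zero_mem _))
    rw [hw0 (by omega), sub_zero] at h3
    have h4 := sub_av_mem (χ := χ) D hf h2 h3
    have h5 := av_mem (χ := χ) D.mul h1
    obtain ⟨g, hg, hgm, hg'⟩ := ih (by omega) (sub_mem hf (dOp_mem D h5))
      (by rw [map_sub, hd, D.sq, sub_zero]) h4
    refine ⟨av ρ χ n h + g, add_mem h5 hg, add_mem (av_pol h2) (pol_le_succ _ hgm), ?_⟩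
    rw [map_add, ← hg', add_sub_cancel]

lemma symbol_equiv (D : Deform x e op ρ) {f : Fn A (n + 1)} (hf : f ∈ Eqv ρ χ (n + 1))
    (hd : dOp op (n + 1) f = 0) (hm : f ∈ Pol (Fin (n + 1) → A) (n + 2)) :
    ∃ h : Fn A n, ∃ w ∈ IMon x (n + 1), h ∈ LC (Fin n → A) ∧ h ∈ Pol (Fin n → A) (n + 2) ∧
      f - dA A n h - w ∈ Pol (Fin (n + 1) → A) (n + 1) ∧ (∀ v, alt v w = alt v f) ∧
      ∀ t v, alt (fun l => ρ t (v l)) w = χ t * alt v w := by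
  obtain ⟨h, w, hw, h1, h2, h3, -⟩ := exists_symbol D (mem_Eqv.1 hf).1 hm
    (dA_mem D hm (by rw [hd]; exact zero_mem _))
  have h4 : ∀ v, alt v w = alt v f := fun v => by
    have := alt_pol v h3
    rw [map_sub, map_sub, alt_dA, sub_zero, sub_eq_zero] at this
    exact this.symm
  refine ⟨h, w, hw, h1, h2, h3, h4, fun t v => ?_⟩
  rw [h4, h4, ← alt_pull, ← smul_eq_mul, ← map_smul]
  congr 1
  funext y
  exact (mem_Eqv.1 hf).2 t y

lemma exists_eq_dOp_of_alt (D : Deform x e op ρ) {f : Fn A (n + 1)} (hf : f ∈ Eqv ρ χ (n + 1))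
    (hd : dOp op (n + 1) f = 0) (hm : f ∈ Pol (Fin (n + 1) → A) (n + 2))
    (h0 : ∀ v, alt v f = 0) : ∃ h ∈ Eqv ρ χ n, f = dOp op n h := by
  obtain ⟨h, w, hw, h1, h2, h3, h4, -⟩ := symbol_equiv D hf hd hm
  rw [eq_zero_of_alt D.dual hw fun v => (h4 v).trans (h0 v), sub_zero] at h3
  have h5 := av_mem (χ := χ) D.mul h1
  obtain ⟨g, hg, -, hg'⟩ := exists_eq_dOp_of_le D le_rfl (sub_mem hf (dOp_mem D h5))
    (by rw [map_sub, hd, D.sq, sub_zero]) (sub_av_mem (χ := χ) D hf h2 h3)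
  exact ⟨av ρ χ n h + g, add_mem h5 hg, by rw [map_add, ← hg', add_sub_cancel]⟩

lemma alt_dOp (D : Deform x e op ρ) {g : Fn A n} (hg : g ∈ LC (Fin n → A))
    (h : dOp op n g ∈ Pol (Fin (n + 1) → A) (n + 2)) (v : Fin (n + 1) → A) :
    alt v (dOp op n g) = 0 := by
  have base : ∀ g : Fn A n, g ∈ Pol (Fin n → A) (n + 2) → alt v (dOp op n g) = 0 := by
    intro g hg
    have := alt_pol v (D.sub n (n + 1) g hg)
    rwa [map_sub, alt_dA, sub_zero] at this
  cases n with
  | zero =>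
    refine base g (pol_mono (show 1 ≤ 2 by omega) (mem_pol_one.2 fun y z => ?_))
    rw [Subsingleton.elim (y + z) y]
  | succ n =>
    obtain ⟨m, hm⟩ := D.pol _ g hg
    replace hm := pol_mono (show m ≤ n + 1 + 2 + m by omega) hm
    induction m generalizing g with
    | zero => exact base g hm
    | succ m ih =>
      obtain ⟨k, w, hw, h1, h2, h3, -⟩ := exists_symbol D hg hm
        (dA_mem D hm (pol_mono (show n + 1 + 2 ≤ n + 1 + 2 + m by omega) h))
      have h4 : g - dOp op n k ∈ Pol (Fin (n + 1) → A) (n + 1 + 2 + m) := by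
        have := sub_mem (add_mem h3 (pol_mono (show n + 1 + 1 ≤ n + 1 + 2 + m by omega)
          (imon_pol hw))) (D.sub n _ k h2)
        rwa [sub_add_cancel, sub_sub_sub_cancel_right] at this
      have h5 : dOp op (n + 1) (g - dOp op n k) = dOp op (n + 1) g := by
        rw [map_sub, D.sq, sub_zero]
      rw [← h5]
      exact ih (sub_mem hg (D.lc _ _ h1)) (by rwa [h5]) h4

theorem Deform.acyclic (D : Deform x e op ρ)
    (hw : ∀ w ∈ IMon x (n + 1), (∀ t v, alt (fun l => ρ t (v l)) w = χ t * alt v w) → w = 0)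
    {f : Fn A (n + 1)} (hf : f ∈ Eqv ρ χ (n + 1)) (hd : dOp op (n + 1) f = 0) :
    ∃ h ∈ Eqv ρ χ n, f = dOp op n h := by
  obtain ⟨m, hm⟩ := D.pol _ f (mem_Eqv.1 hf).1
  obtain ⟨h, hh, h1⟩ := exists_pol_sub D hf hd (pol_mono (show m ≤ n + 2 + m by omega) hm)
  have hf' := sub_mem hf (dOp_mem D hh)
  have hd' : dOp op (n + 1) (f - dOp op n h) = 0 := by rw [map_sub, hd, D.sq, sub_zero]
  obtain ⟨-, w, hw', -, -, -, h4, h5⟩ := symbol_equiv D hf' hd' h1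
  obtain ⟨g, hg, hg'⟩ := exists_eq_dOp_of_alt D hf' hd' h1 fun v => by
    rw [← h4, hw w hw' h5, map_zero]
  exact ⟨h + g, add_mem hh hg, by rw [map_add, ← hg', add_sub_cancel]⟩

lemma hd_monom (s : Fin n → Fin d) : hd (n + 1) (monom x s) = 0 := by
  induction n with
  | zero =>
    funext y
    simp [hd_apply, monom, Fin.sum_univ_two]
  | succ n ih =>
    have : monom x s = hd (n + 1) fun y => x (s 0) (y 0) * monom x (fun l => s l.succ) y := by
      funext a
      rw [hd_char_mul _ (ih _)]
      simp only [monom]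
      rw [Fin.prod_univ_succ]
      rfl
    rw [this, hd_hd]

lemma dA_imonom (s : Fin n → Fin d) : dA A n (imonom x s) = 0 := by
  have h : homog (Γ := Multiplicative A) n (imonom (A := A) x s) = monom (A := A) x s := by
    funext a
    exact Finset.prod_congr (s₁ := Finset.univ) rfl fun l _ =>
      congrArg (x (s l)) (sub_eq_neg_add (α := A) (a l.succ) (a l.castSucc)).symm
  apply homog_injective (Γ := Multiplicative A)
  refine (hd_homog (Γ := Multiplicative A) _).symm.trans ?_
  rw [h]
  exact (hd_monom (A := A) s).trans (map_zero (homog (Γ := Multiplicative A) (n + 1))).symm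

theorem Deform.rank_one (D : Deform x e op ρ) (s : Fin (n + 1) → Fin d) (hs : StrictMono s)
    (hw : ∀ w ∈ IMon x (n + 1), (∀ t v, alt (fun l => ρ t (v l)) w = χ t * alt v w) →
      ∃ c : ZMod 3, w = c • imonom x s)
    (hdet : ∀ t, alt (fun l => ρ t (e (s l))) (imonom x s) =
      χ t * alt (fun l => e (s l)) (imonom x s)) :
    ∃ ω ∈ Eqv ρ χ (n + 1), dOp op (n + 1) ω = 0 ∧
      (∀ f ∈ Eqv ρ χ (n + 1), dOp op (n + 1) f = 0 →
        ∃ c : ZMod 3, ∃ h ∈ Eqv ρ χ n, f - c • ω = dOp op n h) ∧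
      ∀ c : ZMod 3, ∀ h ∈ LC (Fin n → A), c • ω = dOp op n h → c = 0 := by
  set v : Fin (n + 1) → A := fun l => e (s l) with hv
  have hX : imonom x s ∈ IMon x (n + 1) := Submodule.subset_span ⟨s, hs, rfl⟩
  set X := av ρ χ (n + 1) (imonom x s) with hXdef
  have hXm : X ∈ Eqv ρ χ (n + 1) := av_mem D.mul (imon_LC hX)
  have hXp : X ∈ Pol (Fin (n + 1) → A) (n + 2) := av_pol (imon_pol hX)
  have haltX : ∀ u, alt u (imonom x s) = alt u (imonom x s) := fun u => rfl
  have hdA : dA A (n + 1) X = 0 := by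
    rw [hXdef, dA, av_dOp fun t a b => map_add (ρ t) a b]
    rw [dA_imonom, map_zero]
  have hdX : dOp op (n + 1) X ∈ Pol (Fin (n + 2) → A) (n + 1) := by
    have := D.sub _ _ _ hXp
    rwa [hdA, sub_zero] at this
  obtain ⟨g, hg, hgm, hg'⟩ := exists_eq_dOp_of_le D (by omega) (dOp_mem D hXm) (D.sq _ _) hdX
  have halt1 : alt v (imonom x s) ≠ 0 := by
    rw [hv, alt_imonom]
    simp only [D.dual]
    rw [det_strictMono (a := fun _ => 1) hs hs, if_pos rfl, Finset.prod_const_one, mul_one]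
    exact pow_ne_zero _ (by decide)
  have haltω : alt v (X - g) = alt v (imonom x s) := by
    rw [map_sub, alt_pol v hgm, sub_zero, hXdef]
    simp only [av, LinearMap.smul_apply, LinearMap.sum_apply, map_smul, map_sum, alt_pull]
    have : ∀ t, χ t⁻¹ • alt (fun l => ρ t (v l)) (imonom x s) = alt v (imonom x s) := fun t => by
      rw [hv, hdet, smul_eq_mul, ← mul_assoc, ← map_mul, inv_mul_cancel, map_one, one_mul]
    simp only [this, Finset.sum_const, Finset.card_univ, nsmul_eq_mul, smul_eq_mul]
    rw [inv_mul_cancel_left₀ D.card]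
  have hωm : X - g ∈ Eqv ρ χ (n + 1) := sub_mem hXm hg
  have hωp : X - g ∈ Pol (Fin (n + 1) → A) (n + 2) := sub_mem hXp (pol_le_succ _ hgm)
  have hωd : dOp op (n + 1) (X - g) = 0 := by rw [map_sub, hg', sub_self]
  refine ⟨X - g, hωm, hωd, fun f hf hd => ?_, fun c h hh hc => ?_⟩
  · obtain ⟨m, hm⟩ := D.pol _ f (mem_Eqv.1 hf).1
    obtain ⟨h, hh, h1⟩ := exists_pol_sub D hf hd (pol_mono (show m ≤ n + 2 + m by omega) hm)
    have hf' := sub_mem hf (dOp_mem D hh)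
    have hd' : dOp op (n + 1) (f - dOp op n h) = 0 := by rw [map_sub, hd, D.sq, sub_zero]
    obtain ⟨-, w, hw', -, -, -, h4, h5⟩ := symbol_equiv D hf' hd' h1
    obtain ⟨c, rfl⟩ := hw w hw' h5
    obtain ⟨-, wω, hwω', -, -, -, k4, k5⟩ := symbol_equiv D hωm hωd hωp
    obtain ⟨b, rfl⟩ := hw wω hwω' k5
    have hb : b = 1 := by
      have := (k4 v).trans haltω
      rw [map_smul, smul_eq_mul] at this
      exact mul_right_cancel₀ halt1 (this.trans (one_mul _).symm)
    obtain ⟨g', hg1, hg2⟩ := exists_eq_dOp_of_alt D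
      (f := f - dOp op n h - c • (X - g)) (sub_mem hf' (Submodule.smul_mem _ _ hωm))
      (by rw [map_sub, map_smul, hωd, hd', smul_zero, sub_zero])
      (sub_mem h1 (Submodule.smul_mem _ _ hωp)) fun u => by
        rw [map_sub, map_smul, ← h4, ← k4, hb, one_smul, map_smul, sub_self]
    refine ⟨c, h + g', add_mem hh hg1, ?_⟩
    rw [map_add, ← hg2]
    abel
  · have h1 := alt_dOp D hh (by rw [← hc]; exact Submodule.smul_mem _ _ hωp) v
    rw [← hc, map_smul, haltω, smul_eq_mul, mul_eq_zero] at h1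
    exact h1.resolve_right halt1

end

/-! ### The additive group of two by two matrices -/

lemma isUnit_of_toZMod {a : ℤ_[3]} (h : PadicInt.toZMod a ≠ 0) : IsUnit a := by
  by_contra hcon
  apply h
  have : a ∈ RingHom.ker (PadicInt.toZMod : ℤ_[3] →+* ZMod 3) := by
    rw [PadicInt.ker_toZMod]
    exact hcon
  exact this

lemma exists_half : ∃ h : ℤ_[3], 2 * h = 1 := by
  have : IsUnit (2 : ℤ_[3]) := isUnit_of_toZMod (by rw [map_ofNat]; decide)
  exact this.exists_right_inv

/-- The inverse of two. -/
noncomputable def half : ℤ_[3] := exists_half.choose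

lemma two_mul_half : 2 * half = 1 := exists_half.choose_spec

lemma toZMod_half : (PadicInt.toZMod half : ZMod 3) = 2 := by
  have h := congrArg (PadicInt.toZMod : ℤ_[3] → ZMod 3) two_mul_half
  rw [map_mul, map_ofNat, map_one] at h
  revert h
  generalize (PadicInt.toZMod half : ZMod 3) = z
  revert z
  decide

/-- Two by two matrices over the three-adic integers. -/
abbrev R : Type := Matrix (Fin 2) (Fin 2) ℤ_[3]

/-- Two by two matrices over the field with three elements. -/
abbrev RF : Type := Matrix (Fin 2) (Fin 2) (ZMod 3)

/-- Reduction of matrices modulo three. -/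
noncomputable def redM : R →+* RF := (PadicInt.toZMod : ℤ_[3] →+* ZMod 3).mapMatrix

lemma redM_apply (r : R) (i j : Fin 2) : redM r i j = PadicInt.toZMod (r i j) := rfl

/-- Coordinates of a matrix with respect to a basis of eigenvectors. -/
noncomputable def coords : R ≃+ (Fin 4 → ℤ_[3]) where
  toFun r := ![half * (r 0 0 + r 1 1), half * (r 0 1 - r 1 0),
    half * half * (r 0 0 - r 1 1 + r 0 1 + r 1 0), half * half * (r 0 0 - r 1 1 - r 0 1 - r 1 0)]
  invFun a := !![a 0 + a 2 + a 3, a 1 + a 2 - a 3; -a 1 + a 2 - a 3, a 0 - a 2 - a 3]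
  left_inv r := by
    have h := two_mul_half
    ext i j
    fin_cases i <;> fin_cases j <;> simp <;> grind
  right_inv a := by
    have h := two_mul_half
    funext i
    fin_cases i <;> simp <;> grind
  map_add' a b := by
    funext i
    fin_cases i <;> simp <;> ring

/-- The basis of matrices dual to the coordinates. -/
def basisF : Fin 4 → RF :=
  ![!![1, 0; 0, 1], !![0, 1; -1, 0], !![1, 1; 1, -1], !![1, -1; -1, -1]]

/-- The coordinates modulo three. -/
def coordRF (l : Fin 4) (r : RF) : ZMod 3 :=
  ![2 * (r 0 0 + r 1 1), 2 * (r 0 1 - r 1 0), r 0 0 - r 1 1 + r 0 1 + r 1 0,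
    r 0 0 - r 1 1 - r 0 1 - r 1 0] l

/-- The coordinates of a matrix modulo three. -/
noncomputable def xR (l : Fin 4) : R →+ ZMod 3 := (coordF 4 l).comp coords.toAddMonoidHom

lemma xR_eq (l : Fin 4) (r : R) : xR l r = coordRF l (redM r) := by
  have h4 : (2 * 2 : ZMod 3) = 1 := by decide
  fin_cases l <;>
    simp [xR, coordF, coords, coordRF, redM_apply, toZMod_half, h4]

/-- The basis of matrices dual to the coordinates. -/
noncomputable def eR (l : Fin 4) : R :=
  ![!![1, 0; 0, 1], !![0, 1; -1, 0], !![1, 1; 1, -1], !![1, -1; -1, -1]] l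

lemma redM_eR (l : Fin 4) : redM (eR l) = basisF l := by
  ext i j
  rw [redM_apply]
  fin_cases l <;> fin_cases i <;> fin_cases j <;> simp [eR, basisF]

lemma span_R : SpanProp R xR := by
  intro n m f hLC hm hinv hf
  have hback : ∀ {k : ℕ} (u : Fn R k), pull (mapHom coords.toAddMonoidHom k)
      (pull (mapHom coords.symm.toAddMonoidHom k) u) = u := by
    intro k u
    funext y
    rw [pull_apply, pull_apply]
    congr 1
    funext l
    exact coords.symm_apply_apply (y l)
  obtain ⟨g, w, hw, h1, h2, h3, h4, h5, h6⟩ := span_fin 4 n m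
    (pull (mapHom coords.symm.toAddMonoidHom (n + 1)) f) (LC_pull _ hLC) (pol_pull _ hm)
    (fun v => by
      funext y
      have := congrFun (hinv (coords.symm v)) (mapHom coords.symm.toAddMonoidHom (n + 1) y)
      rw [dif_apply] at this ⊢
      rw [pull_apply, pull_apply, map_add]
      exact this)
    (by
      have := hd_pull (k := n + 1) (fun a => coords.symm a) f
      rw [hf, map_zero] at this
      exact this)
  refine ⟨pull (mapHom coords.toAddMonoidHom n) g, pull (mapHom coords.toAddMonoidHom (n + 1)) w,
    ?_, ?_, LC_pull _ h2, pol_pull _ h3, fun v => ?_, fun hn => by rw [h5 hn, map_zero],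
    fun hn => by rw [h6 hn, map_zero]⟩
  · have : (Mon (coordF 4) n).map (pull (mapHom coords.toAddMonoidHom (n + 1))) ≤ Mon xR n := by
      rw [Mon, Submodule.map_span_le]
      rintro _ ⟨s, hs, rfl⟩
      refine Submodule.subset_span ⟨s, hs, ?_⟩
      funext a
      exact Finset.prod_congr (s₁ := Finset.univ) rfl fun l _ =>
        congrArg (coordF 4 (s l)) (map_sub coords _ _).symm
    exact this ⟨w, hw, rfl⟩
  · rw [← hback f, h1, map_add]
    congr 1
    exact (hd_pull (k := n) (fun a => coords a) g).symm
  · funext y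
    have := congrFun (h4 (coords v)) (mapHom coords.toAddMonoidHom n y)
    rw [dif_apply] at this ⊢
    rw [pull_apply, pull_apply, map_add]
    have e : mapHom coords.toAddMonoidHom n (diag n v) = diag n (coords v) := rfl
    rw [e]
    exact this

lemma xR_eR (l l' : Fin 4) : xR l (eR l') = if l = l' then 1 else 0 := by
  rw [xR_eq, redM_eR]
  revert l l'
  decide

lemma exists_pol_R (n : ℕ) (f : Fn R n) (hf : f ∈ LC (Fin n → R)) :
    ∃ m, f ∈ Pol (Fin n → R) m := by
  obtain ⟨i, hi⟩ := mem_LC.1 hf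
  refine exists_pol (ι := Fin n × Fin 2 × Fin 2)
    (fun s => Pi.single s.1 (Matrix.single s.2.1 s.2.2 1)) i (fun v => ?_) hi
  choose w hw using fun s : Fin n × Fin 2 × Fin 2 => exists_res i (v s.1 s.2.1 s.2.2)
  refine ⟨fun s => res i (v s.1 s.2.1 s.2.2), fun l => Matrix.of fun a b => w (l, a, b), ?_⟩
  funext l
  ext a b
  rw [hw (l, a, b)]
  simp only [Pi.add_apply, Finset.sum_apply, Pi.smul_apply, Matrix.add_apply, Matrix.smul_apply,
    Matrix.sum_apply, Matrix.of_apply]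
  congr 1
  rw [Finset.sum_eq_single (l, a, b)]
  · simp
  · rintro ⟨l', a', b'⟩ _ hne
    by_cases hl : l = l'
    · subst hl
      have : ¬ (a' = a ∧ b' = b) := fun h => hne (by rw [h.1, h.2])
      simp [this]
    · simp [hl]
  · simp

/-! ### The group law on matrices coming from the first congruence subgroup -/

/-- The operation `r ∘ r' = r + r' + 3 r r'`. -/
noncomputable def opR (a b : R) : R := a + b + 3 • (a * b)

/-- The products of consecutive entries. -/
noncomputable def quadR {n : ℕ} (j : Fin (n + 1)) (y : Fin (n + 1) → R) (k : Fin n) : R :=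
  if (k : ℕ) = j then y k.castSucc * y k.succ else 0

lemma contractNth_opR {n : ℕ} (j : Fin (n + 1)) (y : Fin (n + 1) → R) :
    Fin.contractNth j opR y = Fin.contractNth j (· + ·) y + 3 • quadR j y := by
  funext k
  simp only [Fin.contractNth, quadR, opR, Pi.add_apply, Pi.smul_apply]
  split_ifs with h1 h2
  · omega
  · simp
  · rfl
  · simp

lemma isAff_contract {A : Type} [AddCommGroup A] {n : ℕ} (j : Fin (n + 1)) :
    IsAff fun y : Fin (n + 1) → A => Fin.contractNth j (· + ·) y := by
  intro v
  refine ⟨Fin.contractNth j (· + ·) v, fun y => ?_⟩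
  funext k
  simp only [Fin.contractNth, Pi.add_apply]
  split_ifs
  · rfl
  · exact add_add_add_comm _ _ _ _
  · rfl

lemma isQuad_quadR {n : ℕ} (j : Fin (n + 1)) : IsQuad (quadR (n := n) j) := by
  intro v
  refine isAff_pi fun k w => ?_
  by_cases h : (k : ℕ) = j
  · refine ⟨w k.castSucc * v k.succ + v k.castSucc * w k.succ, fun y => ?_⟩
    simp only [quadR, if_pos h, Pi.add_apply, Pi.sub_apply]
    noncomm_ring
  · exact ⟨0, fun y => by simp [quadR, h]⟩

lemma sub_opR (n m : ℕ) (f : Fn R n) (hf : f ∈ Pol (Fin n → R) (m + 1)) :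
    dOp opR n f - dA R n f ∈ Pol (Fin (n + 1) → R) m := by
  rw [dA, dOp, dOp, LinearMap.add_apply, LinearMap.add_apply, add_sub_add_left_eq_sub,
    LinearMap.sum_apply, LinearMap.sum_apply, ← Finset.sum_sub_distrib]
  refine Submodule.sum_mem _ fun j _ => ?_
  rw [LinearMap.smul_apply, LinearMap.smul_apply, ← smul_sub]
  refine Submodule.smul_mem _ _ ?_
  have := pol_quad_sub (isAff_contract (A := R) j) (isQuad_quadR j) hf
  simp only [contractNth_opR]
  exact this

lemma LC_opR (n : ℕ) (f : Fn R n) (hf : f ∈ LC (Fin n → R)) :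
    dOp opR n f ∈ LC (Fin (n + 1) → R) := by
  obtain ⟨i, hi⟩ := mem_LC.1 hf
  have h : ∀ (φ : (Fin (n + 1) → R) → (Fin n → R)),
      (∀ y v, ∃ w, φ (y + 3 ^ i • v) = φ y + 3 ^ i • w) → pull φ f ∈ LC (Fin (n + 1) → R) := by
    intro φ hφ
    refine mem_LC.2 ⟨i, fun y v => ?_⟩
    obtain ⟨w, hw⟩ := hφ y v
    rw [pull_apply, hw, hi, pull_apply]
  rw [dOp, LinearMap.add_apply, LinearMap.sum_apply]
  refine add_mem (h _ fun y v => ⟨fun l => v l.succ, rfl⟩) (Submodule.sum_mem _ fun j _ => ?_)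
  rw [LinearMap.smul_apply]
  refine Submodule.smul_mem _ _ (h _ fun y v => ?_)
  rw [contractNth_opR, contractNth_opR]
  refine ⟨Fin.contractNth j (· + ·) v + 3 • fun k : Fin n => if (k : ℕ) = j then
    y k.castSucc * v k.succ + v k.castSucc * y k.succ + 3 ^ i • (v k.castSucc * v k.succ) else 0,
    ?_⟩
  funext k
  simp only [Fin.contractNth, quadR, Pi.add_apply, Pi.smul_apply]
  split_ifs with h1 h2
  · omega
  · simp
  · simp only [mul_add, add_mul, smul_mul_assoc, mul_smul_comm, smul_add]
    simp only [smul_comm (3 : ℕ) (3 ^ i : ℕ)]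
    abel
  · simp

/-! ### A finite subgroup of order prime to three -/

/-- Invertible two by two matrices over the field with three elements. -/
abbrev GF : Type := GL (Fin 2) (ZMod 3)

/-- Invertible two by two matrices over the three-adic integers. -/
abbrev GZ : Type := GL (Fin 2) ℤ_[3]

lemma GF_det (x : GF) : x 0 0 * x 1 1 - x 0 1 * x 1 0 ≠ 0 := by
  rw [← Matrix.det_fin_two]
  exact ((Matrix.isUnit_iff_isUnit_det _).1 x.isUnit).ne_zero

lemma GF_mul (x y : GF) (i j : Fin 2) : (x * y) i j = x i 0 * y 0 j + x i 1 * y 1 j := by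
  rw [Units.val_mul, Matrix.mul_apply, Fin.sum_univ_two]

lemma GF_inv (x : GF) : ((x⁻¹ : GF) : RF) = (x 0 0 * x 1 1 - x 0 1 * x 1 0) •
    !![x 1 1, -x 0 1; -x 1 0, x 0 0] := by
  have h := GF_det x
  rw [← Matrix.adjugate_fin_two, Matrix.coe_units_inv, Matrix.inv_def, Matrix.det_fin_two]
  revert h
  generalize (x 0 0 * x 1 1 - x 0 1 * x 1 0) = z
  intro h
  congr 1
  rw [Ring.inverse_eq_inv']
  refine inv_eq_of_mul_eq_one_left ?_
  revert z
  decide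

lemma orth_mul : ∀ a b c d : ZMod 3, a * d - b * c ≠ 0 → a * c + b * d = 0 →
    ∀ a' b' c' d' : ZMod 3, a' * d' - b' * c' ≠ 0 → a' * c' + b' * d' = 0 →
    (a * a' + b * c') * (c * a' + d * c') + (a * b' + b * d') * (c * b' + d * d') = 0 := by
  decide

/-- The normalizer of a nonsplit torus: matrices with orthogonal rows. -/
def HF : Subgroup GF where
  carrier := {x | x 0 0 * x 1 0 + x 0 1 * x 1 1 = 0}
  one_mem' := by simp
  mul_mem' := by
    intro x y hx hy
    simp only [Set.mem_ofPred_eq, GF_mul] at *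
    exact orth_mul _ _ _ _ (GF_det x) hx _ _ _ _ (GF_det y) hy
  inv_mem' := by
    intro x hx
    have h := GF_det x
    simp only [Set.mem_ofPred_eq, GF_inv] at *
    simp only [Matrix.smul_apply, Matrix.of_apply, Matrix.cons_val', Matrix.cons_val_zero,
      Matrix.cons_val_one, smul_eq_mul, Matrix.cons_val_fin_one]
    revert hx h
    generalize x 0 0 = a
    generalize x 0 1 = b
    generalize x 1 0 = c
    generalize x 1 1 = d
    revert a b c d
    decide

lemma mem_HF {x : GF} : x ∈ HF ↔ x 0 0 * x 1 0 + x 0 1 * x 1 1 = 0 := Iff.rfl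

noncomputable instance : Fintype HF := Fintype.ofFinite _

lemma sq_HF : ∀ a b c d : ZMod 3, a * d - b * c ≠ 0 → a * c + b * d = 0 →
    ((!![a, b; c, d] ^ 2) ^ 2) ^ 2 = 1 := by
  simp only [sq, Matrix.mul_fin_two, Matrix.one_fin_two, EmbeddingLike.apply_eq_iff_eq,
    Matrix.vecCons_inj]
  decide

lemma card_HF : (Fintype.card HF : ZMod 3) ≠ 0 := by
  have h : IsPGroup 2 HF := fun x => ⟨3, by
    ext1
    apply Units.ext
    have h := sq_HF _ _ _ _ (GF_det x) (mem_HF.1 x.2)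
    rw [← Matrix.eta_fin_two] at h
    rw [Subgroup.coe_pow, Units.val_pow_eq_pow_val, Subgroup.coe_one, Units.val_one, ← h,
      ← pow_mul, ← pow_mul]
    norm_num⟩
  have : Fact (Nat.Prime 2) := ⟨Nat.prime_two⟩
  obtain ⟨k, hk⟩ := IsPGroup.iff_card.1 h
  rw [← Nat.card_eq_fintype_card, hk, Nat.cast_pow]
  exact pow_ne_zero _ (by decide)

/-! ### A homomorphic section -/

lemma exists_root : ∃ b : ℤ_[3], 2 * (b * b) = -1 ∧ PadicInt.toZMod b = 1 := by
  have h4 : ‖(4 : ℤ_[3])‖ = 1 := PadicInt.isUnit_iff.1 (isUnit_of_toZMod (by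
    rw [map_ofNat]; decide))
  have h3 : ‖(3 : ℤ_[3])‖ < 1 := PadicInt.norm_lt_one_iff_dvd 3 |>.2 ⟨1, by norm_num⟩
  have hF : (2 * Polynomial.X ^ 2 + 1 : Polynomial ℤ_[3]).aeval (1 : ℤ_[3]) = 3 := by
    simp; norm_num
  have hF' : (2 * Polynomial.X ^ 2 + 1 : Polynomial ℤ_[3]).derivative.aeval (1 : ℤ_[3]) = 4 := by
    simp; norm_num
  obtain ⟨z, hz, hz1, -⟩ := hensels_lemma (p := 3) (R := ℤ_[3])
    (F := (2 * Polynomial.X ^ 2 + 1 : Polynomial ℤ_[3])) (a := 1) (by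
      rw [hF, hF', h4]
      simpa using h3)
  rw [hF', h4] at hz1
  refine ⟨z, ?_, ?_⟩
  · have : 2 * z ^ 2 + 1 = 0 := by simpa using hz
    linear_combination this
  · have h : z - 1 ∈ RingHom.ker (PadicInt.toZMod : ℤ_[3] →+* ZMod 3) := by
      rw [PadicInt.ker_toZMod]
      exact PadicInt.mem_nonunits.2 hz1
    rw [RingHom.mem_ker, map_sub, map_one, sub_eq_zero] at h
    exact h

/-- A square root of minus one half. -/
noncomputable def root : ℤ_[3] := exists_root.choose

lemma root_sq : 2 * (root * root) = -1 := exists_root.choose_spec.1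

lemma toZMod_root : (PadicInt.toZMod root : ZMod 3) = 1 := exists_root.choose_spec.2

/-- The lift to `{-1, 0, 1}`. -/
def lift3 : ZMod 3 → ℤ := ![0, 1, -1]

lemma lift3_cast : ∀ a, ((lift3 a : ℤ) : ZMod 3) = a := by decide

/-- The lift of a matrix with orthogonal rows. -/
noncomputable def tauM (x : RF) : R :=
  (if x 0 0 * x 0 1 = 0 then 1 else root) • Matrix.of fun i j => ((lift3 (x i j) : ℤ) : ℤ_[3])

lemma redM_tauM (x : RF) : redM (tauM x) = x := by
  ext i j
  rw [redM_apply, tauM, Matrix.smul_apply, Matrix.of_apply, smul_eq_mul, map_mul, map_intCast,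
    lift3_cast]
  split_ifs
  · rw [map_one, one_mul]
  · rw [toZMod_root, one_mul]

lemma lift3_mul : ∀ a b c d : ZMod 3, a * d - b * c ≠ 0 → a * c + b * d = 0 →
    ∀ a' b' c' d' : ZMod 3, a' * d' - b' * c' ≠ 0 → a' * c' + b' * d' = 0 →
    let k : ℤ := if a * b = 0 ∨ a' * b' = 0 then 1 else -2
    (lift3 a * lift3 a' + lift3 b * lift3 c' = k * lift3 (a * a' + b * c') ∧
    lift3 a * lift3 b' + lift3 b * lift3 d' = k * lift3 (a * b' + b * d')) ∧
    (lift3 c * lift3 a' + lift3 d * lift3 c' = k * lift3 (c * a' + d * c') ∧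
    lift3 c * lift3 b' + lift3 d * lift3 d' = k * lift3 (c * b' + d * d')) ∧
    ((a * a' + b * c') * (a * b' + b * d') = 0 ↔ (a * b = 0 ↔ a' * b' = 0)) := by
  decide +kernel

lemma tauM_mul (x y : HF) : tauM (x * y : GF) = tauM x.1 * tauM y.1 := by
  have h := lift3_mul _ _ _ _ (GF_det x) (mem_HF.1 x.2) _ _ _ _ (GF_det y) (mem_HF.1 y.2)
  obtain ⟨⟨h1, h2⟩, ⟨h3, h4⟩, h5⟩ := h
  have hr := root_sq
  have key : ∀ i j, ((lift3 (x.1 i 0) : ℤ) : ℤ_[3]) * ((lift3 (y.1 0 j) : ℤ) : ℤ_[3]) +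
      ((lift3 (x.1 i 1) : ℤ) : ℤ_[3]) * ((lift3 (y.1 1 j) : ℤ) : ℤ_[3]) =
      (if x.1 0 0 * x.1 0 1 = 0 ∨ y.1 0 0 * y.1 0 1 = 0 then 1 else -2) *
      ((lift3 ((x.1 * y.1) i j) : ℤ) : ℤ_[3]) := by
    intro i j
    rw [GF_mul]
    have e : ((if x.1 0 0 * x.1 0 1 = 0 ∨ y.1 0 0 * y.1 0 1 = 0 then 1 else -2 : ℤ_[3])) =
      ((if x.1 0 0 * x.1 0 1 = 0 ∨ y.1 0 0 * y.1 0 1 = 0 then 1 else -2 : ℤ) : ℤ_[3]) := by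
      split_ifs <;> simp
    rw [e]
    fin_cases i <;> fin_cases j
    · exact_mod_cast h1
    · exact_mod_cast h2
    · exact_mod_cast h3
    · exact_mod_cast h4
  rw [← GF_mul, ← GF_mul] at h5
  ext i j
  have k := key i j
  rw [Matrix.mul_apply, Fin.sum_univ_two]
  simp only [tauM, Matrix.smul_apply, Matrix.of_apply, smul_eq_mul]
  by_cases hx : x.1 0 0 * x.1 0 1 = 0 <;> by_cases hy : y.1 0 0 * y.1 0 1 = 0 <;>
    simp only [hx, hy, iff_true, iff_false, true_or, or_true, or_self, if_true, if_false,
      not_true_eq_false] at k h5 ⊢ <;>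
    simp only [h5, if_true, if_false] <;> grind

lemma tauM_one : tauM (1 : RF) = 1 := by
  ext i j
  fin_cases i <;> fin_cases j <;> simp [tauM, lift3]

/-- The homomorphic section on the finite subgroup. -/
noncomputable def tau : HF →* GZ :=
  MonoidHom.toHomUnits ⟨⟨fun x => tauM (x : GF), tauM_one⟩, tauM_mul⟩

lemma tau_val (x : HF) : ((tau x : GZ) : R) = tauM (x : GF) := rfl

/-- Reduction of invertible matrices modulo three. -/
noncomputable def red : GZ →* GF :=
  Matrix.GeneralLinearGroup.map (PadicInt.toZMod : ℤ_[3] →+* ZMod 3)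

lemma red_val (x : GZ) : ((red x : GF) : RF) = redM (x : R) := rfl

lemma red_tau (t : HF) : red (tau t) = t := by
  apply Units.ext
  rw [red_val, tau_val, redM_tauM]

lemma isUnit_of_redM {r : R} (h : IsUnit (redM r)) : IsUnit r := by
  rw [Matrix.isUnit_iff_isUnit_det] at h ⊢
  rw [redM, ← RingHom.map_det] at h
  exact isUnit_of_toZMod h.ne_zero

lemma red_surjective : Function.Surjective red := by
  intro y
  have h : redM (Matrix.of fun i j => ((lift3 (y i j) : ℤ) : ℤ_[3])) = y := by
    ext i j
    rw [redM_apply, Matrix.of_apply, map_intCast, lift3_cast]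
  have hu := isUnit_of_redM (h ▸ y.isUnit)
  refine ⟨hu.unit, Units.ext ?_⟩
  rw [red_val]
  exact h

/-! ### The first congruence subgroup -/

/-- The first congruence subgroup. -/
abbrev K : Type := red.ker

lemma toZMod_eq_zero {a : ℤ_[3]} (h : PadicInt.toZMod a = 0) : ∃ c, a = 3 * c := by
  have : a ∈ RingHom.ker (PadicInt.toZMod : ℤ_[3] →+* ZMod 3) := h
  rw [PadicInt.ker_toZMod, PadicInt.maximalIdeal_eq_span_p, Ideal.mem_span_singleton] at this
  obtain ⟨c, hc⟩ := this
  exact ⟨c, by simpa using hc⟩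

lemma redM_eq_zero {r : R} (h : redM r = 0) : ∃ s : R, r = 3 • s := by
  choose s hs using fun i j => toZMod_eq_zero (a := r i j) (by rw [← redM_apply, h]; rfl)
  refine ⟨Matrix.of s, ?_⟩
  ext i j
  rw [hs]
  simp

lemma redM_smul_three (r : R) : redM (3 • r) = 0 := by
  rw [map_nsmul]
  ext i j
  rw [Matrix.smul_apply, nsmul_eq_mul, Matrix.zero_apply]
  have : ((3 : ℕ) : ZMod 3) = 0 := by decide
  rw [this, zero_mul]

lemma redM_one_add (r : R) : redM (1 + 3 • r) = 1 := by
  rw [map_add, redM_smul_three, map_one, add_zero]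

lemma isUnit_one_add (r : R) : IsUnit (1 + 3 • r) :=
  isUnit_of_redM (by rw [redM_one_add]; exact isUnit_one)

/-- The parametrization of the congruence subgroup as a map. -/
noncomputable def uK0 (r : R) : K :=
  ⟨(isUnit_one_add r).unit, MonoidHom.mem_ker.2 (Units.ext (redM_one_add r))⟩

lemma uK0_val (r : R) : ((uK0 r : GZ) : R) = 1 + 3 • r := rfl

lemma smul_three_inj {r s : R} (h : 3 • r = 3 • s) : r = s := by
  ext i j
  have := congrFun (congrFun h i) j
  simpa using this

lemma uK0_bijective : Function.Bijective uK0 := by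
  constructor
  · intro r s h
    have := congrArg (fun k : K => ((k : GZ) : R)) h
    simp only [uK0_val] at this
    exact smul_three_inj (add_left_cancel this)
  · rintro ⟨k, hk⟩
    obtain ⟨s, hs⟩ := redM_eq_zero (r := (k : R) - 1) (by
      rw [map_sub, map_one, ← red_val, MonoidHom.mem_ker.1 hk, Units.val_one, sub_self])
    refine ⟨s, Subtype.ext (Units.ext ?_)⟩
    rw [uK0_val, ← hs, add_sub_cancel]

/-- The parametrization of the congruence subgroup. -/
noncomputable def uK : R ≃ K := Equiv.ofBijective uK0 uK0_bijective

lemma uK_val (r : R) : ((uK r : GZ) : R) = 1 + 3 • r := rfl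

lemma uK_op (r s : R) : uK (opR r s) = uK r * uK s := by
  apply Subtype.ext
  apply Units.ext
  rw [uK_val, Subgroup.coe_mul, Units.val_mul, uK_val, uK_val, opR]
  simp only [smul_add, add_mul, mul_add, one_mul, mul_one, smul_mul_assoc, mul_smul_comm]
  abel

/-- Conjugation by the finite subgroup. -/
noncomputable def rho (t : HF) : R →+ R where
  toFun r := (tau t : GZ) * r * ((tau t)⁻¹ : GZ)
  map_zero' := by simp
  map_add' a b := by rw [mul_add, add_mul]

lemma rho_apply (t : HF) (r : R) : rho t r = (tau t : GZ) * r * ((tau t)⁻¹ : GZ) := rfl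

lemma uK_rho (t : HF) (r : R) : (uK (rho t r) : GZ) = tau t * uK r * (tau t)⁻¹ := by
  apply Units.ext
  simp only [Units.val_mul, uK_val, rho_apply, mul_add, add_mul, mul_one, Units.mul_inv,
    mul_smul_comm, smul_mul_assoc]

lemma deform_R : Deform xR eR opR rho where
  span := span_R
  dual := xR_eR
  pol := exists_pol_R
  sub := sub_opR
  lc := LC_opR
  sq n f := by
    obtain ⟨g, rfl⟩ : ∃ g : Fn K n, pull (fun y l => uK (y l)) g = f :=
      ⟨pull (fun y l => uK.symm (y l)) f, by funext y; simp [pull_apply]⟩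
    rw [dOp_pull uK_op, dOp_pull uK_op, dOp_dOp, map_zero]
  equiv t a b := by
    simp only [rho_apply, opR, mul_add, add_mul, mul_smul_comm, smul_mul_assoc, mul_assoc,
      Units.inv_mul_cancel_left]
  mul t t' a := by
    simp only [rho_apply, map_mul, Units.val_mul, mul_inv_rev, mul_assoc]
  card := card_HF

/-! ### Determinants of the adjoint action -/

/-- The matrix of a conjugation in the basis of eigenvectors. -/
def conjF (a b c d : ZMod 3) (i j : Fin 4) : ZMod 3 :=
  coordRF j (!![a, b; c, d] * basisF i * ((a * d - b * c) • !![d, -b; -c, a]))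

lemma xR_rho (t : HF) (i j : Fin 4) :
    xR j (rho t (eR i)) = conjF (t.1 0 0) (t.1 0 1) (t.1 1 0) (t.1 1 1) i j := by
  rw [xR_eq, rho_apply, map_mul, map_mul, redM_eR, ← red_val, ← red_val, red_tau, map_inv,
    red_tau, GF_inv, conjF, ← Matrix.eta_fin_two]

lemma conjF_zero : ∀ a b c d : ZMod 3, a * d - b * c ≠ 0 → a * c + b * d = 0 → ∀ i : Fin 4,
    conjF a b c d 0 i = (if i = 0 then 1 else 0) ∧ conjF a b c d i 0 = if i = 0 then 1 else 0 := by
  decide +kernel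

lemma conjF_det : ∀ a b c d : ZMod 3, a * d - b * c ≠ 0 → a * c + b * d = 0 →
    conjF a b c d 1 1 * conjF a b c d 2 2 * conjF a b c d 3 3 -
    conjF a b c d 1 1 * conjF a b c d 2 3 * conjF a b c d 3 2 -
    conjF a b c d 1 2 * conjF a b c d 2 1 * conjF a b c d 3 3 +
    conjF a b c d 1 2 * conjF a b c d 2 3 * conjF a b c d 3 1 +
    conjF a b c d 1 3 * conjF a b c d 2 1 * conjF a b c d 3 2 -
    conjF a b c d 1 3 * conjF a b c d 2 2 * conjF a b c d 3 1 = 1 := by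
  decide +kernel

/-- The action preserves the volume form on a set of coordinates. -/
def Vol {n : ℕ} (s : Fin n → Fin 4) : Prop :=
  ∀ t : HF, alt (fun l => rho t (eR (s l))) (imonom xR s) = alt (fun l => eR (s l)) (imonom xR s)

lemma vol_of_det {n : ℕ} {s : Fin n → Fin 4} (hs : StrictMono s)
    (h : ∀ t : HF, (Matrix.of fun i j =>
      conjF (t.1 0 0) (t.1 0 1) (t.1 1 0) (t.1 1 1) (s i) (s j)).det = 1) : Vol s := by
  intro t
  rw [alt_imonom, alt_imonom]
  congr 1
  simp only [xR_rho, xR_eR]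
  refine (h t).trans (Eq.symm ?_)
  refine (congrArg Matrix.det ?_).trans Matrix.det_one
  ext i j
  simp [Matrix.one_apply, hs.injective.eq_iff, eq_comm]

lemma vol_one : Vol ![0] := by
  refine vol_of_det (Subsingleton.strictMono _) fun t => ?_
  have h0 := conjF_zero _ _ _ _ (GF_det t) (mem_HF.1 t.2)
  rw [Matrix.det_fin_one]
  simp [h0]

lemma vol_three : Vol ![1, 2, 3] := by
  refine vol_of_det (by decide) fun t => ?_
  have h1 := conjF_det _ _ _ _ (GF_det t) (mem_HF.1 t.2)
  rw [Matrix.det_fin_three]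
  simp
  rw [← h1]

lemma vol_four : Vol ![0, 1, 2, 3] := by
  refine vol_of_det (by decide) fun t => ?_
  have h0 := conjF_zero _ _ _ _ (GF_det t) (mem_HF.1 t.2)
  have h1 := conjF_det _ _ _ _ (GF_det t) (mem_HF.1 t.2)
  rw [Matrix.det_succ_row_zero, Fin.sum_univ_four, Matrix.det_fin_three]
  simp [h0]
  rw [← h1]

/-- An element of the finite subgroup with given entries. -/
noncomputable def mkHF (a b c d : ZMod 3) (h : a * d - b * c ≠ 0) (h' : a * c + b * d = 0) : HF :=
  ⟨Matrix.GeneralLinearGroup.mkOfDetNeZero !![a, b; c, d] (by rwa [Matrix.det_fin_two_of]), h'⟩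

lemma xR_rho_mkHF (a b c d : ZMod 3) (h : a * d - b * c ≠ 0) (h' : a * c + b * d = 0)
    (i j : Fin 4) : xR j (rho (mkHF a b c d h h') (eR i)) = conjF a b c d i j :=
  xR_rho _ i j

/-- A rotation of order four. -/
noncomputable def rotF : HF := mkHF 0 1 (-1) 0 (by decide) (by decide)

/-- A diagonal reflection up to scaling. -/
noncomputable def diaF : HF := mkHF 1 1 1 (-1) (by decide) (by decide)

/-- A reflection. -/
noncomputable def refF : HF := mkHF 0 1 1 0 (by decide) (by decide)

/-! ### Cohomology of the congruence subgroup with its finite group of symmetries -/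

/-- The eigenvalues of the rotation of order four. -/
def sgnRot : Fin 4 → ZMod 3 := ![1, 1, -1, -1]

/-- The eigenvalues of the diagonal reflection. -/
def sgnDia : Fin 4 → ZMod 3 := ![1, -1, 1, -1]

lemma rho_rotF (i j : Fin 4) : xR j (rho rotF (eR i)) = if j = i then sgnRot j else 0 := by
  rw [rotF, xR_rho_mkHF]
  revert i j
  decide

lemma rho_diaF (i j : Fin 4) : xR j (rho diaF (eR i)) = if j = i then sgnDia j else 0 := by
  rw [diaF, xR_rho_mkHF]
  revert i j
  decide

lemma coeff_char {n : ℕ} {χ : HF →* ZMod 3} {c : {s : Fin n → Fin 4 // StrictMono s} → ZMod 3}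
    (hinv : ∀ t v, alt (fun l => rho t (v l)) (∑ s, c s • imonom xR s.1) =
      χ t * alt v (∑ s, c s • imonom xR s.1)) (t : HF) (a : Fin 4 → ZMod 3)
    (h : ∀ i j, xR j (rho t (eR i)) = if j = i then a j else 0)
    (s : {s : Fin n → Fin 4 // StrictMono s}) : c s * ∏ l, a (s.1 l) = χ t * c s := by
  have h1 := hinv t fun l => eR (s.1 l)
  rw [alt_sum_imonom (u := fun i => rho t (eR i)) (a := a) (fun l l' => h l' l),
    alt_sum_imonom (u := eR) (a := fun _ => 1) xR_eR, Finset.prod_const_one, mul_one,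
    mul_left_comm (χ t)] at h1
  exact mul_left_cancel₀ (pow_ne_zero n (by decide : (-1 : ZMod 3) ≠ 0)) h1

/-- Sets of coordinates whose volume form is invariant. -/
def Good {n : ℕ} (s : Fin n → Fin 4) : Prop := ∏ l, sgnRot (s l) = 1 ∧ ∏ l, sgnDia (s l) = 1

instance {n : ℕ} (s : Fin n → Fin 4) : Decidable (Good s) := instDecidableAnd

section

variable {n : ℕ} {χ : HF →* ZMod 3} {w : Fn R n}

lemma exists_good (h1 : χ rotF = 1) (h2 : χ diaF = 1) (hw : w ∈ IMon xR n)
    (hinv : ∀ t v, alt (fun l => rho t (v l)) w = χ t * alt v w) :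
    ∃ c : {s : Fin n → Fin 4 // StrictMono s} → ZMod 3, w = ∑ s, c s • imonom xR s.1 ∧
      ∀ s, ¬ Good s.1 → c s = 0 := by
  obtain ⟨c, rfl⟩ := mem_IMon.1 hw
  refine ⟨c, rfl, fun s hs => ?_⟩
  have e1 := coeff_char hinv rotF sgnRot rho_rotF s
  have e2 := coeff_char hinv diaF sgnDia rho_diaF s
  rw [h1, one_mul] at e1
  rw [h2, one_mul] at e2
  by_contra hc
  exact hs ⟨mul_left_cancel₀ hc (e1.trans (mul_one _).symm),
    mul_left_cancel₀ hc (e2.trans (mul_one _).symm)⟩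

lemma eq_zero_of_good (hg : ∀ s : Fin n → Fin 4, StrictMono s → ¬ Good s) (h1 : χ rotF = 1)
    (h2 : χ diaF = 1) (hw : w ∈ IMon xR n)
    (hinv : ∀ t v, alt (fun l => rho t (v l)) w = χ t * alt v w) : w = 0 := by
  obtain ⟨c, rfl, hc⟩ := exists_good h1 h2 hw hinv
  exact Finset.sum_eq_zero fun s _ => by rw [hc s (hg s.1 s.2), zero_smul]

lemma eq_smul_of_good {s : Fin n → Fin 4} (hg : ∀ s', StrictMono s' → Good s' → s' = s)
    (h1 : χ rotF = 1) (h2 : χ diaF = 1) (hw : w ∈ IMon xR n)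
    (hinv : ∀ t v, alt (fun l => rho t (v l)) w = χ t * alt v w) :
    ∃ c : ZMod 3, w = c • imonom xR s := by
  obtain ⟨c, rfl, hc⟩ := exists_good h1 h2 hw hinv
  by_cases hs : StrictMono s
  · refine ⟨c ⟨s, hs⟩, Finset.sum_eq_single (⟨s, hs⟩ : {s : Fin n → Fin 4 // StrictMono s})
      (fun s' _ hne => ?_) fun h => absurd (Finset.mem_univ _) h⟩
    rw [hc s' fun h => hne (Subtype.ext (hg s'.1 s'.2 h)), zero_smul]
  · refine ⟨0, (Finset.sum_eq_zero fun s' _ => ?_).trans (zero_smul _ _).symm⟩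
    rw [hc s' fun h => hs (hg s'.1 s'.2 h ▸ s'.2), zero_smul]

lemma eq_zero_of_vol {s : Fin n → Fin 4} (hg : ∀ s', StrictMono s' → Good s' → s' = s)
    (hs : StrictMono s) (hv : Vol s) (h1 : χ rotF = 1) (h2 : χ diaF = 1) (h3 : χ refF = -1)
    (hw : w ∈ IMon xR n) (hinv : ∀ t v, alt (fun l => rho t (v l)) w = χ t * alt v w) : w = 0 := by
  obtain ⟨c, rfl⟩ := eq_smul_of_good hg h1 h2 hw hinv
  have h := hinv refF fun l => eR (s l)
  rw [map_smul, map_smul, hv refF, h3, alt_imonom] at h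
  have hd : (Matrix.of fun i j => xR (s j) (eR (s i))).det = 1 := by
    refine (congrArg Matrix.det ?_).trans Matrix.det_one
    ext i j
    simp [xR_eR, Matrix.one_apply, hs.injective.eq_iff, eq_comm]
  rw [hd, mul_one] at h
  have hp : ((-1 : ZMod 3) ^ n) ≠ 0 := pow_ne_zero n (by decide)
  rw [smul_eq_mul, ← mul_assoc] at h
  have h' := mul_right_cancel₀ hp h
  have : c = 0 := by
    clear h hw hinv
    revert c
    decide
  rw [this, zero_smul]

end

lemma good_one : ∀ s : Fin 1 → Fin 4, StrictMono s → Good s → s = ![0] := by decide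

lemma good_two : ∀ s : Fin 2 → Fin 4, StrictMono s → ¬ Good s := by decide

lemma good_three : ∀ s : Fin 3 → Fin 4, StrictMono s → Good s → s = ![1, 2, 3] := by
  decide +kernel

lemma good_four : ∀ s : Fin 4 → Fin 4, StrictMono s → Good s → s = ![0, 1, 2, 3] := by
  decide +kernel

lemma good_large {n : ℕ} (hn : 5 ≤ n) (s : Fin n → Fin 4) (hs : StrictMono s) : ¬ Good s := by
  have := Fintype.card_le_of_injective s hs.injective
  simp only [Fintype.card_fin] at this
  omega

/-- The determinant character. -/
noncomputable def detF : GF →* ZMod 3 := (Units.coeHom _).comp Matrix.GeneralLinearGroup.det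

lemma detF_apply (x : GF) : detF x = x 0 0 * x 1 1 - x 0 1 * x 1 0 := by
  rw [← Matrix.det_fin_two]
  rfl

/-- Equivariant cochains for a character of the finite general linear group. -/
noncomputable abbrev EqvR (χ : GF →* ZMod 3) (n : ℕ) : Submodule (ZMod 3) (Fn R n) :=
  Eqv rho (χ.comp HF.subtype) n

lemma detF_rotF : detF.comp HF.subtype rotF = 1 :=
  (detF_apply _).trans (by change (0 * 0 - 1 * -1 : ZMod 3) = 1; decide)

lemma detF_diaF : detF.comp HF.subtype diaF = 1 :=
  (detF_apply _).trans (by change (1 * -1 - 1 * 1 : ZMod 3) = 1; decide)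

lemma detF_refF : detF.comp HF.subtype refF = -1 :=
  (detF_apply _).trans (by change (0 * 0 - 1 * 1 : ZMod 3) = -1; decide)

lemma eqvR_det (n : ℕ) (f : Fn R (n + 1)) (hf : f ∈ EqvR detF (n + 1))
    (hd : dOp opR (n + 1) f = 0) : ∃ h ∈ EqvR detF n, f = dOp opR n h := by
  refine deform_R.acyclic (fun w hw hinv => ?_) hf hd
  have key : ∀ m (s : Fin m → Fin 4), (∀ s', StrictMono s' → Good s' → s' = s) → StrictMono s →
      Vol s → n + 1 = m → w = 0 := by
    rintro m s hg hs hv rfl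
    exact eq_zero_of_vol hg hs hv detF_rotF detF_diaF detF_refF hw hinv
  obtain h | rfl | h | h | hn : n + 1 = 1 ∨ n = 1 ∨ n + 1 = 3 ∨ n + 1 = 4 ∨ 5 ≤ n + 1 := by omega
  · exact key _ _ good_one (by decide) vol_one h
  · exact eq_zero_of_good good_two detF_rotF detF_diaF hw hinv
  · exact key _ _ good_three (by decide) vol_three h
  · exact key _ _ good_four (by decide +kernel) vol_four h
  · exact eq_zero_of_good (good_large hn) detF_rotF detF_diaF hw hinv

lemma eqvR_triv (n : ℕ) (hn : n = 1 ∨ 4 ≤ n) (f : Fn R (n + 1)) (hf : f ∈ EqvR 1 (n + 1))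
    (hd : dOp opR (n + 1) f = 0) : ∃ h ∈ EqvR 1 n, f = dOp opR n h := by
  refine deform_R.acyclic (fun w hw hinv => ?_) hf hd
  refine eq_zero_of_good (fun s hs => ?_) rfl rfl hw hinv
  obtain rfl | hn := hn
  · exact good_two s hs
  · exact good_large (by omega) s hs

lemma eqvR_rank_one (n : ℕ) (hn : n = 0 ∨ n = 2 ∨ n = 3) :
    ∃ ω ∈ EqvR 1 (n + 1), dOp opR (n + 1) ω = 0 ∧
      (∀ f ∈ EqvR 1 (n + 1), dOp opR (n + 1) f = 0 →
        ∃ c : ZMod 3, ∃ h ∈ EqvR 1 n, f - c • ω = dOp opR n h) ∧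
      ∀ c : ZMod 3, ∀ h ∈ LC (Fin n → R), c • ω = dOp opR n h → c = 0 := by
  have key : ∀ s : Fin (n + 1) → Fin 4, StrictMono s →
      (∀ s', StrictMono s' → Good s' → s' = s) → Vol s → _ := fun s hs hg hv =>
    deform_R.rank_one (χ := (1 : GF →* ZMod 3).comp HF.subtype) s hs
      (fun w hw hinv => eq_smul_of_good hg rfl rfl hw hinv)
      (fun t => (hv t).trans (one_mul _).symm)
  obtain rfl | rfl | rfl := hn
  · exact key _ (by decide) good_one vol_one
  · exact key _ (by decide) good_three vol_three
  · exact key _ (by decide +kernel) good_four vol_four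

/-! ### Locally constant functions on the general linear group -/

/-- Congruence of invertible matrices. -/
def Cg (i : ℕ) (x y : GZ) : Prop := ∃ w : R, (y : R) = x + 3 ^ i • w

lemma Cg_refl (i : ℕ) (x : GZ) : Cg i x x := ⟨0, by rw [smul_zero, add_zero]⟩

lemma Cg_mul {i : ℕ} {x y x' y' : GZ} (h : Cg i x y) (h' : Cg i x' y') :
    Cg i (x * x') (y * y') := by
  obtain ⟨w, hw⟩ := h
  obtain ⟨w', hw'⟩ := h'
  refine ⟨w * x' + x * w' + 3 ^ i • (w * w'), ?_⟩
  rw [Units.val_mul, Units.val_mul, hw, hw']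
  simp only [smul_add, add_mul, mul_add, smul_mul_assoc, mul_smul_comm]
  abel

lemma Cg_inv {i : ℕ} {x y : GZ} (h : Cg i x y) : Cg i x⁻¹ y⁻¹ := by
  obtain ⟨w, hw⟩ := h
  refine ⟨-((x⁻¹ : GZ) * w * (y⁻¹ : GZ)), ?_⟩
  have e : ((x⁻¹ : GZ) : R) * (y : R) * ((y⁻¹ : GZ) : R) =
      (x⁻¹ : GZ) * (x + 3 ^ i • w) * (y⁻¹ : GZ) := by rw [hw]
  rw [mul_assoc, Units.mul_inv, mul_one, mul_add, Units.inv_mul, add_mul, one_mul, mul_smul_comm,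
    smul_mul_assoc] at e
  rw [smul_neg, ← sub_eq_add_neg, eq_sub_iff_add_eq]
  exact e.symm

lemma Cg_mono {i j : ℕ} (hij : i ≤ j) {x y : GZ} (h : Cg j x y) : Cg i x y := by
  obtain ⟨w, hw⟩ := h
  refine ⟨3 ^ (j - i) • w, ?_⟩
  rw [smul_smul, ← pow_add, Nat.add_sub_cancel' hij, hw]

lemma Cg_red {i : ℕ} {x y : GZ} (h : Cg (i + 1) x y) : red x = red y := by
  obtain ⟨w, hw⟩ := h
  apply Units.ext
  rw [red_val, red_val, hw, pow_succ', mul_smul, map_add, redM_smul_three, add_zero]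

lemma Cg_uK {i : ℕ} {r s : R} : Cg (i + 1) (uK r) (uK s) ↔ ∃ w, s = r + 3 ^ i • w := by
  refine exists_congr fun w => ?_
  rw [uK_val, uK_val, pow_succ', mul_smul, add_assoc, ← smul_add, add_right_inj]
  exact ⟨smul_three_inj, fun h => by rw [h]⟩

/-- Locally constant functions of several invertible matrices. -/
def LCG (k : ℕ) : Submodule (ZMod 3) (Fn GZ k) where
  carrier := {f | ∃ i, ∀ x y : Fin k → GZ, (∀ l, Cg (i + 1) (x l) (y l)) → f x = f y}
  zero_mem' := ⟨0, fun _ _ _ => rfl⟩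
  add_mem' := by
    rintro f g ⟨i, hi⟩ ⟨j, hj⟩
    refine ⟨max i j, fun x y h => ?_⟩
    rw [Pi.add_apply, Pi.add_apply, hi x y fun l => Cg_mono (by omega) (h l),
      hj x y fun l => Cg_mono (by omega) (h l)]
  smul_mem' := by
    rintro c f ⟨i, hi⟩
    exact ⟨i, fun x y h => by rw [Pi.smul_apply, Pi.smul_apply, hi x y h]⟩

lemma LCG_pull {k m : ℕ} {φ : (Fin k → GZ) → Fin m → GZ}
    (h : ∀ i x y, (∀ l, Cg (i + 1) (x l) (y l)) → ∀ l, Cg (i + 1) (φ x l) (φ y l)) {f : Fn GZ m}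
    (hf : f ∈ LCG m) : pull φ f ∈ LCG k := by
  obtain ⟨i, hi⟩ := hf
  exact ⟨i, fun x y hxy => hi _ _ (h i x y hxy)⟩

lemma LCG_hd {k : ℕ} {f : Fn GZ k} (hf : f ∈ LCG k) : hd k f ∈ LCG (k + 1) := by
  rw [hd, LinearMap.sum_apply]
  refine Submodule.sum_mem _ fun j _ => Submodule.smul_mem _ _ (LCG_pull ?_ hf)
  exact fun _ _ _ h _ => h _

lemma LCG_prism {θ : GZ → GZ} (h : ∀ i x y, Cg (i + 1) x y → Cg (i + 1) (θ x) (θ y)) {k : ℕ}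
    {f : Fn GZ (k + 1)} (hf : f ∈ LCG (k + 1)) : prism θ k f ∈ LCG k := by
  rw [prism, LinearMap.sum_apply]
  refine Submodule.sum_mem _ fun j _ => Submodule.smul_mem _ _ (LCG_pull ?_ hf)
  intro i x y hxy l
  obtain ⟨m, hm | hm⟩ := prismMap_cases θ k j l
  · rw [hm, hm]
    exact hxy m
  · rw [hm, hm]
    exact h _ _ _ (hxy m)

/-- Left translation of functions of several variables. -/
noncomputable def ltr (g : GZ) (k : ℕ) : Fn GZ k →ₗ[ZMod 3] Fn GZ k := pull fun x l => g * x l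

@[simp] lemma ltr_apply (g : GZ) {k : ℕ} (f : Fn GZ k) (x : Fin k → GZ) :
    ltr g k f x = f fun l => g * x l := rfl

lemma hd_ltr (g : GZ) {k : ℕ} (f : Fn GZ k) :
    hd k (ltr g k f) = ltr g (k + 1) (hd k f) := hd_pull _ f

lemma LCG_ltr (g : GZ) {k : ℕ} {f : Fn GZ k} (hf : f ∈ LCG k) : ltr g k f ∈ LCG k :=
  LCG_pull (fun _ _ _ h l => Cg_mul (Cg_refl _ g) (h l)) hf

/-- Functions which transform by a character under the preimage of the finite subgroup. -/
noncomputable def DG (χ : GF →* ZMod 3) (k : ℕ) : Submodule (ZMod 3) (Fn GZ k) :=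
  LCG k ⊓ ⨅ h : HF.comap red, LinearMap.ker (ltr (h : GZ) k - χ (red h) • LinearMap.id)

lemma mem_DG {χ : GF →* ZMod 3} {k : ℕ} {f : Fn GZ k} :
    f ∈ DG χ k ↔ f ∈ LCG k ∧ ∀ h, red h ∈ HF → ltr h k f = χ (red h) • f := by
  simp only [DG, Submodule.mem_inf, Submodule.mem_iInf, LinearMap.mem_ker, Subtype.forall]
  refine and_congr_right fun _ => forall_congr' fun t => forall_congr' fun _ => ?_
  rw [LinearMap.sub_apply, sub_eq_zero]
  rfl

lemma DG_hd {χ : GF →* ZMod 3} {k : ℕ} {f : Fn GZ k} (hf : f ∈ DG χ k) :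
    hd k f ∈ DG χ (k + 1) := by
  obtain ⟨h1, h2⟩ := mem_DG.1 hf
  refine mem_DG.2 ⟨LCG_hd h1, fun h hh => ?_⟩
  rw [← hd_ltr, h2 h hh, map_smul]

lemma DG_ker {χ : GF →* ZMod 3} {k : ℕ} {f : Fn GZ k} (hf : f ∈ DG χ k) {g : GZ} (hg : red g = 1) :
    ltr g k f = f := by
  rw [(mem_DG.1 hf).2 g (by rw [hg]; exact HF.one_mem), hg, map_one, one_smul]

/-! ### The projection to the first congruence subgroup -/

lemma exists_section : ∃ m : GF → GZ, (∀ y, red (m y) = y) ∧ m 1 = 1 ∧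
    ∀ (t : HF) y, m (t * y) = tau t * m y := by
  choose s hs using red_surjective
  let r : GF → GF := fun y => Quotient.out (Quotient.mk (QuotientGroup.rightRel HF) y)
  have hr : ∀ y, y * (r y)⁻¹ ∈ HF := fun y =>
    QuotientGroup.rightRel_apply.1 (Quotient.mk_out (s := QuotientGroup.rightRel HF) y)
  have hr' : ∀ (t : HF) y, r (t * y) = r y := fun t y => by
    refine congrArg Quotient.out (Quotient.sound (s := QuotientGroup.rightRel HF) ?_)
    refine QuotientGroup.rightRel_apply.2 ?_
    rw [mul_inv_rev, mul_inv_cancel_left]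
    exact HF.inv_mem t.2
  let m : GF → GZ := fun y => tau ⟨y * (r y)⁻¹, hr y⟩ * s (r y)
  have hm : ∀ y, red (m y) = y := fun y => by
    simp only [m]
    rw [map_mul, red_tau, hs, inv_mul_cancel_right]
  have hm' : ∀ (t : HF) y, m (t * y) = tau t * m y := fun t y => by
    simp only [m, hr', ← mul_assoc]
    rw [← map_mul]
    congr 2
    exact Subtype.ext (mul_assoc _ _ _)
  refine ⟨fun y => m y * (m 1)⁻¹, fun y => ?_, mul_inv_cancel _, fun t y => ?_⟩
  · rw [map_mul, map_inv, hm, hm, inv_one, mul_one]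
  · change m (t * y) * _ = tau t * (m y * _)
    rw [hm', mul_assoc]

/-- A section of the reduction, compatible with the finite subgroup. -/
noncomputable def sec : GF → GZ := exists_section.choose

lemma red_sec (y : GF) : red (sec y) = y := exists_section.choose_spec.1 y

lemma sec_one : sec 1 = 1 := exists_section.choose_spec.2.1

lemma sec_mul (t : HF) (y : GF) : sec (t * y) = tau t * sec y := exists_section.choose_spec.2.2 t y

/-- The projection to the congruence subgroup. -/
noncomputable def qK (x : GZ) : K :=
  ⟨x * (sec (red x))⁻¹, MonoidHom.mem_ker.2 (by rw [map_mul, map_inv, red_sec, mul_inv_cancel])⟩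

lemma qK_val (x : GZ) : (qK x : GZ) = x * (sec (red x))⁻¹ := rfl

lemma qK_coe (k : K) : qK k = k := by
  apply Subtype.ext
  rw [qK_val, MonoidHom.mem_ker.1 k.2, sec_one, inv_one, mul_one]

lemma qK_mul (k : K) (x : GZ) : qK (k * x) = k * qK x := by
  apply Subtype.ext
  rw [qK_val, map_mul, MonoidHom.mem_ker.1 k.2, one_mul, Subgroup.coe_mul, qK_val, mul_assoc]

lemma qK_tau (t : HF) (x : GZ) : (qK (tau t * x) : GZ) = tau t * qK x * (tau t)⁻¹ := by
  rw [qK_val, map_mul, red_tau, sec_mul, qK_val, mul_inv_rev]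
  group

lemma Cg_qK {i : ℕ} {x y : GZ} (h : Cg (i + 1) x y) : Cg (i + 1) (qK x) (qK y) := by
  rw [qK_val, qK_val, Cg_red h]
  exact Cg_mul h (Cg_refl _ _)

lemma uK_symm_conj (t : HF) (k k' : K) (h : (k' : GZ) = tau t * k * (tau t)⁻¹) :
    uK.symm k' = rho t (uK.symm k) := by
  rw [Equiv.symm_apply_eq]
  apply Subtype.ext
  rw [uK_rho, Equiv.apply_symm_apply, h]

lemma exists_decomp {h : GZ} (hh : red h ∈ HF) : ∃ (t : HF) (k : K), h = k * tau t ∧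
    (t : GF) = red h := by
  refine ⟨⟨red h, hh⟩, ⟨h * (tau ⟨red h, hh⟩)⁻¹, MonoidHom.mem_ker.2 ?_⟩, ?_, rfl⟩
  · rw [map_mul, map_inv, red_tau, mul_inv_cancel]
  · rw [inv_mul_cancel_right]

lemma mem_DG_of {χ : GF →* ZMod 3} {k : ℕ} {f : Fn GZ k} (hf : f ∈ LCG k)
    (h1 : ∀ g : K, ltr (g : GZ) k f = f) (h2 : ∀ t : HF, ltr (tau t) k f = χ t • f) :
    f ∈ DG χ k := by
  refine mem_DG.2 ⟨hf, fun h hh => ?_⟩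
  obtain ⟨t, g, rfl, ht⟩ := exists_decomp hh
  rw [← ht, ← h2 t]
  funext x
  have := congrFun (h1 g) fun l => tau t * x l
  simp only [ltr_apply, ← mul_assoc] at this ⊢
  exact this

/-! ### Comparison of homogeneous cochains with cochains of the congruence subgroup -/

/-- From inhomogeneous cochains of the congruence subgroup to homogeneous cochains. -/
noncomputable def toG (n : ℕ) : Fn R n →ₗ[ZMod 3] Fn GZ (n + 1) :=
  pull (fun x l => qK (x l)) ∘ₗ homog n ∘ₗ pull fun y l => uK.symm (y l)

lemma toG_apply {n : ℕ} (F : Fn R n) (x : Fin (n + 1) → GZ) :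
    toG n F x = F fun l => uK.symm ((qK (x l.castSucc))⁻¹ * qK (x l.succ)) := rfl

/-- From homogeneous cochains to inhomogeneous cochains of the congruence subgroup. -/
noncomputable def ofG (n : ℕ) : Fn GZ (n + 1) →ₗ[ZMod 3] Fn R n :=
  pull (fun y l => uK (y l)) ∘ₗ inhom n ∘ₗ pull fun (x : Fin (n + 1) → K) l => (x l : GZ)

lemma ofG_apply {n : ℕ} (f : Fn GZ (n + 1)) (y : Fin n → R) :
    ofG n f y = f fun l => ((Fin.partialProd (fun l => uK (y l)) l : K) : GZ) := rfl

lemma pull_uK_symm {n : ℕ} (F : Fn R n) :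
    pull (fun (y : Fin n → R) l => uK (y l)) (pull (fun y l => uK.symm (y l)) F) = F := by
  funext y
  simp [pull_apply]

lemma uK_symm_mul (k k' : K) : uK.symm (k * k') = opR (uK.symm k) (uK.symm k') := by
  rw [Equiv.symm_apply_eq, uK_op, Equiv.apply_symm_apply, Equiv.apply_symm_apply]

lemma hd_toG {n : ℕ} (F : Fn R n) : hd (n + 1) (toG n F) = toG (n + 1) (dOp opR n F) := by
  simp only [toG, LinearMap.comp_apply]
  rw [hd_pull, hd_homog, dOp_pull uK_symm_mul]

lemma ofG_toG {n : ℕ} (F : Fn R n) : ofG n (toG n F) = F := by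
  simp only [ofG, toG, LinearMap.comp_apply]
  have : ∀ f : Fn K (n + 1), pull (fun (x : Fin (n + 1) → K) l => (x l : GZ))
      (pull (fun (x : Fin (n + 1) → GZ) l => qK (x l)) f) = f := by
    intro f
    funext x
    simp only [pull_apply, qK_coe]
  rw [this, inhom_homog, pull_uK_symm]

lemma ofG_hd {n : ℕ} {f : Fn GZ (n + 1)} (hf : ∀ g : K, ltr (g : GZ) (n + 1) f = f) :
    ofG (n + 1) (hd (n + 1) f) = dOp opR n (ofG n f) := by
  simp only [ofG, LinearMap.comp_apply]
  rw [dOp_pull uK_op, ← inhom_hd, hd_pull]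
  exact fun g x => congrFun (hf g) fun l => x l

lemma toG_LCG {n : ℕ} {F : Fn R n} (hF : F ∈ LC (Fin n → R)) : toG n F ∈ LCG (n + 1) := by
  obtain ⟨i, hi⟩ := mem_LC.1 hF
  refine ⟨i, fun x y h => ?_⟩
  rw [toG_apply, toG_apply]
  have : ∀ l : Fin n, Cg (i + 1) (((qK (x l.castSucc))⁻¹ * qK (x l.succ) : K) : GZ)
      (((qK (y l.castSucc))⁻¹ * qK (y l.succ) : K) : GZ) := fun l =>
    Cg_mul (Cg_inv (Cg_qK (h _))) (Cg_qK (h _))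
  have key : ∀ l : Fin n, ∃ w, uK.symm ((qK (y l.castSucc))⁻¹ * qK (y l.succ)) =
      uK.symm ((qK (x l.castSucc))⁻¹ * qK (x l.succ)) + 3 ^ i • w := fun l =>
    Cg_uK.1 (by rw [Equiv.apply_symm_apply, Equiv.apply_symm_apply]; exact this l)
  choose w hw using key
  rw [funext hw]
  exact (hi _ w).symm

lemma ofG_LC {n : ℕ} {f : Fn GZ (n + 1)} (hf : f ∈ LCG (n + 1)) : ofG n f ∈ LC (Fin n → R) := by
  obtain ⟨i, hi⟩ := hf
  refine mem_LC.2 ⟨i, fun y v => ?_⟩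
  rw [ofG_apply, ofG_apply]
  refine (hi _ _ fun l => ?_).symm
  induction l using Fin.induction with
  | zero =>
    rw [Fin.partialProd_zero, Fin.partialProd_zero]
    exact Cg_refl _ _
  | succ l ih =>
    rw [Fin.partialProd_succ, Fin.partialProd_succ]
    exact Cg_mul ih (Cg_uK.2 ⟨v l, rfl⟩)

variable {χ : GF →* ZMod 3}

lemma toG_mem {n : ℕ} {F : Fn R n} (hF : F ∈ EqvR χ n) : toG n F ∈ DG χ (n + 1) := by
  obtain ⟨h1, h2⟩ := mem_Eqv.1 hF
  refine mem_DG_of (toG_LCG h1) (fun g => ?_) fun t => ?_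
  · funext x
    rw [ltr_apply, toG_apply, toG_apply]
    congr 1
    funext l
    rw [qK_mul, qK_mul, mul_inv_rev, mul_assoc, inv_mul_cancel_left]
  · funext x
    rw [ltr_apply, toG_apply, Pi.smul_apply, toG_apply, smul_eq_mul]
    refine Eq.trans ?_ (h2 t _)
    congr 1
    funext l
    apply uK_symm_conj
    rw [Subgroup.coe_mul, Subgroup.coe_inv, qK_tau, qK_tau, Subgroup.coe_mul, Subgroup.coe_inv]
    group

/-- The chain map to equivariant cochains. -/
noncomputable def ofD (χ : GF →* ZMod 3) (n : ℕ) : Fn GZ (n + 1) →ₗ[ZMod 3] Fn R n :=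
  av rho (χ.comp HF.subtype) n ∘ₗ ofG n

lemma ofD_mem {n : ℕ} {f : Fn GZ (n + 1)} (hf : f ∈ DG χ (n + 1)) : ofD χ n f ∈ EqvR χ n :=
  av_mem deform_R.mul (ofG_LC (mem_DG.1 hf).1)

lemma ofD_hd {n : ℕ} {f : Fn GZ (n + 1)} (hf : f ∈ DG χ (n + 1)) :
    dOp opR n (ofD χ n f) = ofD χ (n + 1) (hd (n + 1) f) := by
  rw [ofD, ofD, LinearMap.comp_apply, LinearMap.comp_apply, av_dOp deform_R.equiv,
    ofG_hd fun g => DG_ker hf (MonoidHom.mem_ker.1 g.2)]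

/-- The maps which are averaged in the composition of the comparison maps. -/
noncomputable def thetaG (t : HF) (x : GZ) : GZ := qK x * (tau t)⁻¹

lemma ofG_rho {n : ℕ} {f : Fn GZ (n + 1)} (hf : f ∈ DG χ (n + 1)) (t : HF)
    (x : Fin (n + 1) → GZ) :
    ofG n f (fun l => rho t (uK.symm ((qK (x l.castSucc))⁻¹ * qK (x l.succ)))) =
      χ t * f fun l => thetaG t (x l) := by
  rw [ofG_apply]
  have h := congrFun ((mem_DG.1 hf).2 (tau t * (qK (x 0) : GZ)⁻¹) (by
    rw [map_mul, red_tau, map_inv, MonoidHom.mem_ker.1 (qK (x 0)).2, inv_one, mul_one]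
    exact t.2)) fun l => thetaG t (x l)
  rw [map_mul, red_tau, map_inv, MonoidHom.mem_ker.1 (qK (x 0)).2, inv_one, mul_one,
    Pi.smul_apply, smul_eq_mul, ltr_apply] at h
  rw [← h]
  congr 1
  funext l
  induction l using Fin.induction with
  | zero =>
    rw [Fin.partialProd_zero, thetaG]
    simp
  | succ l ih =>
    rw [Fin.partialProd_succ, Subgroup.coe_mul, ih, uK_rho, Equiv.apply_symm_apply, thetaG, thetaG,
      Subgroup.coe_mul, Subgroup.coe_inv]
    group

lemma toG_ofD {n : ℕ} {f : Fn GZ (n + 1)} (hf : f ∈ DG χ (n + 1)) :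
    toG n (ofD χ n f) =
      (Fintype.card HF : ZMod 3)⁻¹ • ∑ t : HF, pull (fun x l => thetaG t (x l)) f := by
  funext x
  rw [toG_apply, ofD, LinearMap.comp_apply, av_apply, Pi.smul_apply, smul_eq_mul, Finset.sum_apply]
  congr 1
  refine Finset.sum_congr rfl fun t _ => ?_
  rw [ofG_rho hf, pull_apply, ← mul_assoc]
  have : (χ.comp HF.subtype) t⁻¹ * χ t = 1 := by
    change χ _ * χ _ = 1
    rw [← map_mul]
    change χ ((t : GF)⁻¹ * t) = 1
    rw [inv_mul_cancel, map_one]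
  rw [this, one_mul]

/-- The chain homotopy. -/
noncomputable def hmtp (k : ℕ) : Fn GZ (k + 1) →ₗ[ZMod 3] Fn GZ k :=
  (Fintype.card HF : ZMod 3)⁻¹ • ∑ t : HF, prism (thetaG t) k

lemma hd_hmtp {n : ℕ} {f : Fn GZ (n + 1)} (hf : f ∈ DG χ (n + 1)) :
    hd n (hmtp n f) + hmtp (n + 1) (hd (n + 1) f) = toG n (ofD χ n f) - f := by
  rw [toG_ofD hf, hmtp, hmtp]
  simp only [LinearMap.smul_apply, LinearMap.sum_apply, map_smul, map_sum]
  rw [← smul_add, ← Finset.sum_add_distrib]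
  simp only [hd_prism]
  rw [Finset.sum_sub_distrib, smul_sub, Finset.sum_const, Finset.card_univ]
  congr 1
  rw [← Nat.cast_smul_eq_nsmul (ZMod 3), smul_smul, inv_mul_cancel₀ card_HF, one_smul]

lemma thetaG_ker (g : K) (t : HF) (x : GZ) : thetaG t (g * x) = g * thetaG t x := by
  rw [thetaG, thetaG, qK_mul, Subgroup.coe_mul, mul_assoc]

lemma thetaG_tau (s t : HF) (x : GZ) : thetaG t (tau s * x) = tau s * thetaG (t * s) x := by
  rw [thetaG, thetaG, qK_tau, map_mul]
  group

lemma hmtp_mem {n : ℕ} {f : Fn GZ (n + 1)} (hf : f ∈ DG χ (n + 1)) : hmtp n f ∈ DG χ n := by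
  refine mem_DG_of ?_ (fun g => ?_) fun s => ?_
  · rw [hmtp, LinearMap.smul_apply, LinearMap.sum_apply]
    refine Submodule.smul_mem _ _ (Submodule.sum_mem _ fun t _ => LCG_prism ?_ (mem_DG.1 hf).1)
    exact fun i x y h => Cg_mul (Cg_qK h) (Cg_refl _ _)
  · simp only [hmtp, LinearMap.smul_apply, LinearMap.sum_apply, map_smul, map_sum]
    congr 1
    refine Finset.sum_congr rfl fun t _ => ?_
    rw [ltr, ← prism_pull (thetaG t) (thetaG t) _ fun x => (thetaG_ker g t x).symm]
    congr 1
    exact DG_ker hf (MonoidHom.mem_ker.1 g.2)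
  · simp only [hmtp, LinearMap.smul_apply, LinearMap.sum_apply, map_smul, map_sum]
    rw [smul_comm]
    congr 1
    rw [← Equiv.sum_comp (Equiv.mulRight s) fun t => prism (thetaG t) n f, Finset.smul_sum]
    refine Finset.sum_congr rfl fun t _ => ?_
    rw [ltr, ← prism_pull (thetaG (t * s)) (thetaG t) _ fun x => (thetaG_tau s t x).symm,
      Equiv.coe_mulRight, ← map_smul]
    congr 1
    have := (mem_DG.1 hf).2 (tau s) (by rw [red_tau]; exact s.2)
    rw [red_tau] at this
    exact this

lemma DG_acyclic {n : ℕ} (H : ∀ F ∈ EqvR χ (n + 1), dOp opR (n + 1) F = 0 →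
      ∃ E ∈ EqvR χ n, F = dOp opR n E) {f : Fn GZ (n + 2)} (hf : f ∈ DG χ (n + 2))
    (hd0 : hd (n + 2) f = 0) : ∃ g ∈ DG χ (n + 1), f = hd (n + 1) g := by
  obtain ⟨E, hE, he⟩ := H _ (ofD_mem hf) (by rw [ofD_hd hf, hd0, map_zero])
  refine ⟨toG n E - hmtp (n + 1) f, sub_mem (toG_mem hE) (hmtp_mem hf), ?_⟩
  have h := hd_hmtp hf
  rw [hd0, map_zero, add_zero, he, ← hd_toG] at h
  rw [map_sub, h, sub_sub_cancel]

lemma DG_rank_one {n : ℕ} (H : ∃ ω ∈ EqvR χ (n + 1), dOp opR (n + 1) ω = 0 ∧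
      (∀ f ∈ EqvR χ (n + 1), dOp opR (n + 1) f = 0 →
        ∃ c : ZMod 3, ∃ h ∈ EqvR χ n, f - c • ω = dOp opR n h) ∧
      ∀ c : ZMod 3, ∀ h ∈ LC (Fin n → R), c • ω = dOp opR n h → c = 0) :
    ∃ ω ∈ DG χ (n + 2), hd (n + 2) ω = 0 ∧
      (∀ f ∈ DG χ (n + 2), hd (n + 2) f = 0 →
        ∃ c : ZMod 3, ∃ h ∈ DG χ (n + 1), f - c • ω = hd (n + 1) h) ∧
      ∀ c : ZMod 3, ∀ h ∈ DG χ (n + 1), c • ω = hd (n + 1) h → c = 0 := by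
  obtain ⟨ω, h1, h2, h3, h4⟩ := H
  refine ⟨toG (n + 1) ω, toG_mem h1, by rw [hd_toG, h2, map_zero], fun f hf hd0 => ?_,
    fun c h hh he => ?_⟩
  · obtain ⟨c, E, hE, he⟩ := h3 _ (ofD_mem hf) (by rw [ofD_hd hf, hd0, map_zero])
    refine ⟨c, toG n E - hmtp (n + 1) f, sub_mem (toG_mem hE) (hmtp_mem hf), ?_⟩
    have h := hd_hmtp hf
    rw [hd0, map_zero, add_zero] at h
    rw [map_sub, h, hd_toG, ← he, map_sub, map_smul]
    abel
  · refine h4 c (ofG n h) (ofG_LC (mem_DG.1 hh).1) ?_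
    rw [← ofG_hd fun g => DG_ker hh (MonoidHom.mem_ker.1 g.2), ← he, map_smul, ofG_toG]

/-! ### Dimensions of subquotients -/

/-- The subquotient of `Z` by `B` has dimension `d`. -/
def HasDim {M : Type} [AddCommGroup M] [Module (ZMod 3) M] (Z B : Submodule (ZMod 3) M) (d : ℕ) :
    Prop :=
  ∃ φ : (Fin d → ZMod 3) →ₗ[ZMod 3] M, (∀ a, φ a ∈ Z) ∧ (∀ f ∈ Z, ∃ a, f - φ a ∈ B) ∧
    ∀ a, φ a ∈ B → a = 0

section HasDim

variable {M M₁ M₂ V : Type} [AddCommGroup M] [Module (ZMod 3) M] [AddCommGroup M₁]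
  [Module (ZMod 3) M₁] [AddCommGroup M₂] [Module (ZMod 3) M₂] [AddCommGroup V] [Module (ZMod 3) V]
  {Z B : Submodule (ZMod 3) M} {Z₁ B₁ : Submodule (ZMod 3) M₁} {Z₂ B₂ : Submodule (ZMod 3) M₂}

lemma HasDim.of_linearMap [Module.Finite (ZMod 3) V] {d : ℕ} (hd : Module.finrank (ZMod 3) V = d)
    (φ : V →ₗ[ZMod 3] M) (h1 : ∀ a, φ a ∈ Z) (h2 : ∀ f ∈ Z, ∃ a, f - φ a ∈ B)
    (h3 : ∀ a, φ a ∈ B → a = 0) : HasDim Z B d := by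
  let e : (Fin d → ZMod 3) ≃ₗ[ZMod 3] V :=
    LinearEquiv.ofFinrankEq _ _ (by rw [Module.finrank_fin_fun, hd])
  refine ⟨φ ∘ₗ e.toLinearMap, fun a => h1 _, fun f hf => ?_, fun a ha => ?_⟩
  · obtain ⟨a, ha⟩ := h2 f hf
    refine ⟨e.symm a, ?_⟩
    simpa using ha
  · simpa using h3 _ ha

lemma HasDim.zero (h : ∀ f ∈ Z, f ∈ B) : HasDim Z B 0 :=
  ⟨0, fun _ => Z.zero_mem, fun f hf => ⟨0, by simpa using h f hf⟩, fun _ _ => Subsingleton.elim _ _⟩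

lemma HasDim.one {ω : M} (h0 : ω ∈ Z) (h1 : ∀ f ∈ Z, ∃ c : ZMod 3, f - c • ω ∈ B)
    (h2 : ∀ c : ZMod 3, c • ω ∈ B → c = 0) : HasDim Z B 1 :=
  .of_linearMap (V := ZMod 3) (Module.finrank_self _) (LinearMap.toSpanSingleton (ZMod 3) M ω)
    (fun a => Z.smul_mem a h0) h1 h2

lemma HasDim.finrank {d : ℕ} (h : HasDim Z B d) :
    Module.finrank (ZMod 3) (Z ⧸ B.comap Z.subtype) = d := by
  obtain ⟨φ, h1, h2, h3⟩ := h
  rw [← Module.finrank_fin_fun (ZMod 3) (n := d)]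
  symm
  refine LinearEquiv.finrank_eq (LinearEquiv.ofBijective
    ((B.comap Z.subtype).mkQ ∘ₗ φ.codRestrict Z h1) ⟨?_, ?_⟩)
  · rw [injective_iff_map_eq_zero]
    intro a ha
    rw [LinearMap.comp_apply, Submodule.mkQ_apply, Submodule.Quotient.mk_eq_zero] at ha
    exact h3 a ha
  · intro q
    obtain ⟨f, rfl⟩ := Submodule.Quotient.mk_surjective _ q
    obtain ⟨a, ha⟩ := h2 f f.2
    refine ⟨a, ((Submodule.Quotient.eq _).2 ?_).symm⟩
    exact ha

lemma exists_lift (S : Submodule (ZMod 3) (M₁ × M)) (φ : V →ₗ[ZMod 3] M₁)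
    (h : ∀ v, ∃ y, (φ v, y) ∈ S) : ∃ ψ : V →ₗ[ZMod 3] M, ∀ v, (φ v, ψ v) ∈ S := by
  let p : S →ₗ[ZMod 3] M₁ := LinearMap.fst _ _ _ ∘ₗ S.subtype
  obtain ⟨r, hr⟩ := p.rangeRestrict.exists_rightInverse_of_surjective p.range_rangeRestrict
  have hφ : ∀ v, φ v ∈ p.range := fun v => by
    obtain ⟨y, hy⟩ := h v
    exact ⟨⟨_, hy⟩, rfl⟩
  refine ⟨LinearMap.snd _ _ _ ∘ₗ S.subtype ∘ₗ r ∘ₗ φ.codRestrict _ hφ, fun v => ?_⟩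
  have e := congrArg Subtype.val (LinearMap.congr_fun hr (φ.codRestrict _ hφ v))
  have : φ v = ((r (φ.codRestrict _ hφ v) : S) : M₁ × M).1 := e.symm
  rw [this]
  exact (r (φ.codRestrict _ hφ v)).2

/-- Additivity of dimensions in a short exact sequence of subquotients given by relations. -/
lemma HasDim.add {d₁ d₂ : ℕ} (S₁ : Submodule (ZMod 3) (M₁ × M)) (S₂ : Submodule (ZMod 3) (M₂ × M))
    (hd₁ : HasDim Z₁ B₁ d₁) (hd₂ : HasDim Z₂ B₂ d₂) (hS₁ : ∀ p ∈ S₁, p.2 ∈ Z)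
    (hS₂ : ∀ p ∈ S₂, p.2 ∈ Z)
    (t₁ : ∀ x ∈ Z₁, ∃ y, (x, y) ∈ S₁) (w₁ : ∀ x ∈ B₁, ∀ y, (x, y) ∈ S₁ → y ∈ B)
    (i₁ : ∀ x, ∀ y ∈ B, (x, y) ∈ S₁ → x ∈ B₁) (t₂ : ∀ y ∈ Z, ∃ z ∈ Z₂, (z, y) ∈ S₂)
    (w₂ : ∀ z, ∀ y ∈ B, (z, y) ∈ S₂ → z ∈ B₂) (s₂ : ∀ z ∈ Z₂, ∃ y, (z, y) ∈ S₂)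
    (c : ∀ x y, (x, y) ∈ S₁ → (0, y) ∈ S₂)
    (ex : ∀ z ∈ B₂, ∀ y, (z, y) ∈ S₂ → ∃ x ∈ Z₁, (x, y) ∈ S₁) : HasDim Z B (d₁ + d₂) := by
  obtain ⟨φ, h1, h2, h3⟩ := hd₁
  obtain ⟨χ, k1, k2, k3⟩ := hd₂
  obtain ⟨ψ, hψ⟩ := exists_lift S₁ φ fun v => t₁ _ (h1 v)
  obtain ⟨η, hη⟩ := exists_lift S₂ χ fun v => s₂ _ (k1 v)
  refine .of_linearMap (V := (Fin d₁ → ZMod 3) × (Fin d₂ → ZMod 3)) (by simp) (ψ.coprod η) ?_ ?_ ?_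
  · rintro ⟨a, b⟩
    exact Z.add_mem (hS₁ _ (hψ a)) (hS₂ _ (hη b))
  · intro y hy
    obtain ⟨z, hz, hzy⟩ := t₂ y hy
    obtain ⟨b, hb⟩ := k2 z hz
    obtain ⟨x, hx, hxy⟩ := ex _ hb (y - η b) (S₂.sub_mem hzy (hη b))
    obtain ⟨a, ha⟩ := h2 x hx
    refine ⟨(a, b), ?_⟩
    have := w₁ _ ha _ (S₁.sub_mem hxy (hψ a))
    rw [LinearMap.coprod_apply, add_comm, ← sub_sub]
    exact this
  · rintro ⟨a, b⟩ h
    rw [LinearMap.coprod_apply] at h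
    have e : b = 0 := by
      refine k3 b (w₂ _ _ h ?_)
      have := S₂.add_mem (c _ _ (hψ a)) (hη b)
      simpa using this
    subst e
    have e : a = 0 := h3 a (i₁ _ _ (by simpa using h) (hψ a))
    rw [e]
    rfl

/-- Invariance of the dimension under a correspondence of subquotients. -/
lemma HasDim.of_rel {d : ℕ} (S : Submodule (ZMod 3) (M₂ × M)) (hd : HasDim Z₂ B₂ d)
    (hS : ∀ p ∈ S, p.2 ∈ Z) (t : ∀ y ∈ Z, ∃ z ∈ Z₂, (z, y) ∈ S)
    (w : ∀ z, ∀ y ∈ B, (z, y) ∈ S → z ∈ B₂) (s : ∀ z ∈ Z₂, ∃ y, (z, y) ∈ S)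
    (ex : ∀ z ∈ B₂, ∀ y, (z, y) ∈ S → y ∈ B) : HasDim Z B d := by
  obtain ⟨χ, k1, k2, k3⟩ := hd
  obtain ⟨η, hη⟩ := exists_lift S χ fun v => s _ (k1 v)
  refine ⟨η, fun b => hS _ (hη b), fun y hy => ?_, fun b hb => k3 b (w _ _ hb (hη b))⟩
  obtain ⟨z, hz, hzy⟩ := t y hy
  obtain ⟨b, hb⟩ := k2 z hz
  exact ⟨b, ex _ hb _ (S.sub_mem hzy (hη b))⟩

end HasDim

/-! ### Subcomplexes -/

section Complex

variable {M : ℕ → Type} [∀ n, AddCommGroup (M n)] [∀ n, Module (ZMod 3) (M n)]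
  (δ : ∀ n, M n →ₗ[ZMod 3] M (n + 1)) (θ : ∀ n, M n →ₗ[ZMod 3] M n)

/-- Cocycles of a subcomplex. -/
def Zc (U : ∀ n, Submodule (ZMod 3) (M n)) (n : ℕ) : Submodule (ZMod 3) (M n) :=
  U n ⊓ LinearMap.ker (δ n)

/-- Coboundaries of a subcomplex. -/
def Bc (U : ∀ n, Submodule (ZMod 3) (M n)) : ∀ n, Submodule (ZMod 3) (M n)
  | 0 => ⊥
  | n + 1 => (U n).map (δ n)

/-- The part of a subcomplex killed by an endomorphism. -/
def Ec (U : ∀ n, Submodule (ZMod 3) (M n)) (n : ℕ) : Submodule (ZMod 3) (M n) :=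
  U n ⊓ LinearMap.ker (θ n)

variable {δ θ}

lemma mem_Bc_zero {U : ∀ n, Submodule (ZMod 3) (M n)} {x : M 0} : x ∈ Bc δ U 0 ↔ x = 0 :=
  Submodule.mem_bot _

lemma mem_Bc_succ {U : ∀ n, Submodule (ZMod 3) (M n)} {n : ℕ} {x : M (n + 1)} :
    x ∈ Bc δ U (n + 1) ↔ ∃ y ∈ U n, δ n y = x := Iff.rfl

variable (δ θ) in
/-- Two subcomplexes exchanged by a chain map of order three. -/
structure Twist (P N : ∀ n, Submodule (ZMod 3) (M n)) : Prop where
  comm : ∀ n x, δ n (θ n x) = θ (n + 1) (δ n x)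
  sq : ∀ n x, δ (n + 1) (δ n x) = 0
  cube : ∀ n x, θ n (θ n (θ n x)) = 0
  dP : ∀ n, ∀ x ∈ P n, δ n x ∈ P (n + 1)
  dN : ∀ n, ∀ x ∈ N n, δ n x ∈ N (n + 1)
  tP : ∀ n, ∀ x ∈ P n, θ n x ∈ N n
  tN : ∀ n, ∀ x ∈ N n, θ n x ∈ P n
  exP : ∀ n, ∀ x ∈ P n, θ n x = 0 → ∃ y ∈ P n, x = θ n (θ n y)
  exN : ∀ n, ∀ x ∈ N n, θ n x = 0 → ∃ y ∈ N n, x = θ n (θ n y)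

namespace Twist

variable {P N : ∀ n, Submodule (ZMod 3) (M n)}

lemma swap (T : Twist δ θ P N) : Twist δ θ N P :=
  ⟨T.comm, T.sq, T.cube, T.dN, T.dP, T.tN, T.tP, T.exN, T.exP⟩

lemma exP_sq (T : Twist δ θ P N) {n : ℕ} {x : M n} (hx : x ∈ P n) (h : θ n (θ n x) = 0) :
    ∃ y ∈ N n, x = θ n y := by
  obtain ⟨y, hy, e⟩ := T.exN n _ (T.tP n x hx) h
  obtain ⟨w, hw, e'⟩ := T.exP n (x - θ n y) (sub_mem hx (T.tN n y hy))
    (by rw [map_sub, e, sub_self])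
  refine ⟨y + θ n w, add_mem hy (T.tP n w hw), ?_⟩
  rw [map_add, ← e', add_sub_cancel]

/-- The connecting relation. -/
def conn (_ : Twist δ θ P N) (n : ℕ) : Submodule (ZMod 3) (M n × M (n + 2)) where
  carrier := {p | ∃ u ∈ P n, ∃ v ∈ N (n + 1), θ n (θ n u) = p.1 ∧ δ n u = θ (n + 1) v ∧
    δ (n + 1) v = p.2}
  zero_mem' := ⟨0, zero_mem _, 0, zero_mem _, by simp, by simp, by simp⟩
  add_mem' := by
    rintro p p' ⟨u, hu, v, hv, h1, h2, h3⟩ ⟨u', hu', v', hv', h1', h2', h3'⟩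
    exact ⟨u + u', add_mem hu hu', v + v', add_mem hv hv', by simp [h1, h1'], by simp [h2, h2'],
      by simp [h3, h3']⟩
  smul_mem' := by
    rintro c p ⟨u, hu, v, hv, h1, h2, h3⟩
    exact ⟨c • u, Submodule.smul_mem _ _ hu, c • v, Submodule.smul_mem _ _ hv, by simp [h1],
      by simp [h2], by simp [h3]⟩

variable (T : Twist δ θ P N)
include T

lemma conn_mem {n : ℕ} : ∀ p ∈ T.conn n, p.2 ∈ Zc δ (Ec θ N) (n + 2) := by
  rintro ⟨e, f⟩ ⟨u, hu, v, hv, h1, h2, rfl⟩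
  refine ⟨⟨T.dN _ _ hv, ?_⟩, T.sq _ _⟩
  refine LinearMap.mem_ker.2 ?_; rw [← T.comm, ← h2, T.sq]

lemma conn_total {n : ℕ} : ∀ x ∈ Zc δ (Ec θ P) n, ∃ y, (x, y) ∈ T.conn n := by
  rintro x ⟨⟨h1, h2⟩, h3⟩
  obtain ⟨u, hu, rfl⟩ := T.exP n x h1 h2
  obtain ⟨v, hv, e⟩ := T.exP_sq (T.dP n u hu) (by rw [← T.comm, ← T.comm]; exact h3)
  exact ⟨_, u, hu, v, hv, rfl, e, rfl⟩

lemma exists_primitive {n : ℕ} {x : M n} (hx : x ∈ Bc δ (Ec θ P) n) {u : M n} (hu : u ∈ P n)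
    (h : θ n (θ n u) = x) : ∃ w ∈ N n, δ n u = δ n (θ n w) := by
  cases n with
  | zero =>
    obtain ⟨w, hw, rfl⟩ := T.exP_sq hu (h.trans (mem_Bc_zero.1 hx))
    exact ⟨w, hw, rfl⟩
  | succ n =>
    obtain ⟨e, he, rfl⟩ := mem_Bc_succ.1 hx
    obtain ⟨u', hu', rfl⟩ := T.exP n e he.1 he.2
    obtain ⟨w, hw, e'⟩ := T.exP_sq (x := u - δ n u') (sub_mem hu (T.dP n u' hu'))
      (by rw [map_sub, map_sub, h, ← T.comm, ← T.comm, sub_self])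
    exact ⟨w, hw, by rw [← e', map_sub, T.sq, sub_zero]⟩

lemma conn_wd {n : ℕ} : ∀ x ∈ Bc δ (Ec θ P) n, ∀ y, (x, y) ∈ T.conn n →
    y ∈ Bc δ (Ec θ N) (n + 2) := by
  rintro x hx y ⟨u, hu, v, hv, h1, h2, rfl⟩
  obtain ⟨w, hw, e⟩ := T.exists_primitive hx hu h1
  refine mem_Bc_succ.2 ⟨v - δ n w, ⟨sub_mem hv (T.dN n w hw), ?_⟩, ?_⟩
  · refine LinearMap.mem_ker.2 ?_; rw [map_sub, ← h2, e, T.comm, sub_self]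
  · rw [map_sub, T.sq, sub_zero]

lemma sq_mem_Bc {n : ℕ} {b : M n} (hb : b ∈ Bc δ P n) : θ n (θ n b) ∈ Bc δ (Ec θ P) n := by
  cases n with
  | zero => rw [mem_Bc_zero.1 hb, map_zero, map_zero]; exact zero_mem _
  | succ n =>
    obtain ⟨u, hu, rfl⟩ := mem_Bc_succ.1 hb
    refine mem_Bc_succ.2 ⟨θ n (θ n u), ⟨T.tN _ _ (T.tP _ _ hu), T.cube _ _⟩, ?_⟩
    rw [T.comm, T.comm]

lemma exists_sq_primitive {n : ℕ} {v : M (n + 1)} (hv : v ∈ N (n + 1)) {u : M n} (hu : u ∈ P n)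
    (h : θ (n + 1) v = δ n u) : θ n (θ n u) ∈ Zc δ (Ec θ P) n ∧
      (θ n (θ n u), δ (n + 1) v) ∈ T.conn n :=
  ⟨⟨⟨T.tN _ _ (T.tP _ _ hu), T.cube _ _⟩, by
    refine LinearMap.mem_ker.2 ?_; rw [T.comm, T.comm, ← h, T.cube]⟩, u, hu, v, hv, rfl, h.symm, rfl⟩

end Twist

/-- Surjectivity on cohomology of the inclusion of the part killed by an endomorphism. -/
def Surj (δ : ∀ n, M n →ₗ[ZMod 3] M (n + 1)) (θ : ∀ n, M n →ₗ[ZMod 3] M n)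
    (P : ∀ n, Submodule (ZMod 3) (M n)) : Prop :=
  ∀ n, ∀ x ∈ Zc δ P n, ∃ y ∈ Zc δ (Ec θ P) n, x - y ∈ Bc δ P n

namespace Twist

variable {P N : ∀ n, Submodule (ZMod 3) (M n)} (T : Twist δ θ P N)
  (hN : ∀ n, ∀ x ∈ Zc δ N n, x ∈ Bc δ N n) (hR : Surj δ θ P)
include T hN hR

lemma conn_inj_neg {n : ℕ} : ∀ x, ∀ y ∈ Bc δ (Ec θ P) (n + 2), (x, y) ∈ T.swap.conn n →
    x ∈ Bc δ (Ec θ N) n := by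
  rintro x y hy ⟨u, hu, v, hv, rfl, h2, rfl⟩
  obtain ⟨f', hf', e⟩ := mem_Bc_succ.1 hy
  obtain ⟨y, hy, hb⟩ := hR (n + 1) (v - f') ⟨sub_mem hv hf'.1, by
    refine LinearMap.mem_ker.2 ?_; rw [map_sub, e, sub_self]⟩
  obtain ⟨w, hw, e'⟩ := mem_Bc_succ.1 hb
  have e2 : δ n u = δ n (θ n w) := by
    rw [h2, T.comm, e', map_sub, map_sub, hf'.2, hy.1.2, sub_zero, sub_zero]
  have := T.swap.sq_mem_Bc (hN n (u - θ n w) ⟨sub_mem hu (T.tP _ _ hw), by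
    refine LinearMap.mem_ker.2 ?_; rw [map_sub, e2, sub_self]⟩)
  rwa [map_sub, map_sub, T.cube, sub_zero] at this

lemma conn_inj_pos {n : ℕ} : ∀ x, ∀ y ∈ Bc δ (Ec θ N) (n + 2), (x, y) ∈ T.conn n →
    x ∈ Bc δ (Ec θ P) n := by
  rintro x y hy ⟨u, hu, v, hv, rfl, h2, rfl⟩
  obtain ⟨f', hf', e⟩ := mem_Bc_succ.1 hy
  obtain ⟨w, hw, e'⟩ := mem_Bc_succ.1 (hN (n + 1) (v - f') ⟨sub_mem hv hf'.1, by
    refine LinearMap.mem_ker.2 ?_; rw [map_sub, e, sub_self]⟩)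
  have e2 : δ n u = δ n (θ n w) := by
    rw [h2, T.comm, e', map_sub, hf'.2, sub_zero]
  obtain ⟨y, hy, hb⟩ := hR n (u - θ n w) ⟨sub_mem hu (T.tN _ _ hw), by
    refine LinearMap.mem_ker.2 ?_; rw [map_sub, e2, sub_self]⟩
  have := T.sq_mem_Bc hb
  rwa [map_sub, map_sub, map_sub, map_sub, T.cube, hy.1.2, map_zero, sub_zero, sub_zero] at this

lemma hasDim_pos {n e a : ℕ} (he : HasDim (Zc δ (Ec θ N) n) (Bc δ (Ec θ N) n) e)
    (ha : HasDim (Zc δ P (n + 2)) (Bc δ P (n + 2)) a) :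
    HasDim (Zc δ (Ec θ P) (n + 2)) (Bc δ (Ec θ P) (n + 2)) (e + a) := by
  let S : Submodule (ZMod 3) (M (n + 2) × M (n + 2)) :=
    ((Zc δ (Ec θ P) (n + 2)).comap (LinearMap.snd _ _ _)) ⊓
      (Bc δ P (n + 2)).comap (LinearMap.fst _ _ _ - LinearMap.snd _ _ _)
  have hle : Bc δ (Ec θ P) (n + 2) ≤ Bc δ P (n + 2) := by
    rintro x ⟨y, hy, rfl⟩
    exact ⟨y, hy.1, rfl⟩
  refine HasDim.add (T.swap.conn n) S he ha T.swap.conn_mem (fun p hp => hp.1) T.swap.conn_total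
    T.swap.conn_wd (T.conn_inj_neg hN hR) (fun y hy => ⟨y, ⟨hy.1.1, hy.2⟩, hy, ?_⟩)
    (fun z y hy h => ?_) (fun z hz => ?_) (fun x y h => ⟨T.swap.conn_mem _ h, ?_⟩)
    (fun z hz y h => ?_)
  · simp
  · have h' : z - y ∈ Bc δ P (n + 2) := h.2
    simpa using add_mem h' (hle hy)
  · obtain ⟨y, hy, h⟩ := hR _ z hz
    exact ⟨y, hy, h⟩
  · obtain ⟨u, hu, v, hv, -, -, rfl⟩ := h
    refine mem_Bc_succ.2 ⟨-v, neg_mem hv, ?_⟩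
    simp
  · have : y ∈ Bc δ P (n + 2) := by
      have := sub_mem hz h.2
      simpa using this
    obtain ⟨v, hv, rfl⟩ := mem_Bc_succ.1 this
    obtain ⟨u, hu, e⟩ := mem_Bc_succ.1 (hN (n + 1) (θ _ v) ⟨T.tP _ _ hv, by
      refine LinearMap.mem_ker.2 ?_; rw [T.comm]; exact h.1.1.2⟩)
    obtain ⟨k1, k2⟩ := T.swap.exists_sq_primitive hv hu e.symm
    exact ⟨_, k1, k2⟩

/-- The relation between cocycles given by a primitive. -/
def prim (_ : Twist δ θ P N) (n : ℕ) : Submodule (ZMod 3) (M n × M (n + 1)) where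
  carrier := {p | p.2 ∈ Ec θ N (n + 1) ∧ ∃ v ∈ N n, δ n v = p.2 ∧ p.1 - θ n v ∈ Bc δ P n}
  zero_mem' := ⟨zero_mem _, 0, zero_mem _, by simp, by simp⟩
  add_mem' := by
    rintro p p' ⟨h0, v, hv, h1, h2⟩ ⟨h0', v', hv', h1', h2'⟩
    refine ⟨add_mem h0 h0', v + v', add_mem hv hv', by simp [h1, h1'], ?_⟩
    rw [map_add, Prod.fst_add, add_sub_add_comm]
    exact add_mem h2 h2'
  smul_mem' := by
    rintro c p ⟨h0, v, hv, h1, h2⟩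
    refine ⟨Submodule.smul_mem _ _ h0, c • v, Submodule.smul_mem _ _ hv, by simp [h1], ?_⟩
    rw [map_smul, Prod.smul_fst, ← smul_sub]
    exact Submodule.smul_mem _ _ h2

omit hN hR in
lemma theta_mem_Bc {n : ℕ} {b : M n} (hb : b ∈ Bc δ N n) : θ n b ∈ Bc δ P n := by
  cases n with
  | zero => rw [mem_Bc_zero.1 hb, map_zero]; exact zero_mem _
  | succ n =>
    obtain ⟨u, hu, rfl⟩ := mem_Bc_succ.1 hb
    exact mem_Bc_succ.2 ⟨θ n u, T.tN _ _ hu, T.comm _ _⟩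

omit hR in
lemma prim_wd {n : ℕ} : ∀ z, ∀ y ∈ Bc δ (Ec θ N) (n + 1), (z, y) ∈ T.prim n → z ∈ Bc δ P n := by
  rintro z y hy ⟨-, v, hv, rfl, h⟩
  obtain ⟨f, hf, e⟩ := mem_Bc_succ.1 hy
  have := T.theta_mem_Bc (hN n (v - f) ⟨sub_mem hv hf.1, by
    refine LinearMap.mem_ker.2 ?_; rw [map_sub, e, sub_self]⟩)
  rw [map_sub, hf.2, sub_zero] at this
  simpa using add_mem h this

omit hR in
lemma prim_total {n : ℕ} : ∀ y ∈ Zc δ (Ec θ N) (n + 1), ∃ z ∈ Zc δ P n, (z, y) ∈ T.prim n := by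
  rintro y ⟨h1, h2⟩
  obtain ⟨v, hv, rfl⟩ := mem_Bc_succ.1 (hN _ y ⟨h1.1, h2⟩)
  refine ⟨θ n v, ⟨T.tN _ _ hv, ?_⟩, h1, v, hv, rfl, ?_⟩
  · refine LinearMap.mem_ker.2 ?_
    rw [T.comm, h1.2]
  · rw [sub_self]
    exact zero_mem _

omit hN in
lemma prim_surj {n : ℕ} : ∀ z ∈ Zc δ P n, ∃ y, (z, y) ∈ T.prim n := by
  intro z hz
  obtain ⟨y, hy, hb⟩ := hR n z hz
  obtain ⟨u, hu, e⟩ := T.exP n y hy.1.1 hy.1.2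
  refine ⟨δ n (θ n u), ⟨T.dN _ _ (T.tP _ _ hu), ?_⟩, θ n u, T.tP _ _ hu, rfl, ?_⟩
  · refine LinearMap.mem_ker.2 ?_
    rw [← T.comm, ← e, hy.2]
  · rw [← e]
    exact hb

lemma hasDim_neg {n e a : ℕ} (he : HasDim (Zc δ (Ec θ P) n) (Bc δ (Ec θ P) n) e)
    (ha : HasDim (Zc δ P (n + 1)) (Bc δ P (n + 1)) a) :
    HasDim (Zc δ (Ec θ N) (n + 2)) (Bc δ (Ec θ N) (n + 2)) (e + a) := by
  refine HasDim.add (T.conn n) (T.prim (n + 1)) he ha T.conn_mem ?_ T.conn_total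
    T.conn_wd (T.conn_inj_pos hN hR) (T.prim_total hN) (T.prim_wd hN) (T.prim_surj hR)
    (fun x y h => ⟨(T.conn_mem _ h).1, ?_⟩) (fun z hz y h => ?_)
  · rintro p ⟨h, v, hv, e, -⟩
    exact ⟨h, by refine LinearMap.mem_ker.2 ?_; rw [← e, T.sq]⟩
  · obtain ⟨u, hu, v, hv, -, h2, h3⟩ := h
    refine ⟨v, hv, h3, mem_Bc_succ.2 ⟨-u, neg_mem hu, ?_⟩⟩
    rw [map_neg, h2, zero_sub]
  · obtain ⟨-, v, hv, h3, h2⟩ := h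
    obtain ⟨u, hu, e⟩ := mem_Bc_succ.1 (sub_mem hz h2)
    obtain ⟨k1, k2⟩ := T.exists_sq_primitive hv hu (by simpa using e.symm)
    rw [show δ (n + 1) v = y from h3] at k2
    exact ⟨_, k1, k2⟩

lemma hasDim_neg_one {a : ℕ} (ha : HasDim (Zc δ P 0) (Bc δ P 0) a) :
    HasDim (Zc δ (Ec θ N) 1) (Bc δ (Ec θ N) 1) a := by
  refine HasDim.of_rel (T.prim 0) ha ?_ (T.prim_total hN) (T.prim_wd hN) (T.prim_surj hR) ?_
  · rintro p ⟨h, v, hv, e, -⟩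
    exact ⟨h, by refine LinearMap.mem_ker.2 ?_; rw [← e, T.sq]⟩
  · rintro z hz y ⟨h, v, hv, h3, h2⟩
    have e := mem_Bc_zero.1 (sub_mem hz h2)
    simp only [sub_sub_cancel] at e
    exact mem_Bc_succ.2 ⟨v, ⟨hv, e⟩, h3⟩

omit T hR in
lemma hasDim_neg_zero : HasDim (Zc δ (Ec θ N) 0) (Bc δ (Ec θ N) 0) 0 :=
  HasDim.zero fun f hf => hN 0 f ⟨hf.1.1, hf.2⟩

omit T hN in
lemma hasDim_pos_zero {a : ℕ} (ha : HasDim (Zc δ P 0) (Bc δ P 0) a) :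
    HasDim (Zc δ (Ec θ P) 0) (Bc δ (Ec θ P) 0) a := by
  have : Zc δ (Ec θ P) 0 = Zc δ P 0 := by
    refine le_antisymm (fun x hx => ⟨hx.1.1, hx.2⟩) fun x hx => ?_
    obtain ⟨y, hy, h⟩ := hR 0 x hx
    rw [sub_eq_zero.1 (mem_Bc_zero.1 h)]
    exact hy
  rw [this]
  exact ha

lemma hasDim_pos_one {a : ℕ} (ha : HasDim (Zc δ P 1) (Bc δ P 1) a) :
    HasDim (Zc δ (Ec θ P) 1) (Bc δ (Ec θ P) 1) a := by
  let S : Submodule (ZMod 3) (M 1 × M 1) :=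
    ((Zc δ (Ec θ P) 1).comap (LinearMap.snd _ _ _)) ⊓
      (Bc δ P 1).comap (LinearMap.fst _ _ _ - LinearMap.snd _ _ _)
  have hle : Bc δ (Ec θ P) 1 ≤ Bc δ P 1 := by
    rintro x ⟨y, hy, rfl⟩
    exact ⟨y, hy.1, rfl⟩
  have hge : ∀ x ∈ Zc δ (Ec θ P) 1, x ∈ Bc δ P 1 → x ∈ Bc δ (Ec θ P) 1 := by
    intro x hx hb
    obtain ⟨v, hv, rfl⟩ := mem_Bc_succ.1 hb
    have := mem_Bc_zero.1 (hN 0 (θ 0 v) ⟨T.tP _ _ hv, by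
      refine LinearMap.mem_ker.2 ?_; rw [T.comm, hx.1.2]⟩)
    exact mem_Bc_succ.2 ⟨v, ⟨hv, this⟩, rfl⟩
  refine HasDim.of_rel S ha (fun p hp => hp.1) (fun y hy => ⟨y, ⟨hy.1.1, hy.2⟩, hy, ?_⟩)
    (fun z y hy h => ?_) (fun z hz => ?_) (fun z hz y h => hge y h.1 ?_)
  · simp
  · have h' : z - y ∈ Bc δ P 1 := h.2
    simpa using add_mem h' (hle hy)
  · obtain ⟨y, hy, h⟩ := hR _ z hz
    exact ⟨y, hy, h⟩
  · have := sub_mem hz h.2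
    simpa using this

end Twist

end Complex

section Complex

variable {M : ℕ → Type} [∀ n, AddCommGroup (M n)] [∀ n, Module (ZMod 3) (M n)]
  {δ : ∀ n, M n →ₗ[ZMod 3] M (n + 1)} {θ : ∀ n, M n →ₗ[ZMod 3] M n}
  {P N : ∀ n, Submodule (ZMod 3) (M n)}

variable (δ θ P N) in
/-- A larger pair of complexes with little cohomology. -/
structure Ambient (P' N' : ∀ n, Submodule (ZMod 3) (M n)) (ω : M 1) : Prop where
  leP : ∀ n, P n ≤ P' n
  leN : ∀ n, N n ≤ N' n
  tP : ∀ n, ∀ x ∈ P' n, θ n x ∈ N' n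
  tN : ∀ n, ∀ x ∈ N' n, θ n x ∈ P' n
  acP : ∀ n, n = 2 ∨ n = 3 → ∀ x ∈ P' (n + 1), δ (n + 1) x = 0 → ∃ y ∈ P' n, x = δ n y
  acN : ∀ n, n ≤ 2 → ∀ x ∈ N' (n + 1), δ (n + 1) x = 0 → ∃ y ∈ N' n, x = δ n y
  lift : ∀ g ∈ P' 0, δ 0 g ∈ P 1 → ∃ r ∈ P 0, δ 0 g = δ 0 r
  one : ∀ x ∈ P' 1, δ 1 x = 0 → ∃ a : ZMod 3, ∃ m ∈ P' 0, x = a • ω + δ 0 m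
  omega : θ 1 ω = 0
  const : ∀ x, δ 0 x = 0 → θ 0 x = 0

namespace Twist

variable (T : Twist δ θ P N) (hN : ∀ n, ∀ x ∈ Zc δ N n, x ∈ Bc δ N n)
  {P' N' : ∀ n, Submodule (ZMod 3) (M n)} {ω : M 1} (A : Ambient δ θ P N P' N' ω)
include T hN

lemma theta_primitive {n : ℕ} {x : M (n + 1)} (hx : x ∈ Zc δ P (n + 1)) :
    ∃ u ∈ N n, θ (n + 1) x = δ n u ∧ θ n (θ n u) ∈ Zc δ N n := by
  obtain ⟨u, hu, e⟩ := mem_Bc_succ.1 (hN (n + 1) (θ _ x) ⟨T.tP _ _ hx.1, by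
    refine LinearMap.mem_ker.2 ?_; rw [T.comm, hx.2, map_zero]⟩)
  refine ⟨u, hu, e.symm, T.tP _ _ (T.tN _ _ hu), LinearMap.mem_ker.2 ?_⟩
  rw [T.comm, T.comm, e, T.cube]

omit hN in
/-- The last step in the construction of invariant representatives. -/
lemma exists_invariant {n : ℕ} {x : M (n + 1)} (hx : x ∈ Zc δ P (n + 1)) {u : M n} (hu : u ∈ N n)
    (e : θ (n + 1) x = δ n u) {v : M n} (hv : v ∈ N n) (hv' : δ n v = 0)
    (e' : θ n (θ n u) = θ n (θ n v)) :
    ∃ y ∈ Zc δ (Ec θ P) (n + 1), x - y ∈ Bc δ P (n + 1) := by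
  obtain ⟨y, hy, h⟩ := T.swap.exP_sq (x := u - v) (sub_mem hu hv)
    (by rw [map_sub, map_sub, e', sub_self])
  refine ⟨x - δ n y, ⟨⟨sub_mem hx.1 (T.dP _ _ hy), LinearMap.mem_ker.2 ?_⟩,
    LinearMap.mem_ker.2 ?_⟩, ?_⟩
  · rw [map_sub, e, ← T.comm, ← h, map_sub, hv', sub_zero, sub_self]
  · rw [map_sub, hx.2, T.sq, sub_zero]
  · rw [sub_sub_cancel]
    exact mem_Bc_succ.2 ⟨y, hy, rfl⟩

lemma surj_zero : ∀ x ∈ Zc δ P 0, ∃ y ∈ Zc δ (Ec θ P) 0, x - y ∈ Bc δ P 0 := by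
  intro x hx
  refine ⟨x, ⟨⟨hx.1, ?_⟩, hx.2⟩, by rw [sub_self]; exact zero_mem _⟩
  refine mem_Bc_zero.1 (hN 0 _ ⟨T.tP _ _ hx.1, LinearMap.mem_ker.2 ?_⟩)
  rw [T.comm, hx.2, map_zero]

lemma surj_one : ∀ x ∈ Zc δ P 1, ∃ y ∈ Zc δ (Ec θ P) 1, x - y ∈ Bc δ P 1 := by
  intro x hx
  obtain ⟨u, hu, e, h⟩ := T.theta_primitive hN hx
  exact T.exists_invariant hx hu e (zero_mem _) (map_zero _)
    (by rw [map_zero, map_zero]; exact mem_Bc_zero.1 (hN 0 _ h))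

include A

/-- The part of the construction which only depends on descent from the ambient complex. -/
lemma surj_of_descent {n : ℕ} (hn : n = 1 ∨ n = 0)
    (D : ∀ p' ∈ N' n, θ (n + 1) (δ n p') ∈ P (n + 1) →
      ∃ v ∈ N n, θ (n + 1) (δ n p') = δ n (θ n v)) :
    ∀ x ∈ Zc δ P (n + 3), ∃ y ∈ Zc δ (Ec θ P) (n + 3), x - y ∈ Bc δ P (n + 3) := by
  intro x hx
  obtain ⟨u, hu, e, h⟩ := T.theta_primitive hN hx
  obtain ⟨p, hp, hpe⟩ := mem_Bc_succ.1 (hN _ _ h)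
  obtain ⟨x', hx', rfl⟩ := A.acP (n + 2) (by omega) x (A.leP _ hx.1) hx.2
  obtain ⟨u', hu', e1⟩ := A.acN (n + 1) (by omega) (u - θ _ x')
    (sub_mem (A.leN _ hu) (A.tP _ _ hx')) (by rw [map_sub, ← e, T.comm, sub_self])
  have e2 : θ (n + 2) (θ (n + 2) u) = δ (n + 1) (θ (n + 1) (θ (n + 1) u')) := by
    rw [T.comm, T.comm, ← e1, map_sub, map_sub, T.cube, sub_zero]
  obtain ⟨p', hp', e3⟩ := A.acN n (by omega) (p - θ _ (θ _ u'))
    (sub_mem (A.leN _ hp) (A.tP _ _ (A.tN _ _ hu'))) (by rw [map_sub, hpe, e2, sub_self])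
  have e4 : θ (n + 1) p = θ (n + 1) (δ n p') := by
    rw [← e3, map_sub, T.cube, sub_zero]
  obtain ⟨v, hv, e5⟩ := D p' hp' (by rw [← e4]; exact T.tN _ _ hp)
  obtain ⟨w, hw, e6⟩ := T.exN (n + 1) (p - δ n v) (sub_mem hp (T.dN _ _ hv))
    (by rw [map_sub, e4, e5, T.comm, sub_self])
  refine T.exists_invariant hx hu e (T.dN _ _ hw) (T.sq _ _) ?_
  rw [← T.comm, ← T.comm, ← e6, map_sub, T.sq, sub_zero, hpe]

lemma surj_three : ∀ x ∈ Zc δ P 3, ∃ y ∈ Zc δ (Ec θ P) 3, x - y ∈ Bc δ P 3 := by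
  refine T.surj_of_descent hN A (n := 0) (by omega) fun p' hp' h => ?_
  rw [← T.comm] at h ⊢
  obtain ⟨r, hr, e⟩ := A.lift _ (A.tN _ _ hp') h
  have e2 : θ 0 (θ 0 r) = 0 := by
    have := A.const (θ 0 p' - r) (by rw [map_sub, e, sub_self])
    rw [map_sub, sub_eq_zero] at this
    rw [← this, T.cube]
  obtain ⟨v, hv, rfl⟩ := T.exP_sq hr e2
  exact ⟨v, hv, e⟩

lemma surj_four (hP : ∀ x ∈ Zc δ P 2, x ∈ Bc δ P 2) :
    ∀ x ∈ Zc δ P 4, ∃ y ∈ Zc δ (Ec θ P) 4, x - y ∈ Bc δ P 4 := by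
  refine T.surj_of_descent hN A (n := 1) (by omega) fun p' hp' h => ?_
  rw [← T.comm] at h ⊢
  obtain ⟨r, hr, e⟩ := mem_Bc_succ.1 (hP _ ⟨h, T.sq _ _⟩)
  obtain ⟨a, m, hm, e1⟩ := A.one (r - θ 1 p') (sub_mem (A.leP _ hr) (A.tN _ _ hp'))
    (by rw [map_sub, e, sub_self])
  have e2 : θ 1 (θ 1 r) = δ 0 (θ 0 (θ 0 m)) := by
    rw [sub_eq_iff_eq_add] at e1
    rw [e1, T.comm, T.comm]
    simp only [map_add, map_smul, A.omega, T.cube, smul_zero, zero_add, add_zero]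
  obtain ⟨m', hm', e3⟩ := A.lift _ (A.tN _ _ (A.tP _ _ hm))
    (by rw [← e2]; exact T.tN _ _ (T.tP _ _ hr))
  have e4 : θ 0 m' = 0 := by
    refine mem_Bc_zero.1 (hN 0 _ ⟨T.tP _ _ hm', LinearMap.mem_ker.2 ?_⟩)
    rw [T.comm, ← e3, ← e2, T.cube]
  obtain ⟨m'', hm'', rfl⟩ := T.exP 0 m' hm' e4
  obtain ⟨v, hv, e5⟩ := T.exP_sq (x := r - δ 0 m'') (sub_mem hr (T.dP _ _ hm''))
    (by rw [map_sub, map_sub, e2, e3, ← T.comm, ← T.comm, sub_self])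
  exact ⟨v, hv, by rw [← e5, map_sub, T.sq, sub_zero, e]⟩

lemma surj (hP : ∀ n, n = 2 ∨ 5 ≤ n → ∀ x ∈ Zc δ P n, x ∈ Bc δ P n) : Surj δ θ P := by
  intro n
  by_cases h : n = 2 ∨ 5 ≤ n
  · exact fun x hx => ⟨0, zero_mem _, by rw [sub_zero]; exact hP n h x hx⟩
  · obtain rfl | rfl | rfl | rfl : n = 0 ∨ n = 1 ∨ n = 3 ∨ n = 4 := by omega
    · exact T.surj_zero hN
    · exact T.surj_one hN
    · exact T.surj_three hN A
    · exact T.surj_four hN A (hP 2 (by omega))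

end Twist

/-- The dimensions for the trivial character. -/
def dimPos (n : ℕ) : ℕ :=
  if n = 0 then 1 else if n = 1 then 1 else if n = 2 then 0 else if n = 3 then 2
    else if n % 4 = 0 ∨ n % 4 = 3 then 3 else 1

/-- The dimensions for the nontrivial character. -/
def dimNeg (n : ℕ) : ℕ :=
  if n = 0 then 0 else if n = 1 then 1 else if n = 2 then 2 else if n = 3 then 1
    else if n % 4 = 1 ∨ n % 4 = 2 then 3 else 1

/-- The dimensions for the larger group. -/
def dimBase (n : ℕ) : ℕ := if n = 0 ∨ n = 1 ∨ n = 3 ∨ n = 4 then 1 else 0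

lemma dimPos_rec (n : ℕ) : dimPos (n + 2) = dimNeg n + dimBase (n + 2) := by
  unfold dimPos dimNeg dimBase
  grind

lemma dimNeg_rec (n : ℕ) : dimNeg (n + 2) = dimPos n + dimBase (n + 1) := by
  unfold dimPos dimNeg dimBase
  grind

namespace Twist

/-- The dimensions of the cohomology of the part killed by an endomorphism. -/
lemma hasDim (T : Twist δ θ P N) (hN : ∀ n, ∀ x ∈ Zc δ N n, x ∈ Bc δ N n) (hR : Surj δ θ P)
    (hP : ∀ n, HasDim (Zc δ P n) (Bc δ P n) (dimBase n)) (n : ℕ) :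
    HasDim (Zc δ (Ec θ P) n) (Bc δ (Ec θ P) n) (dimPos n) := by
  suffices H : HasDim (Zc δ (Ec θ P) n) (Bc δ (Ec θ P) n) (dimPos n) ∧
      HasDim (Zc δ (Ec θ N) n) (Bc δ (Ec θ N) n) (dimNeg n) from H.1
  induction n using Nat.twoStepInduction with
  | zero => exact ⟨hasDim_pos_zero hR (hP 0), hasDim_neg_zero hN⟩
  | one => exact ⟨T.hasDim_pos_one hN hR (hP 1), T.hasDim_neg_one hN hR (hP 0)⟩
  | more n ih _ =>
    rw [dimPos_rec, dimNeg_rec]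
    exact ⟨T.hasDim_pos hN hR ih.2 (hP _), T.hasDim_neg hN hR ih.1 (hP _)⟩

end Twist

end Complex

/-! ### The element of order three -/

/-- An element of order three. -/
def cF : GF := ⟨!![0, -1; 1, -1], !![-1, 1; -1, 0], by decide, by decide⟩

/-- An element of order three. -/
noncomputable def cG : GZ := ⟨!![0, -1; 1, -1], !![-1, 1; -1, 0],
  by simp [Matrix.one_fin_two], by simp [Matrix.one_fin_two]⟩

lemma red_cG : red cG = cF := by
  apply Units.ext
  rw [red_val]
  funext i j
  rw [redM_apply]
  fin_cases i <;> fin_cases j <;> simp [cG, cF]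

lemma cG_sq : cG * cG = cG⁻¹ := by
  apply Units.ext
  rw [Units.val_mul]
  change !![0, -1; 1, -1] * !![0, -1; 1, -1] = (!![-1, 1; -1, 0] : R)
  simp

lemma cG_inv_sq : cG⁻¹ * cG⁻¹ = cG := by
  rw [← mul_inv_rev, cG_sq, inv_inv]

lemma conj_one : ∀ a b c d : ZMod 3, a * d - b * c = 1 → a * c + b * d = 0 →
    ∀ x : RF, (x = !![-1, 1; -1, 0] * !![a, b; c, d] * !![0, -1; 1, -1] ∨
      x = !![0, -1; 1, -1] * !![a, b; c, d] * !![-1, 1; -1, 0]) →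
      x 0 0 * x 1 0 + x 0 1 * x 1 1 = 0 := by
  intro a b c d h h' x hx
  rcases hx with rfl | rfl <;> simp only [Matrix.mul_fin_two, Matrix.of_apply, Matrix.cons_val',
    Matrix.cons_val_zero, Matrix.cons_val_one, Matrix.cons_val_fin_one] <;> revert a b c d <;>
    decide

lemma conj_neg : ∀ a b c d : ZMod 3, a * d - b * c = -1 → a * c + b * d = 0 →
    ∀ x : RF, (x = !![-1, 1; -1, 0] * !![a, b; c, d] * !![-1, 1; -1, 0] ∨
      x = !![0, -1; 1, -1] * !![a, b; c, d] * !![0, -1; 1, -1]) →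
      x 0 0 * x 1 0 + x 0 1 * x 1 1 = 0 := by
  intro a b c d h h' x hx
  rcases hx with rfl | rfl <;> simp only [Matrix.mul_fin_two, Matrix.of_apply, Matrix.cons_val',
    Matrix.cons_val_zero, Matrix.cons_val_one, Matrix.cons_val_fin_one] <;> revert a b c d <;>
    decide

lemma HF_conj_one {x : GF} (hx : x ∈ HF) (h : detF x = 1) :
    cF⁻¹ * x * cF ∈ HF ∧ cF * x * cF⁻¹ ∈ HF := by
  rw [detF_apply] at h
  have e := Matrix.eta_fin_two (x : RF)
  constructor
  · refine conj_one _ _ _ _ h hx _ (Or.inl ?_)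
    rw [← e]
    rfl
  · refine conj_one _ _ _ _ h hx _ (Or.inr ?_)
    rw [← e]
    rfl

lemma HF_conj_neg {x : GF} (hx : x ∈ HF) (h : detF x = -1) :
    cF⁻¹ * x * cF⁻¹ ∈ HF ∧ cF * x * cF ∈ HF := by
  rw [detF_apply] at h
  have e := Matrix.eta_fin_two (x : RF)
  constructor
  · refine conj_neg _ _ _ _ h hx _ (Or.inl ?_)
    rw [← e]
    rfl
  · refine conj_neg _ _ _ _ h hx _ (Or.inr ?_)
    rw [← e]
    rfl

lemma detF_cases (x : GF) : detF x = 1 ∨ detF x = -1 := by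
  have h : detF x ≠ 0 := by rw [detF_apply]; exact GF_det x
  revert h
  generalize detF x = a
  revert a
  decide

lemma detF_mul_self : detF * detF = 1 := by
  ext x
  rw [MonoidHom.mul_apply, MonoidHom.one_apply]
  rcases detF_cases x with h | h <;> rw [h] <;> decide

lemma cF_sq : cF * cF = cF⁻¹ := by
  rw [← red_cG, ← map_mul, cG_sq, map_inv]

lemma char_cF (χ : GF →* ZMod 3) : χ cF = 1 := by
  have h : χ cF * χ cF * χ cF = 1 := by
    rw [← map_mul, ← map_mul, cF_sq, inv_mul_cancel, map_one]
  revert h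
  generalize χ cF = a
  revert a
  decide

/-- The difference of the translations by an element of order three and its inverse. -/
noncomputable def thL (k : ℕ) : Fn GZ k →ₗ[ZMod 3] Fn GZ k := ltr cG⁻¹ k - ltr cG k

lemma thL_apply {k : ℕ} (f : Fn GZ k) (x : Fin k → GZ) :
    thL k f x = f (fun l => cG⁻¹ * x l) - f fun l => cG * x l := rfl

lemma thL_thL {k : ℕ} (f : Fn GZ k) (x : Fin k → GZ) :
    thL k (thL k f) x = f x + f (fun l => cG * x l) + f fun l => cG⁻¹ * x l := by
  simp only [thL_apply, ← mul_assoc, cG_sq, cG_inv_sq, inv_mul_cancel, mul_inv_cancel, one_mul]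
  have h : (3 : ZMod 3) = 0 := rfl
  linear_combination -(f x) * h

lemma thL_cube {k : ℕ} (f : Fn GZ k) : thL k (thL k (thL k f)) = 0 := by
  funext x
  rw [thL_thL, thL_apply, thL_apply, thL_apply]
  simp only [← mul_assoc, cG_sq, cG_inv_sq, inv_mul_cancel, mul_inv_cancel, one_mul]
  rw [Pi.zero_apply]
  ring

lemma hd_thL {k : ℕ} (f : Fn GZ k) : hd k (thL k f) = thL (k + 1) (hd k f) := by
  simp only [thL, LinearMap.sub_apply, map_sub, hd_ltr]

lemma LCG_thL {k : ℕ} {f : Fn GZ k} (hf : f ∈ LCG k) : thL k f ∈ LCG k :=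
  sub_mem (LCG_ltr _ hf) (LCG_ltr _ hf)

lemma thL_mem {χ : GF →* ZMod 3} {k : ℕ} {f : Fn GZ k} (hf : f ∈ DG χ k) :
    thL k f ∈ DG (χ * detF) k := by
  obtain ⟨h1, h2⟩ := mem_DG.1 hf
  have key : ∀ h, red h ∈ HF → ∀ x : Fin k → GZ, (f fun l => h * x l) = χ (red h) * f x :=
    fun h hh x => congrFun (h2 h hh) x
  refine mem_DG.2 ⟨LCG_thL h1, fun h hh => ?_⟩
  funext x
  rw [ltr_apply, thL_apply, Pi.smul_apply, thL_apply, MonoidHom.mul_apply, smul_eq_mul]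
  rcases detF_cases (red h) with hd | hd
  · obtain ⟨k1, k2⟩ := HF_conj_one hh hd
    have e1 := key (cG⁻¹ * h * cG) (by simpa [red_cG] using k1) fun l => cG⁻¹ * x l
    have e2 := key (cG * h * cG⁻¹) (by simpa [red_cG] using k2) fun l => cG * x l
    simp only [map_mul, map_inv, red_cG, char_cF, mul_assoc, mul_inv_cancel_left,
      inv_mul_cancel_left, one_mul, mul_one] at e1 e2 ⊢
    rw [e1, e2, hd]
    ring
  · obtain ⟨k1, k2⟩ := HF_conj_neg hh hd
    have e1 := key (cG⁻¹ * h * cG⁻¹) (by simpa [red_cG] using k1) fun l => cG * x l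
    have e2 := key (cG * h * cG) (by simpa [red_cG] using k2) fun l => cG⁻¹ * x l
    simp only [map_mul, map_inv, red_cG, char_cF, mul_assoc, mul_inv_cancel_left,
      inv_mul_cancel_left, one_mul, mul_one] at e1 e2 ⊢
    rw [e1, e2, hd]
    ring

open Classical in
/-- The indicator function of the finite subgroup. -/
noncomputable def indF (x : GF) : ZMod 3 := if x ∈ HF then 1 else 0

lemma sum_ind : ∀ a b c d : ZMod 3, a * d - b * c ≠ 0 →
    (if a * c + b * d = 0 then 1 else 0) + (if -c * (a - c) + -d * (b - d) = 0 then 1 else 0) +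
      (if (c - a) * -a + (d - b) * -b = 0 then 1 else 0) = (1 : ZMod 3) := by
  decide

lemma sum_indF (x : GF) : indF x + indF (cF * x) + indF (cF⁻¹ * x) = 1 := by
  rw [← sum_ind _ _ _ _ (GF_det x)]
  have h1 : ∀ i j, (cF * x) i j = (!![-x 1 0, -x 1 1; x 0 0 - x 1 0, x 0 1 - x 1 1] : RF) i j := by
    intro i j
    rw [GF_mul]
    fin_cases i <;> fin_cases j <;> simp [cF, sub_eq_add_neg]
  have h2 : ∀ i j, (cF⁻¹ * x) i j = (!![x 1 0 - x 0 0, x 1 1 - x 0 1; -x 0 0, -x 0 1] : RF) i j := by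
    intro i j
    rw [GF_mul]
    change (!![-1, 1; -1, 0] : RF) i 0 * x 0 j + (!![-1, 1; -1, 0] : RF) i 1 * x 1 j = _
    fin_cases i <;> fin_cases j <;> simp [sub_eq_add_neg, add_comm]
  simp only [indF, mem_HF, h1, h2]
  simp

lemma indF_mul {h : GF} (hh : h ∈ HF) (x : GF) : indF (h * x) = indF x := by
  by_cases hx : x ∈ HF
  · rw [indF, indF, if_pos hx, if_pos (HF.mul_mem hh hx)]
  · rw [indF, indF, if_neg hx, if_neg fun h' => hx ((HF.mul_mem_cancel_left hh).1 h')]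

lemma exists_thL {χ : GF →* ZMod 3} {k : ℕ} {f : Fn GZ (k + 1)} (hf : f ∈ DG χ (k + 1))
    (h0 : thL (k + 1) f = 0) : ∃ g ∈ DG χ (k + 1), f = thL (k + 1) (thL (k + 1) g) := by
  obtain ⟨h1, h2⟩ := mem_DG.1 hf
  refine ⟨fun x => indF (red (x 0)) * f x, mem_DG.2 ⟨?_, fun h hh => ?_⟩, ?_⟩
  · obtain ⟨i, hi⟩ := h1
    refine ⟨i, fun x y hxy => ?_⟩
    simp only [Cg_red (hxy 0), hi x y hxy]
  · funext x
    have := congrFun (h2 h hh) x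
    simp only [ltr_apply, Pi.smul_apply, smul_eq_mul] at this ⊢
    rw [map_mul, indF_mul hh, this]
    ring
  · have e1 : ∀ x : Fin (k + 1) → GZ, (f fun l => cG⁻¹ * x l) = f fun l => cG * x l := fun x =>
      sub_eq_zero.1 (congrFun h0 x)
    have e2 : ∀ x : Fin (k + 1) → GZ, (f fun l => cG * x l) = f x := fun x => by
      have := e1 fun l => cG * x l
      simp only [← mul_assoc, cG_sq, inv_mul_cancel, one_mul] at this
      rw [← e1]
      exact this.symm
    funext x
    rw [thL_thL]
    simp only [e1, e2, map_mul, map_inv, red_cG]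
    rw [← add_mul, ← add_mul, sum_indF, one_mul]

/-- The two complexes of equivariant functions. -/
lemma twist_DG : Twist (M := fun n => Fn GZ (n + 1)) (fun n => hd (n + 1)) (fun n => thL (n + 1))
    (fun n => DG 1 (n + 1)) fun n => DG detF (n + 1) where
  comm _ _ := hd_thL _
  sq _ _ := hd_hd _
  cube _ _ := thL_cube _
  dP _ _ h := DG_hd h
  dN _ _ h := DG_hd h
  tP _ _ h := by simpa using thL_mem h
  tN _ _ h := by simpa [detF_mul_self] using thL_mem h
  exP _ _ h h0 := exists_thL h h0
  exN _ _ h h0 := exists_thL h h0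

/-! ### The determinant class -/

lemma exists_quot (x : GZ) : ∃ q : ℤ_[3], (x : R).det ^ 2 = 1 + 3 * q := by
  have h := detF_cases (red x)
  have e : detF (red x) = PadicInt.toZMod (x : R).det := by
    rw [detF_apply, Matrix.det_fin_two, map_sub, map_mul, map_mul]
    rfl
  have h0 : PadicInt.toZMod ((x : R).det ^ 2 - 1) = (0 : ZMod 3) := by
    rw [map_sub, map_pow, map_one, ← e]
    rcases h with h | h <;> rw [h] <;> decide
  obtain ⟨q, hq⟩ := toZMod_eq_zero h0
  exact ⟨q, by linear_combination hq⟩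

/-- The homomorphism to the additive group of the field given by the determinant. -/
noncomputable def ell (x : GZ) : ZMod 3 := PadicInt.toZMod (exists_quot x).choose

lemma ell_eq {x : GZ} {q : ℤ_[3]} (h : (x : R).det ^ 2 = 1 + 3 * q) :
    ell x = PadicInt.toZMod q := by
  have e := add_left_cancel ((exists_quot x).choose_spec.symm.trans h)
  exact congrArg _ (mul_left_cancel₀ (by norm_num : (3 : ℤ_[3]) ≠ 0) e)

lemma ell_mul (x y : GZ) : ell (x * y) = ell x + ell y := by
  obtain ⟨q, hq⟩ := exists_quot x
  obtain ⟨r, hr⟩ := exists_quot y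
  rw [ell_eq hq, ell_eq hr, ell_eq (q := q + r + 3 * (q * r)), map_add, map_add, map_mul]
  · rw [show PadicInt.toZMod (3 : ℤ_[3]) = (0 : ZMod 3) by rw [map_ofNat]; rfl, zero_mul, add_zero]
  · rw [Units.val_mul, Matrix.det_mul, mul_pow, hq, hr]
    ring

lemma ell_Cg {x y : GZ} (h : Cg 2 x y) : ell x = ell y := by
  obtain ⟨w, hw⟩ := h
  obtain ⟨q, hq⟩ := exists_quot x
  have : ∃ t : ℤ_[3], (y : R).det = (x : R).det + 9 * t := by
    refine ⟨x 0 0 * w 1 1 + w 0 0 * x 1 1 - x 0 1 * w 1 0 - w 0 1 * x 1 0 +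
      9 * (w 0 0 * w 1 1 - w 0 1 * w 1 0), ?_⟩
    have e : ∀ i j, (y : R) i j = (x : R) i j + 9 * w i j := fun i j => by
      rw [hw, Matrix.add_apply, Matrix.smul_apply]
      simp
      try norm_num
    rw [Matrix.det_fin_two, Matrix.det_fin_two, e, e, e, e]
    ring
  obtain ⟨t, ht⟩ := this
  rw [ell_eq hq, ell_eq (x := y) (q := q + 3 * (2 * (x : R).det * t + 9 * t ^ 2)), map_add,
    map_mul PadicInt.toZMod 3]
  · rw [show PadicInt.toZMod (3 : ℤ_[3]) = (0 : ZMod 3) by rw [map_ofNat]; rfl, zero_mul, add_zero]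
  · rw [ht]
    linear_combination hq

/-- A central element of infinite order. -/
noncomputable def zG : GZ :=
  Units.map (algebraMap ℤ_[3] R).toMonoidHom
    (isUnit_of_toZMod (a := (4 : ℤ_[3]))
      (by rw [map_ofNat PadicInt.toZMod 4]; decide)).unit

lemma zG_val : (zG : R) = algebraMap ℤ_[3] R 4 := rfl

lemma zG_comm (x : GZ) : zG * x = x * zG :=
  Units.ext (Algebra.commutes _ _)

lemma ell_zG : ell zG = 1 := by
  rw [ell_eq (q := 85), map_ofNat]
  · rfl
  · rw [zG_val, Matrix.det_fin_two]
    simp [Matrix.algebraMap_matrix_apply]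
    norm_num

lemma red_zG : red zG = 1 := by
  apply Units.ext
  rw [red_val, zG_val]
  funext i j
  rw [redM_apply, Matrix.algebraMap_matrix_apply]
  have : PadicInt.toZMod (4 : ℤ_[3]) = (1 : ZMod 3) := by rw [map_ofNat]; rfl
  fin_cases i <;> fin_cases j <;> simp [this]

/-- An involution of determinant `-1`. -/
noncomputable def sG : GZ := ⟨!![0, 1; 1, 0], !![0, 1; 1, 0],
  by simp [Matrix.one_fin_two], by simp [Matrix.one_fin_two]⟩

lemma sG_sq : sG * sG = 1 := by
  apply Units.ext
  rw [Units.val_mul]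
  simp [sG, Matrix.one_fin_two]

lemma sG_cG : cG * sG = sG * cG⁻¹ := by
  apply Units.ext
  rw [Units.val_mul, Units.val_mul]
  change !![0, -1; 1, -1] * !![0, 1; 1, 0] = (!![0, 1; 1, 0] * !![-1, 1; -1, 0] : R)
  simp

lemma sG_cG_inv : cG⁻¹ * sG = sG * cG := by
  rw [inv_mul_eq_iff_eq_mul, ← mul_assoc, sG_cG, inv_mul_cancel_right]

lemma red_sG : red sG ∈ HF ∧ detF (red sG) = -1 := by
  rw [mem_HF, detF_apply, red_val]
  simp [redM_apply, sG]

/-! ### Closed functions of one and two variables -/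

lemma const_of_hd {X : Type} {f : Fn X 1} (h : hd 1 f = 0) (x y : Fin 1 → X) : f x = f y := by
  have e := eq_hd_fix h (x 0)
  rw [congrFun e x, congrFun e y, hd_zero, hd_zero]

lemma hd_const {X : Type} (a : ZMod 3) : hd 1 (fun _ => a : Fn X 1) = 0 := by
  funext x
  simp [hd_apply, Fin.sum_univ_two]

/-- The determinant class. -/
noncomputable def omG : Fn GZ 2 := hd 1 fun x => ell (x 0)

lemma ltr_ell (g : GZ) : ltr g 1 (fun x => ell (x 0)) = (fun x => ell (x 0)) + fun _ => ell g := by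
  funext x
  rw [ltr_apply, Pi.add_apply, ell_mul, add_comm]

lemma ltr_omG (g : GZ) : ltr g 2 omG = omG := by
  rw [omG, ← hd_ltr, ltr_ell, map_add, hd_const, add_zero]

lemma eq_zero_of_omG {g : Fn GZ 1} (hg : ltr zG 1 g = g) {a : ZMod 3} (h : a • omG = hd 1 g) :
    a = 0 := by
  have := const_of_hd (f := (a • fun x => ell (x 0)) - g)
    (by rw [map_sub, map_smul, ← omG, h, sub_self]) (fun _ => 1) fun _ => zG * 1
  have e := congrFun hg fun _ => 1
  rw [ltr_apply] at e
  simp only [Pi.sub_apply, Pi.smul_apply, smul_eq_mul, e, ell_mul, ell_zG] at this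
  linear_combination -this

lemma omG_mem : omG ∈ DG 1 2 := by
  refine mem_DG.2 ⟨LCG_hd ⟨1, fun x y h => ell_Cg (h 0)⟩, fun h _ => ?_⟩
  rw [ltr_omG, MonoidHom.one_apply, one_smul]

lemma hd_omG : hd 2 omG = 0 := hd_hd _

lemma ltr_zG_of_mem {χ : GF →* ZMod 3} {k : ℕ} {f : Fn GZ k} (hf : f ∈ DG χ k) :
    ltr zG k f = f := DG_ker hf red_zG

lemma omG_spans {f : Fn GZ 2} (hf : f ∈ DG 1 2) (h : hd 2 f = 0) :
    ∃ c : ZMod 3, ∃ m ∈ DG 1 1, f - c • omG = hd 1 m := by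
  obtain ⟨ω, -, -, h3, -⟩ := DG_rank_one (eqvR_rank_one 0 (by omega))
  obtain ⟨c, m, hm, e⟩ := h3 omG omG_mem hd_omG
  obtain ⟨c', m', hm', e'⟩ := h3 f hf h
  have hc : c ≠ 0 := by
    rintro rfl
    rw [zero_smul, sub_zero] at e
    exact one_ne_zero (eq_zero_of_omG (a := 1) (ltr_zG_of_mem hm) (by rw [one_smul, e]))
  refine ⟨c' * c⁻¹, m' - (c' * c⁻¹) • m, sub_mem hm' (Submodule.smul_mem _ _ hm), ?_⟩
  rw [map_sub, map_smul, ← e, ← e', smul_sub, smul_smul, mul_assoc, inv_mul_cancel₀ hc, mul_one]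
  abel

/-! ### Cohomology of the equivariant functions -/

lemma acyclic_det (n : ℕ) : ∀ x ∈ Zc (M := fun n => Fn GZ (n + 1)) (fun n => hd (n + 1))
    (fun n => DG detF (n + 1)) n, x ∈ Bc (M := fun n => Fn GZ (n + 1)) (fun n => hd (n + 1))
    (fun n => DG detF (n + 1)) n := by
  intro x hx
  cases n with
  | zero =>
    refine mem_Bc_zero.2 (funext fun y => ?_)
    have h1 := congrFun ((mem_DG.1 hx.1).2 sG red_sG.1) y
    rw [ltr_apply, const_of_hd hx.2 _ y, red_sG.2, Pi.smul_apply, smul_eq_mul] at h1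
    have h : (3 : ZMod 3) = 0 := rfl
    rw [Pi.zero_apply]
    linear_combination x y * h - h1
  | succ n =>
    obtain ⟨g, hg, e⟩ := DG_acyclic (eqvR_det n) hx.1 hx.2
    exact mem_Bc_succ.2 ⟨g, hg, e.symm⟩

lemma acyclic_one (n : ℕ) (hn : n = 2 ∨ 5 ≤ n) : ∀ x ∈ Zc (M := fun n => Fn GZ (n + 1))
    (fun n => hd (n + 1)) (fun n => DG 1 (n + 1)) n, x ∈ Bc (M := fun n => Fn GZ (n + 1))
    (fun n => hd (n + 1)) (fun n => DG 1 (n + 1)) n := by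
  intro x hx
  obtain ⟨n, rfl⟩ : ∃ m, n = m + 1 := ⟨n - 1, by omega⟩
  obtain ⟨g, hg, e⟩ := DG_acyclic (eqvR_triv n (by omega)) hx.1 hx.2
  exact mem_Bc_succ.2 ⟨g, hg, e.symm⟩

lemma hasDim_one (n : ℕ) : HasDim
    (Zc (M := fun n => Fn GZ (n + 1)) (fun n => hd (n + 1)) (fun n => DG 1 (n + 1)) n)
    (Bc (M := fun n => Fn GZ (n + 1)) (fun n => hd (n + 1)) (fun n => DG 1 (n + 1)) n)
    (dimBase n) := by
  by_cases hn : n = 2 ∨ 5 ≤ n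
  · rw [dimBase, if_neg (by omega)]
    exact HasDim.zero (acyclic_one n hn)
  rw [dimBase, if_pos (by omega)]
  cases n with
  | zero =>
    refine HasDim.one (ω := fun _ => 1) ⟨mem_DG.2 ⟨⟨0, fun _ _ _ => rfl⟩, fun h hh => ?_⟩,
      hd_const 1⟩ (fun f hf => ⟨f fun _ => 1, mem_Bc_zero.2 (funext fun x => ?_)⟩) fun c hc => ?_
    · rw [MonoidHom.one_apply, one_smul]
      rfl
    · simp [const_of_hd hf.2 x fun _ => 1]
    · simpa using congrFun (mem_Bc_zero.1 hc) fun _ => 1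
  | succ n =>
    obtain ⟨ω, h1, h2, h3, h4⟩ := DG_rank_one (eqvR_rank_one n (by omega))
    refine HasDim.one (ω := ω) ⟨h1, h2⟩ (fun f hf => ?_) fun c hc => ?_
    · obtain ⟨c, m, hm, e⟩ := h3 f hf.1 hf.2
      exact ⟨c, mem_Bc_succ.2 ⟨m, hm, e.symm⟩⟩
    · obtain ⟨m, hm, e⟩ := mem_Bc_succ.1 hc
      exact h4 c m hm e.symm

/-! ### Functions invariant under a central element of infinite order -/

lemma exists_int_primitive (a : ℤ → ZMod 3) : ∃ S : ℤ → ZMod 3, ∀ n, S (n + 1) - S n = a n := by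
  refine ⟨fun n => Int.rec (motive := fun _ => ZMod 3) (fun n => ∑ i ∈ Finset.range n, a i)
    (fun n => -∑ i ∈ Finset.range (n + 1), a (Int.negSucc i)) n, fun n => ?_⟩
  rcases n with n | n
  · change (∑ i ∈ Finset.range (n + 1), a i) - ∑ i ∈ Finset.range n, a i = a n
    rw [Finset.sum_range_succ, add_sub_cancel_left]
  · cases n with
    | zero =>
      change (∑ i ∈ Finset.range 0, a i) -
        (-∑ i ∈ Finset.range (0 + 1), a (Int.negSucc i)) = _
      simp
    | succ n =>
      change (-∑ i ∈ Finset.range (n + 1), a (Int.negSucc i)) -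
        (-∑ i ∈ Finset.range (n + 1 + 1), a (Int.negSucc i)) = _
      rw [Finset.sum_range_succ _ (n + 1)]
      abel

lemma exists_perm_primitive {X : Type} (σ : Equiv.Perm X)
    (hσ : ∀ (n : ℤ) x, (σ ^ n) x = x → n = 0) (h : X → ZMod 3) :
    ∃ h' : X → ZMod 3, ∀ x, h' (σ x) - h' x = h x := by
  let s := Equiv.Perm.SameCycle.setoid σ
  let r : X → X := fun x => (Quotient.mk s x).out
  have hr : ∀ x, ∃ n : ℤ, (σ ^ n) (r x) = x := fun x => Quotient.mk_out (s := s) x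
  choose e he using hr
  choose S hS using exists_int_primitive
  have rs : ∀ x, r (σ x) = r x := fun x =>
    congrArg Quotient.out (Quotient.sound (s := s)
      (show Equiv.Perm.SameCycle σ (σ x) x from ⟨-1, by simp⟩))
  have es : ∀ x, e (σ x) = e x + 1 := fun x => by
    have h1 := he (σ x)
    rw [rs] at h1
    refine sub_eq_zero.1 (hσ _ (r x) ?_)
    rw [show e (σ x) - (e x + 1) = -(1 + e x) + e (σ x) by ring, zpow_add, Equiv.Perm.mul_apply, h1,
      zpow_neg, Equiv.Perm.inv_eq_iff_eq, zpow_add, Equiv.Perm.mul_apply, he, zpow_one]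
  refine ⟨fun x => S (fun n => h ((σ ^ n) (r x))) (e x), fun x => ?_⟩
  beta_reduce
  rw [rs, es, hS, he]

lemma zG_zpow {n : ℤ} (h : zG ^ n = 1) : n = 0 := by
  have key : ∀ m : ℕ, zG ^ m = 1 → m = 0 := fun m hm => by
    have h0 : ((zG ^ m : GZ) : R) = (1 : GZ) := by rw [hm]
    have h1 := congrFun (congrFun h0 0) 0
    rw [Units.val_pow_eq_pow_val, zG_val, ← map_pow, Matrix.algebraMap_matrix_apply, if_pos rfl,
      Units.val_one, Matrix.one_apply_eq] at h1
    have h2 : (4 : ℕ) ^ m = 1 := by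
      apply Nat.cast_injective (R := ℤ_[3])
      rw [Nat.cast_pow, Nat.cast_one, ← h1, Nat.cast_ofNat]
      rfl
    simpa using h2
  rcases Int.eq_nat_or_neg n with ⟨m, rfl | rfl⟩
  · rw [zpow_natCast] at h
    rw [key m h, Nat.cast_zero]
  · rw [zpow_neg, inv_eq_one, zpow_natCast] at h
    rw [key m h, Nat.cast_zero, neg_zero]

lemma exists_ltr_sub {k : ℕ} (h : Fn GZ (k + 1)) : ∃ h', ltr zG (k + 1) h' - h' = h := by
  let σ : Equiv.Perm (Fin (k + 1) → GZ) := Equiv.arrowCongr (Equiv.refl _) (Equiv.mulLeft zG)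
  have hσ : ∀ n : ℤ, ∀ x, (σ ^ n) x = fun l => zG ^ n * x l := by
    have key : ∀ n : ℕ, ∀ x, (σ ^ n) x = fun l => zG ^ n * x l := by
      intro n
      induction n with
      | zero => intro x; simp
      | succ n ih =>
        intro x
        rw [pow_succ', Equiv.Perm.mul_apply, ih]
        funext l
        change zG * (zG ^ n * x l) = _
        rw [pow_succ', mul_assoc]
    intro n x
    rcases Int.eq_nat_or_neg n with ⟨m, rfl | rfl⟩
    · simp only [zpow_natCast, key]
    · rw [zpow_neg, Equiv.Perm.inv_eq_iff_eq, zpow_natCast, key]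
      simp
  obtain ⟨h', e⟩ := exists_perm_primitive σ (fun n x hx => zG_zpow (by
    rw [hσ] at hx
    simpa using congrFun hx 0)) h
  exact ⟨h', funext fun x => e x⟩

lemma exists_primitive_zG {n : ℕ} {f : Fn GZ (n + 3)} (hf : ltr zG _ f = f) (h : hd _ f = 0) :
    ∃ g, ltr zG _ g = g ∧ f = hd (n + 2) g := by
  have e := eq_hd_fix h 1
  obtain ⟨g, hg⟩ : ∃ g, f = hd (n + 2) g := ⟨_, e⟩
  have e1 : hd (n + 2) (ltr zG _ g - g) = 0 := by
    rw [map_sub, hd_ltr, ← hg, hf, sub_self]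
  obtain ⟨u, hu⟩ : ∃ u, ltr zG _ g - g = hd (n + 1) u := ⟨_, eq_hd_fix e1 1⟩
  obtain ⟨v, rfl⟩ := exists_ltr_sub u
  refine ⟨g - hd _ v, ?_, by rw [map_sub, hd_hd, sub_zero, hg]⟩
  rw [map_sub, hd_ltr] at hu
  rw [map_sub]
  linear_combination (exp := 1) hu

lemma exists_primitive_zG_one {f : Fn GZ 2} (hf : ltr zG _ f = f) (h : hd _ f = 0) :
    ∃ (a : ZMod 3) (g : _), ltr zG _ g = g ∧ f = a • omG + hd 1 g := by
  obtain ⟨g, hg⟩ : ∃ g, f = hd 1 g := ⟨_, eq_hd_fix h 1⟩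
  have e1 : hd 1 (ltr zG _ g - g) = 0 := by
    rw [map_sub, hd_ltr, ← hg, hf, sub_self]
  set a := (ltr zG _ g - g) fun _ => 1 with ha
  have e2 : ltr zG _ g = g + fun _ => a := by
    funext x
    rw [Pi.add_apply, ha, const_of_hd e1 _ x, Pi.sub_apply, add_sub_cancel]
  refine ⟨a, g - a • fun x => ell (x 0), ?_, ?_⟩
  · rw [map_sub, map_smul, ltr_ell, e2, ell_zG]
    funext x
    simp
  · rw [map_sub, map_smul, ← omG, hg, add_sub_cancel]

/-- Functions invariant under the central element and transforming by a sign. -/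
noncomputable def LS (ε : ZMod 3) (k : ℕ) : Submodule (ZMod 3) (Fn GZ k) :=
  LinearMap.ker (ltr zG k - LinearMap.id) ⊓ LinearMap.ker (ltr sG k - ε • LinearMap.id)

lemma mem_LS {ε : ZMod 3} {k : ℕ} {f : Fn GZ k} :
    f ∈ LS ε k ↔ ltr zG k f = f ∧ ltr sG k f = ε • f := by
  simp [LS, sub_eq_zero]

lemma ltr_mul (g h : GZ) {k : ℕ} (f : Fn GZ k) : ltr g k (ltr h k f) = ltr (h * g) k f := by
  funext x
  simp only [ltr_apply, mul_assoc]

lemma ltr_sG_sq {k : ℕ} (f : Fn GZ k) : ltr sG k (ltr sG k f) = f := by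
  rw [ltr_mul, sG_sq]
  funext x
  simp

lemma average_mem {ε : ZMod 3} (hε : ε * ε = 1) {k : ℕ} {g : Fn GZ k} (hg : ltr zG _ g = g) :
    -(g + ε • ltr sG _ g) ∈ LS ε k := by
  refine mem_LS.2 ⟨?_, ?_⟩
  · rw [map_neg, map_add, map_smul, hg, ltr_mul, ← zG_comm, ← ltr_mul, hg]
  · rw [map_neg, map_add, map_smul, ltr_sG_sq, smul_neg, smul_add, smul_smul, hε, one_smul,
      add_comm]

lemma neg_add_self (a : ZMod 3) : -(a + a) = a := by
  revert a; decide

lemma exists_primitive_LS {ε : ZMod 3} (hε : ε * ε = 1) {n : ℕ} {f : Fn GZ (n + 3)}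
    (hf : f ∈ LS ε _) (h : hd _ f = 0) : ∃ g ∈ LS ε _, f = hd (n + 2) g := by
  obtain ⟨h1, h2⟩ := mem_LS.1 hf
  obtain ⟨g, hg, e⟩ := exists_primitive_zG h1 h
  refine ⟨_, average_mem hε hg, ?_⟩
  rw [map_neg, map_add, map_smul, hd_ltr, ← e, h2, smul_smul, hε, one_smul]
  exact (funext fun x => neg_add_self _).symm

lemma exists_primitive_LS_one {f : Fn GZ 2} (hf : f ∈ LS 1 _) (h : hd _ f = 0) :
    ∃ a : ZMod 3, ∃ g ∈ LS 1 _, f = a • omG + hd 1 g := by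
  obtain ⟨h1, h2⟩ := mem_LS.1 hf
  obtain ⟨a, g, hg, e⟩ := exists_primitive_zG_one h1 h
  refine ⟨a, _, average_mem (one_mul 1) hg, ?_⟩
  have e1 : hd 1 g = f - a • omG := by rw [e, add_sub_cancel_left]
  rw [map_neg, map_add, map_smul, hd_ltr, e1, map_sub, map_smul, ltr_omG, h2, one_smul, one_smul]
  funext x
  have := neg_add_self ((f - a • omG) x)
  simp only [Pi.sub_apply, Pi.add_apply, Pi.neg_apply] at this ⊢
  rw [this, add_sub_cancel]

lemma exists_primitive_LS_neg_one {f : Fn GZ 2} (hf : f ∈ LS (-1) _) (h : hd _ f = 0) :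
    ∃ g ∈ LS (-1) _, f = hd 1 g := by
  obtain ⟨h1, h2⟩ := mem_LS.1 hf
  obtain ⟨a, g, hg, e⟩ := exists_primitive_zG_one h1 h
  refine ⟨_, average_mem (by decide) hg, ?_⟩
  have e1 : hd 1 g = f - a • omG := by rw [e, add_sub_cancel_left]
  rw [map_neg, map_add, map_smul, hd_ltr, e1, map_sub, map_smul, ltr_omG, h2, neg_one_smul,
    neg_one_smul]
  funext x
  have := neg_add_self (f x)
  simp only [Pi.sub_apply, Pi.add_apply, Pi.neg_apply]
  linear_combination -this

lemma thL_LS {ε : ZMod 3} {k : ℕ} {f : Fn GZ k} (hf : f ∈ LS ε k) : thL k f ∈ LS (-ε) k := by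
  obtain ⟨h1, h2⟩ := mem_LS.1 hf
  refine mem_LS.2 ⟨?_, ?_⟩
  · rw [thL, LinearMap.sub_apply, map_sub, ltr_mul, ltr_mul, ← zG_comm, ← zG_comm, ← ltr_mul,
      ← ltr_mul, h1]
  · rw [thL, LinearMap.sub_apply, map_sub, ltr_mul, ltr_mul, sG_cG, sG_cG_inv, ← ltr_mul, ← ltr_mul,
      h2, map_smul, map_smul, ← smul_sub, neg_smul, ← smul_neg, neg_sub]

lemma DG_le_LS {χ : GF →* ZMod 3} {ε : ZMod 3} (h : χ (red sG) = ε) (k : ℕ) :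
    DG χ k ≤ LS ε k := fun f hf =>
  mem_LS.2 ⟨ltr_zG_of_mem hf, by rw [(mem_DG.1 hf).2 sG red_sG.1, h]⟩

lemma ambient_LS : Ambient (M := fun n => Fn GZ (n + 1)) (fun n => hd (n + 1))
    (fun n => thL (n + 1)) (fun n => DG 1 (n + 1)) (fun n => DG detF (n + 1))
    (fun n => LS 1 (n + 1)) (fun n => LS (-1) (n + 1)) omG where
  leP _ := DG_le_LS rfl _
  leN _ := DG_le_LS red_sG.2 _
  tP _ _ h := thL_LS h
  tN _ _ h := by simpa using thL_LS h
  acP n hn x hx h := by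
    obtain ⟨n, rfl⟩ : ∃ m, n = m + 1 := ⟨n - 1, by omega⟩
    exact exists_primitive_LS (by decide) hx h
  acN n hn x hx h := by
    cases n with
    | zero => exact exists_primitive_LS_neg_one hx h
    | succ n => exact exists_primitive_LS (by decide) hx h
  lift g hg h := by
    obtain ⟨c, m, hm, e⟩ := omG_spans h (hd_hd _)
    have hc : c = 0 := eq_zero_of_omG (g := g - m)
      (by rw [map_sub, (mem_LS.1 hg).1, ltr_zG_of_mem hm])
      (by rw [map_sub, ← e, sub_sub_cancel])
    exact ⟨m, hm, by rw [← e, hc, zero_smul, sub_zero]⟩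
  one x hx h := exists_primitive_LS_one hx h
  omega := by rw [thL, LinearMap.sub_apply, ltr_omG, ltr_omG, sub_self]
  const x h := by
    funext y
    rw [thL_apply, const_of_hd h (fun l => cG⁻¹ * y l) fun l => cG * y l, sub_self, Pi.zero_apply]

lemma hasDim_Ec (n : ℕ) : HasDim
    (Zc (M := fun n => Fn GZ (n + 1)) (fun n => hd (n + 1))
      (Ec (M := fun n => Fn GZ (n + 1)) (fun n => thL (n + 1)) fun n => DG 1 (n + 1)) n)
    (Bc (M := fun n => Fn GZ (n + 1)) (fun n => hd (n + 1))
      (Ec (M := fun n => Fn GZ (n + 1)) (fun n => thL (n + 1)) fun n => DG 1 (n + 1)) n)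
    (dimPos n) :=
  twist_DG.hasDim acyclic_det (twist_DG.surj acyclic_det ambient_LS acyclic_one) hasDim_one n

/-! ### Comparison with the direct limit -/

lemma eq_of_thL {k : ℕ} {f : Fn GZ k} (h0 : thL k f = 0) : ltr cG k f = f := by
  have e1 : ∀ x : Fin k → GZ, (f fun l => cG⁻¹ * x l) = f fun l => cG * x l := fun x =>
    sub_eq_zero.1 (congrFun h0 x)
  funext x
  have := e1 fun l => cG * x l
  simp only [← mul_assoc, cG_sq, inv_mul_cancel, one_mul] at this
  rw [ltr_apply, ← e1]
  exact this.symm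

lemma mem_Ec_DG {n : ℕ} {f : Fn GZ (n + 1)} :
    f ∈ Ec (M := fun n => Fn GZ (n + 1)) (fun n => thL (n + 1)) (fun n => DG 1 (n + 1)) n ↔
      f ∈ LCG (n + 1) ∧ ∀ g, ltr g (n + 1) f = f := by
  constructor
  · rintro ⟨h1, h2⟩
    obtain ⟨h3, h4⟩ := mem_DG.1 h1
    have h5 : ltr cG _ f = f := eq_of_thL h2
    have h6 : ltr cG⁻¹ _ f = f := by
      nth_rewrite 1 [← h5]
      rw [ltr_mul, mul_inv_cancel]
      funext x
      simp
    have key : ∀ g, indF (red g) ≠ 0 → ltr g _ f = f := fun g hg => by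
      rw [h4 g (by_contra fun h => hg (if_neg h)), MonoidHom.one_apply, one_smul]
    refine ⟨h3, fun g => ?_⟩
    by_cases k1 : indF (red g) = 0
    · by_cases k2 : indF (red (cG * g)) = 0
      · have k3 : indF (red (cG⁻¹ * g)) ≠ 0 := fun k3 => by
          have := sum_indF (red g)
          rw [map_mul, red_cG] at k2
          rw [map_mul, map_inv, red_cG] at k3
          rw [k1, k2, k3] at this
          exact absurd this (by decide)
        have := key _ k3
        rwa [← ltr_mul, h6] at this
      · have := key _ k2
        rwa [← ltr_mul, h5] at this
    · exact key g k1
  · rintro ⟨h1, h2⟩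
    refine ⟨mem_DG.2 ⟨h1, fun h _ => by rw [h2, MonoidHom.one_apply, one_smul]⟩, ?_⟩
    change ltr cG⁻¹ _ f - ltr cG _ f = 0
    rw [h2, h2, sub_self]

section Limit

variable {Γ : ℕ → Type} [∀ i, Group (Γ i)] (π : ∀ i, Γ (i + 1) →* Γ i) (q : ∀ i, GZ →* Γ i)

/-- Inflation to homogeneous cochains of the limit group. -/
noncomputable def infl (i n : ℕ) : Fn (Γ i) n →ₗ[ZMod 3] Fn GZ (n + 1) :=
  pull (fun x l => q i (x l)) ∘ₗ homog n

lemma infl_apply {i n : ℕ} (f : Fn (Γ i) n) (x : Fin (n + 1) → GZ) :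
    infl q i n f x = homog n f fun l => q i (x l) := rfl

lemma hd_infl {i n : ℕ} (f : Fn (Γ i) n) :
    hd (n + 1) (infl q i n f) = infl q i (n + 1) (dCoh 3 (Γ i) n f) := by
  rw [dCoh_eq_dOp, infl, infl, LinearMap.comp_apply, LinearMap.comp_apply, hd_pull, hd_homog]

variable {q} (hk : ∀ i x y, q i x = q i y ↔ Cg (i + 1) x y) (hs : ∀ i, Function.Surjective (q i))

include hs in
lemma infl_injective {i n : ℕ} {f g : Fn (Γ i) n} (h : infl q i n f = infl q i n g) : f = g := by
  refine homog_injective (funext fun x => ?_)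
  choose s hs using hs i
  have := congrFun h fun l => s (x l)
  simpa only [infl_apply, hs] using this

include hk in
lemma infl_mem {i n : ℕ} (f : Fn (Γ i) n) : infl q i n f ∈
    Ec (M := fun n => Fn GZ (n + 1)) (fun n => thL (n + 1)) (fun n => DG 1 (n + 1)) n := by
  refine mem_Ec_DG.2 ⟨⟨i, fun x y h => ?_⟩, fun g => funext fun x => ?_⟩
  · simp only [infl_apply, fun l => (hk i _ _).2 (h l)]
  · rw [ltr_apply, infl_apply, infl_apply]
    simp only [map_mul]
    exact homog_mul f _ _

include hk hs in
lemma exists_infl {n : ℕ} {z : Fn GZ (n + 1)} (hz : z ∈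
    Ec (M := fun n => Fn GZ (n + 1)) (fun n => thL (n + 1)) (fun n => DG 1 (n + 1)) n) :
    ∃ i, ∀ j, i ≤ j → ∃ u, infl q j n u = z := by
  obtain ⟨⟨i, hi⟩, h2⟩ := mem_Ec_DG.1 hz
  refine ⟨i, fun j hj => ?_⟩
  choose s hs using hs j
  have hv : ∀ x y : Fin (n + 1) → GZ, (∀ l, q j (x l) = q j (y l)) → z x = z y := fun x y h =>
    hi x y fun l => Cg_mono (by omega) ((hk j _ _).1 (h l))
  let v : Fn (Γ j) (n + 1) := fun x => z fun l => s (x l)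
  have hinv : ∀ g x, v (fun l => g * x l) = v x := fun g x => by
    refine Eq.trans (hv _ _ fun l => ?_) (congrFun (h2 (s g)) fun l => s (x l))
    rw [map_mul, hs, hs, hs]
  refine ⟨inhom n v, funext fun x => ?_⟩
  rw [infl_apply, homog_inhom hinv]
  exact hv _ _ fun l => hs _

variable {π} (hp : ∀ i x, π i (q (i + 1) x) = q i x)

include hp in
lemma Htrans_mk {n i j : ℕ} (h : i ≤ j) (f : cocycles 3 (Γ i) n) : ∃ f' : cocycles 3 (Γ j) n,
    Htrans π n i j h (Submodule.Quotient.mk f) = Submodule.Quotient.mk f' ∧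
      infl q j n (f' : Fn (Γ j) n) = infl q i n (f : Fn (Γ i) n) := by
  induction j, h using Nat.le_induction with
  | base => exact ⟨f, by rw [Htrans, Nat.leRecOn_self]; rfl, rfl⟩
  | succ j h ih =>
    obtain ⟨f', e1, e2⟩ := ih
    refine ⟨⟨_, cochainComap_mem_cocycles (π j) n f'.2⟩, ?_, ?_⟩
    · rw [Htrans, Nat.leRecOn_succ h]
      change Hmap (π j) n (Htrans π n i j h (Submodule.Quotient.mk f)) = _
      rw [e1]
      rfl
    · rw [← e2]
      funext x
      rw [infl_apply, infl_apply, homog_apply, homog_apply]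
      change (f' : Fn (Γ j) n) (fun l => π j ((q (j + 1) (x l.castSucc))⁻¹ * q (j + 1) (x l.succ))) = _
      simp only [map_mul, map_inv, hp]

/-- The invariant homogeneous cocycles. -/
noncomputable abbrev ZE (n : ℕ) : Submodule (ZMod 3) (Fn GZ (n + 1)) :=
  Zc (M := fun n => Fn GZ (n + 1)) (fun n => hd (n + 1))
      (Ec (M := fun n => Fn GZ (n + 1)) (fun n => thL (n + 1)) fun n => DG 1 (n + 1)) n

/-- The invariant homogeneous coboundaries. -/
noncomputable abbrev BE (n : ℕ) : Submodule (ZMod 3) (Fn GZ (n + 1)) :=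
  Bc (M := fun n => Fn GZ (n + 1)) (fun n => hd (n + 1))
      (Ec (M := fun n => Fn GZ (n + 1)) (fun n => thL (n + 1)) fun n => DG 1 (n + 1)) n

include hk in
lemma infl_mem_ZE {i n : ℕ} {f : Fn (Γ i) n} (hf : f ∈ cocycles 3 (Γ i) n) :
    infl q i n f ∈ ZE n := by
  refine ⟨infl_mem hk f, LinearMap.mem_ker.2 ?_⟩
  rw [hd_infl, show dCoh 3 (Γ i) n f = 0 from hf, map_zero]

include hk in
lemma infl_mem_BE {i n : ℕ} {f : Fn (Γ i) n} (hf : f ∈ coboundaries 3 (Γ i) n) :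
    infl q i n f ∈ BE n := by
  cases n with
  | zero =>
    have h : f = 0 := hf
    rw [h, map_zero]
    exact zero_mem _
  | succ n =>
    obtain ⟨u, rfl⟩ := hf
    rw [← hd_infl]
    exact mem_Bc_succ.2 ⟨_, infl_mem hk u, rfl⟩

/-- The map from the cohomology at a finite level to that of the limit. -/
noncomputable def toLimit (i n : ℕ) :
    Hgrp 3 (Γ i) n →ₗ[ZMod 3] ZE n ⧸ (BE n).comap (ZE n).subtype :=
  Submodule.mapQ _ _ (((infl q i n).comp (cocycles 3 (Γ i) n).subtype).codRestrict (ZE n)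
    fun f => infl_mem_ZE hk f.2) fun _ hf => infl_mem_BE hk hf

include hs hp in
lemma exists_Htrans_eq_zero {i n : ℕ} {x : Hgrp 3 (Γ i) n} (hx : toLimit hk i n x = 0) :
    ∃ j, ∃ hij : i ≤ j, Htrans π n i j hij x = 0 := by
  obtain ⟨f, rfl⟩ := Submodule.Quotient.mk_surjective _ x
  have hB : infl q i n (f : Fn (Γ i) n) ∈ BE n :=
    (Submodule.Quotient.mk_eq_zero ((BE n).comap (ZE n).subtype)).1 hx
  cases n with
  | zero =>
    have e := mem_Bc_zero.1 hB
    have e' : (f : Fn (Γ i) 0) = 0 := infl_injective hs (e.trans (map_zero _).symm)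
    rw [show f = 0 from Subtype.ext e', Submodule.Quotient.mk_zero]
    exact ⟨i, le_rfl, map_zero _⟩
  | succ n =>
    obtain ⟨y, hy, e⟩ := mem_Bc_succ.1 hB
    obtain ⟨j, hj⟩ := exists_infl hk hs hy
    obtain ⟨u, rfl⟩ := hj (max i j) (le_max_right _ _)
    obtain ⟨f', e1, e2⟩ := Htrans_mk hp (le_max_left i j) f
    refine ⟨max i j, le_max_left _ _, ?_⟩
    rw [e1]
    refine (Submodule.Quotient.mk_eq_zero _).2 ⟨u, infl_injective hs ?_⟩
    rw [← hd_infl, e]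
    exact e2.symm

include hk hs hp in
lemma finrank_limit (n : ℕ) : Module.finrank (ZMod 3)
    (Module.DirectLimit (fun i => Hgrp 3 (Γ i) n) (Htrans π n)) = dimPos n := by
  have compat : ∀ i j hij x, toLimit hk j n (Htrans π n i j hij x) = toLimit hk i n x := by
    intro i j hij x
    obtain ⟨f, rfl⟩ := Submodule.Quotient.mk_surjective _ x
    obtain ⟨f', e1, e2⟩ := Htrans_mk hp hij f
    rw [e1]
    exact congrArg Submodule.Quotient.mk (Subtype.ext e2)
  rw [← (hasDim_Ec n).finrank]
  refine LinearEquiv.finrank_eq (LinearEquiv.ofBijective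
    (Module.DirectLimit.lift _ _ _ _ (fun i => toLimit hk i n) compat) ⟨?_, fun z => ?_⟩)
  · intro x y hxy
    obtain ⟨i, x, y, rfl, rfl⟩ := Module.DirectLimit.exists_of₂ x y
    rw [Module.DirectLimit.lift_of, Module.DirectLimit.lift_of] at hxy
    obtain ⟨j, hij, h⟩ := exists_Htrans_eq_zero hk hs hp (x := x - y)
      (by rw [map_sub, hxy, sub_self])
    rw [map_sub, sub_eq_zero] at h
    rw [← Module.DirectLimit.of_f (hij := hij), h, Module.DirectLimit.of_f]
  · obtain ⟨⟨z, hz⟩, rfl⟩ := Submodule.Quotient.mk_surjective _ z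
    obtain ⟨i, hi⟩ := exists_infl hk hs hz.1
    obtain ⟨u, rfl⟩ := hi i le_rfl
    have hu : u ∈ cocycles 3 (Γ i) n := by
      refine LinearMap.mem_ker.2 (infl_injective hs ?_)
      rw [← hd_infl, map_zero]
      exact hz.2
    exact ⟨Module.DirectLimit.of _ _ _ _ i (Submodule.Quotient.mk ⟨u, hu⟩),
      Module.DirectLimit.lift_of _ _ _⟩

end Limit

/-- Reduction to a finite level. -/
noncomputable def redLevel (i : ℕ) : GZ →* GL (Fin 2) (ZMod (3 ^ (i + 1))) :=
  Matrix.GeneralLinearGroup.map (PadicInt.toZModPow (i + 1))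

lemma toZModPow_surjective (i : ℕ) :
    Function.Surjective (PadicInt.toZModPow (p := 3) i) := ZMod.ringHom_surjective _

lemma redLevel_surjective (i : ℕ) : Function.Surjective (redLevel i) := by
  intro x
  choose s hs using toZModPow_surjective (i + 1)
  have : Nontrivial (ZMod (3 ^ (i + 1))) :=
    ZMod.nontrivial_iff.2 (Nat.one_lt_pow (by omega) (by omega)).ne'
  have hloc : IsLocalHom (PadicInt.toZModPow (p := 3) (i + 1)) :=
    .of_surjective _ (toZModPow_surjective _)
  let A : R := fun a b => s ((x : Matrix _ _ _) a b)
  have hA : A.map (PadicInt.toZModPow (p := 3) (i + 1)) = x := by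
    funext a b
    exact hs _
  have hdet : IsUnit A.det := by
    refine hloc.map_nonunit _ ?_
    rw [RingHom.map_det, RingHom.mapMatrix_apply, hA]
    exact (Matrix.isUnit_iff_isUnit_det _).1 x.isUnit
  exact ⟨Matrix.GeneralLinearGroup.mk'' A hdet, Units.ext hA⟩

lemma toZModPow_eq_iff {i : ℕ} {a b : ℤ_[3]} :
    PadicInt.toZModPow i a = PadicInt.toZModPow i b ↔ ∃ c, b = a + 3 ^ i * c := by
  rw [eq_comm, ← sub_eq_zero, ← map_sub, ← RingHom.mem_ker, PadicInt.ker_toZModPow,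
    Ideal.mem_span_singleton']
  refine exists_congr fun c => ?_
  push_cast
  constructor <;> intro h <;> linear_combination -h

lemma redLevel_eq_iff (i : ℕ) (x y : GZ) : redLevel i x = redLevel i y ↔ Cg (i + 1) x y := by
  constructor
  · intro h
    have h' : ((redLevel i x).1 : Matrix _ _ _) = (redLevel i y).1 := by rw [h]
    have : ∀ a b, ∃ c, (y : R) a b = (x : R) a b + 3 ^ (i + 1) * c := fun a b =>
      toZModPow_eq_iff.1 (congrFun (congrFun h' a) b)
    choose c hc using this
    refine ⟨Matrix.of c, Matrix.ext fun a b => ?_⟩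
    rw [Matrix.add_apply, Matrix.smul_apply, hc, nsmul_eq_mul]
    push_cast
    rfl
  · rintro ⟨w, hw⟩
    refine Units.ext (Matrix.ext fun a b => toZModPow_eq_iff.2 ⟨w a b, ?_⟩)
    rw [hw, Matrix.add_apply, Matrix.smul_apply, nsmul_eq_mul]
    push_cast
    rfl

lemma map_redLevel (i : ℕ) (x : GZ) :
    Matrix.GeneralLinearGroup.map (ZMod.castHom (pow_dvd_pow 3 (Nat.le_succ (i + 1)))
      (ZMod (3 ^ (i + 1)))) (redLevel (i + 1) x) = redLevel i x :=
  Units.ext (Matrix.ext fun _ _ =>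
    RingHom.congr_fun (PadicInt.zmod_cast_comp_toZModPow (p := 3) _ _ (Nat.le_succ (i + 1))) _)

end GL2Coh

set_option synthInstance.maxHeartbeats 1000000 in
set_option maxHeartbeats 1000000 in
/-- **Continuous mod-3 cohomology of `GL₂(ℤ_3)` (additive form).**
With `G_i = GL₂(ℤ/3^i)` and inflation maps induced by the reductions `G_{i+1} → G_i`, the
direct limit `colim_i H^n(G_i; 𝔽₃)` (which computes `H^n_c(GL₂(ℤ_3); 𝔽₃)`) has `𝔽₃`-dimension
`1, 1, 0, 2` for `n = 0, 1, 2, 3`, and for `n ≥ 4` dimension `3` if `n ≡ 0, 3 (mod 4)` and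
`1` if `n ≡ 1, 2 (mod 4)`; this is the additive form of
`H^*_c(GL₂(ℤ_3); 𝔽₃) ≅ 𝔽₃[X] ⊗ Λ(Z₁, Z₂, Z₃)` with `|Z₁| = 1`, `|Z₂| = |Z₃| = 3`,
`|X| = 4`. -/
theorem continuous_cohomology_GL2_Z3 (n : ℕ) :
    Module.finrank (ZMod 3)
      (Module.DirectLimit (fun i => Hgrp 3 (GL (Fin 2) (ZMod (3 ^ (i + 1)))) n)
        (Htrans (fun i =>
          Matrix.GeneralLinearGroup.map
            (ZMod.castHom (pow_dvd_pow 3 (Nat.le_succ (i + 1))) (ZMod (3 ^ (i + 1))))) n)) =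
      if n = 0 then 1
      else if n = 1 then 1
      else if n = 2 then 0
      else if n = 3 then 2
      else if n % 4 = 0 ∨ n % 4 = 3 then 3
      else 1 := by
  exact GL2Coh.finrank_limit GL2Coh.redLevel_eq_iff GL2Coh.redLevel_surjective
    GL2Coh.map_redLevel n
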